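/- arXiv:1705.07960 — 2 statements merged into one kernel-verified Lean document; each statement's English description precedes it below -/
import Mathlib

section
/- (Generalized de Bruijn–Erdős theorem) Let V be a d-dimensional vector space over a field K and let E be a finite subset of V that spans V. Then for every k with k ≤ d/2, the number of k-dimensional subspaces of V of the form span(S) for some S ⊆ E is at most the number of (d−k)-dimensional subspaces of V of the form span(S) for some S ⊆ E. -/
open Classical in
/-- The number of subspaces of `V` of dimension `k` spanned by a subset of `E`. -/
noncomputable def numSpannedSubspaces (K : Type*) {V : Type*} [Field K] [AddCommGroup V]
    [Module K V] (E : Finset V) (k : ℕ) : ℕ :=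
  ((E.powerset.image fun S : Finset V => Submodule.span K (S : Set V)).filter
    fun W : Submodule K V => Module.finrank K W = k).card

namespace GDE
noncomputable section
open Classical
open Module
set_option linter.all false

variable {k V : Type*} [Field k] [AddCommGroup V] [Module k V] [FiniteDimensional k V]
  [Fintype (Submodule k V)]

/-- add a vector to a subspace -/
def pl (F : Submodule k V) (v : V) : Submodule k V := F ⊔ Submodule.span k {v}

lemma le_pl (F : Submodule k V) (v : V) : F ≤ pl F v := le_sup_left

lemma mem_pl (F : Submodule k V) (v : V) : v ∈ pl F v :=
  (le_sup_right : _ ≤ pl F v) (Submodule.mem_span_singleton_self v)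

lemma pl_le {F G : Submodule k V} {v : V} : pl F v ≤ G ↔ F ≤ G ∧ v ∈ G := by
  simp [pl, sup_le_iff, Submodule.span_singleton_le_iff_mem]

lemma pl_of_mem {F : Submodule k V} {v : V} (h : v ∈ F) : pl F v = F :=
  le_antisymm (pl_le.2 ⟨le_rfl, h⟩) (le_pl _ _)

lemma pl_comm (F : Submodule k V) (v w : V) : pl (pl F v) w = pl (pl F w) v := by
  simp only [pl, sup_assoc]; rw [sup_comm (Submodule.span k {v})]

lemma pl_mono {F G : Submodule k V} (h : F ≤ G) (v : V) : pl F v ≤ pl G v :=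
  sup_le_sup_right h _

lemma finrank_pl {F : Submodule k V} {v : V} (h : v ∉ F) :
    finrank k (pl F v) = finrank k F + 1 := Submodule.finrank_sup_span_singleton h

/-- exchange -/
lemma mem_pl_exchange {F : Submodule k V} {v w : V} (hw : w ∉ F) (h : w ∈ pl F v) :
    pl F w = pl F v := by
  have hv : v ∉ F := fun hv => hw (by rwa [pl_of_mem hv] at h)
  refine Submodule.eq_of_le_of_finrank_eq (pl_le.2 ⟨le_pl _ _, h⟩) ?_
  rw [finrank_pl hw, finrank_pl hv]

variable (k V) in
/-- the real vector space on all subspaces -/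
abbrev AA := Submodule k V → ℝ

/-- basis vector -/
def y (U : Submodule k V) : AA k V := Pi.single U 1

/-- raising operator -/
def Y (v : V) : AA k V →ₗ[ℝ] AA k V where
  toFun x := ∑ U, x U • (if v ∈ U then (0 : AA k V) else y (pl U v))
  map_add' x z := by simp only [Pi.add_apply, add_smul, Finset.sum_add_distrib]
  map_smul' c x := by simp only [Pi.smul_apply, smul_eq_mul, mul_smul, Finset.smul_sum, RingHom.id_apply]

lemma Y_y (v : V) (U : Submodule k V) :
    Y v (y U) = if v ∈ U then (0 : AA k V) else y (pl U v) := by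
  show ∑ U', (y U : AA k V) U' • (if v ∈ U' then (0 : AA k V) else y (pl U' v)) = _
  rw [Finset.sum_eq_single U]
  · simp [y]
  · intro b _ hb; simp [y, hb]
  · simp

lemma sum_y (x : AA k V) : x = ∑ U, x U • y U := by
  funext G
  simp [y, Finset.sum_apply, Pi.single_apply]

/-- supported above F -/
def A (F : Submodule k V) : Submodule ℝ (AA k V) where
  carrier := {x | ∀ U, ¬ F ≤ U → x U = 0}
  add_mem' := by intro a b ha hb U hU; simp [ha U hU, hb U hU]
  zero_mem' := by intro U _; rfl
  smul_mem' := by intro c a ha U hU; simp [ha U hU]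

/-- homogeneous of degree n -/
def H (n : ℕ) : Submodule ℝ (AA k V) where
  carrier := {x | ∀ U : Submodule k V, finrank k U ≠ n → x U = 0}
  add_mem' := by intro a b ha hb U hU; simp [ha U hU, hb U hU]
  zero_mem' := by intro U _; rfl
  smul_mem' := by intro c a ha U hU; simp [ha U hU]

/-- projection -/
def pr (n : ℕ) : AA k V →ₗ[ℝ] AA k V where
  toFun x := fun U => if finrank k U = n then x U else 0
  map_add' x z := by funext U; simp only [Pi.add_apply]; split_ifs <;> simp
  map_smul' c x := by funext U; simp

lemma pr_apply (n : ℕ) (x : AA k V) (U) : pr n x U = if finrank k U = n then x U else 0 := rfl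

lemma pr_mem (n : ℕ) (x : AA k V) : pr n x ∈ H n := by
  intro U hU; simp [pr_apply, hU]

lemma pr_of_mem {n : ℕ} {x : AA k V} (h : x ∈ H n) : pr n x = x := by
  funext U; rw [pr_apply]; split_ifs with hU
  · rfl
  · exact (h U hU).symm

lemma pr_of_mem_ne {n m : ℕ} {x : AA k V} (h : x ∈ H n) (hm : n ≠ m) : pr m x = 0 := by
  funext U; rw [pr_apply]; split_ifs with hU
  · exact h U (by omega)
  · rfl

lemma sum_pr (x : AA k V) : x = ∑ n ∈ Finset.range (finrank k V + 1), pr n x := by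
  funext U
  rw [Finset.sum_apply]
  simp only [pr_apply]
  rw [Finset.sum_ite_eq]
  rw [if_pos]
  rw [Finset.mem_range]
  exact Nat.lt_succ_of_le (Submodule.finrank_le U)

lemma eq_zero_of_pr {x : AA k V} (h : ∀ n, pr n x = 0) : x = 0 := by
  rw [sum_pr x]; exact Finset.sum_eq_zero fun n _ => h n

lemma H_eq_zero {n : ℕ} {x : AA k V} (h : x ∈ H n) (hn : finrank k V < n) : x = 0 := by
  funext U; exact h U (by have := Submodule.finrank_le U; omega)

lemma AH_eq_zero {F : Submodule k V} {n : ℕ} {x : AA k V} (hx : x ∈ A F) (h : x ∈ H n)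
    (hn : n < finrank k F) : x = 0 := by
  funext U
  by_cases hU : F ≤ U
  · exact h U (by have := Submodule.finrank_mono hU; omega)
  · exact hx U hU

lemma AH_eq_smul {F : Submodule k V} {x : AA k V} (hx : x ∈ A F) (h : x ∈ H (finrank k F)) :
    x = x F • y F := by
  funext U
  by_cases hU : F = U
  · subst hU; simp [y]
  · simp [y, Pi.single_apply, Ne.symm hU]
    by_cases hFU : F ≤ U
    · exact h U (fun he => hU (Submodule.eq_of_le_of_finrank_eq hFU he.symm))
    · exact hx U hFU

lemma y_mem_A {F U : Submodule k V} (h : F ≤ U) : (y U : AA k V) ∈ A F := by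
  intro G hG; simp only [y, Pi.single_apply]; rw [if_neg]; rintro rfl; exact hG h

lemma y_mem_H (U : Submodule k V) : (y U : AA k V) ∈ H (finrank k U) := by
  intro G hG; simp only [y, Pi.single_apply]; rw [if_neg]; rintro rfl; exact hG rfl

lemma y_ne (U : Submodule k V) : (y U : AA k V) ≠ 0 := by
  intro h; have := congrFun h U; simp [y] at this

lemma A_mono {F G : Submodule k V} (h : F ≤ G) : (A G : Submodule ℝ (AA k V)) ≤ A F :=
  fun x hx U hU => hx U fun hG => hU (h.trans hG)

/-- induction on A F -/
lemma A_ind {F : Submodule k V} (P : Submodule ℝ (AA k V))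
    (h : ∀ U, F ≤ U → y U ∈ P) {x : AA k V} (hx : x ∈ A F) : x ∈ P := by
  rw [sum_y x]
  refine P.sum_mem fun U _ => ?_
  by_cases hU : F ≤ U
  · exact P.smul_mem _ (h U hU)
  · rw [hx U hU, zero_smul]; exact P.zero_mem

lemma H_ind {n : ℕ} (P : Submodule ℝ (AA k V))
    (h : ∀ U : Submodule k V, finrank k U = n → y U ∈ P) {x : AA k V} (hx : x ∈ H n) : x ∈ P := by
  rw [sum_y x]
  refine P.sum_mem fun U _ => ?_
  by_cases hU : finrank k U = n
  · exact P.smul_mem _ (h U hU)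
  · rw [hx U hU, zero_smul]; exact P.zero_mem

lemma A_bot (x : AA k V) : x ∈ A (⊥ : Submodule k V) := by intro U hU; simp at hU

lemma A_ext {M : Type*} [AddCommGroup M] [Module ℝ M] {F : Submodule k V}
    {f g : AA k V →ₗ[ℝ] M} (h : ∀ U, F ≤ U → f (y U) = g (y U)) {x : AA k V} (hx : x ∈ A F) :
    f x = g x :=
  A_ind (LinearMap.eqLocus f g) h hx

lemma Y_comm (v w : V) (x : AA k V) : Y v (Y w x) = Y w (Y v x) := by
  refine A_ext (F := ⊥) (f := Y v ∘ₗ Y w) (g := Y w ∘ₗ Y v) (fun U _ => ?_) (A_bot x)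
  simp only [LinearMap.comp_apply, Y_y]
  by_cases hv : v ∈ U <;> by_cases hw : w ∈ U
  · simp [hv, hw]
  · simp [hv, hw, Y_y, le_pl U w hv]
  · simp [hv, hw, Y_y, le_pl U v hw]
  · simp only [hv, hw, if_false, Y_y]
    by_cases h : v ∈ pl U w
    · have := mem_pl_exchange hv h
      have h2 : w ∈ pl U v := this ▸ mem_pl U w
      simp [h, h2]
    · have h2 : w ∉ pl U v := fun h2 => h (by rw [mem_pl_exchange hw h2]; exact mem_pl U v)
      simp [h, h2, pl_comm]

lemma Y_mem_A {F : Submodule k V} {x : AA k V} (hx : x ∈ A F) (v : V) : Y v x ∈ A (pl F v) := by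
  refine A_ind ((A (pl F v)).comap (Y v)) (fun U hU => ?_) hx
  rw [Submodule.mem_comap, Y_y]
  split_ifs
  · exact Submodule.zero_mem _
  · exact y_mem_A (pl_mono hU v)

lemma Y_zero {F : Submodule k V} {x : AA k V} (hx : x ∈ A F) {v : V} (hv : v ∈ F) : Y v x = 0 := by
  refine A_ext (f := Y v) (g := 0) (fun U hU => ?_) hx
  rw [Y_y, if_pos (hU hv)]; rfl

lemma Y_mem_H {n : ℕ} {x : AA k V} (hx : x ∈ H n) (v : V) : Y v x ∈ H (n + 1) := by
  refine H_ind ((H (n+1)).comap (Y v)) (fun U hU => ?_) hx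
  rw [Submodule.mem_comap, Y_y]
  split_ifs with h
  · exact Submodule.zero_mem _
  · rw [← hU, ← finrank_pl h]; exact y_mem_H _

lemma pr_Y (n : ℕ) (v : V) (x : AA k V) : pr (n + 1) (Y v x) = Y v (pr n x) := by
  refine A_ext (F := ⊥) (f := pr (n+1) ∘ₗ Y v) (g := Y v ∘ₗ pr n) (fun U _ => ?_) (A_bot x)
  simp only [LinearMap.comp_apply]
  by_cases h : finrank k U = n
  · have hU : (y U : AA k V) ∈ H n := h ▸ y_mem_H U
    rw [pr_of_mem hU, pr_of_mem (Y_mem_H hU v)]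
  · rw [pr_of_mem_ne (y_mem_H U) h, map_zero,
      pr_of_mem_ne (Y_mem_H (y_mem_H U) v) (by omega)]

lemma pr_Y_zero (v : V) (x : AA k V) : pr 0 (Y v x) = 0 := by
  refine A_ext (F := ⊥) (f := pr 0 ∘ₗ Y v) (g := 0) (fun U _ => ?_) (A_bot x)
  exact pr_of_mem_ne (Y_mem_H (y_mem_H U) v) (by omega)

lemma Y_congr {F : Submodule k V} {x : AA k V} (hx : x ∈ A F) {v w : V} (h : pl F v = pl F w)
    : Y v x = Y w x := by
  refine A_ext (f := Y v) (g := Y w) (fun U hU => ?_) hx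
  have h1 : pl U v = pl U w := by
    have : ∀ a, pl U a = U ⊔ pl F a := fun a => by
      simp only [pl, ← sup_assoc, sup_eq_left.2 hU]
    rw [this, this, h]
  have h2 : v ∈ U ↔ w ∈ U := by
    constructor
    · intro hv; rw [pl_of_mem hv] at h1; rw [h1]; exact mem_pl _ _
    · intro hv; rw [pl_of_mem hv] at h1; rw [← h1]; exact mem_pl _ _
  simp only [Y_y, h1, h2]

/-- the pairing -/
def B (f : ℕ) : LinearMap.BilinForm ℝ (AA k V) :=
  Matrix.toBilin' (Matrix.of fun U U' : Submodule k V =>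
    if U ⊔ U' = ⊤ ∧ finrank k U + finrank k U' = finrank k V + f then (1 : ℝ) else 0)

lemma B_y (f : ℕ) (U U' : Submodule k V) : B f (y U) (y U') =
    if U ⊔ U' = ⊤ ∧ finrank k U + finrank k U' = finrank k V + f then (1 : ℝ) else 0 := by
  simp only [B, y, Matrix.toBilin'_single, Matrix.of_apply]

lemma B_symm (f : ℕ) (x z : AA k V) : B f x z = B f z x := by
  refine A_ext (F := ⊥) (f := B f) (g := (B f).flip) (fun U _ => ?_) (A_bot x) ▸ rfl
  refine LinearMap.ext fun z => ?_
  refine A_ext (F := ⊥) (f := B f (y U)) (g := (B f).flip (y U)) (fun U' _ => ?_) (A_bot z)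
  show B f (y U) (y U') = B f (y U') (y U)
  rw [B_y, B_y, sup_comm U U', add_comm (finrank k U)]

/-- adjunction -/
lemma B_adj {F : Submodule k V} {v : V} (hv : v ∉ F) {x z : AA k V} (hx : x ∈ A F)
    (hz : z ∈ A (pl F v)) :
    B (finrank k F) x z = B (finrank k F + 1) (Y v x) z := by
  refine A_ext (f := (B (finrank k F)).flip z) (g := ((B (finrank k F + 1)).flip z) ∘ₗ Y v)
    (fun U hU => ?_) hx
  refine A_ext (f := B (finrank k F) (y U)) (g := B (finrank k F + 1) (Y v (y U)))
    (fun U' hU' => ?_) hz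
  rw [Y_y]
  rw [pl_le] at hU'
  split_ifs with h
  · rw [B_y, if_neg]
    · simp
    · rintro ⟨h1, h2⟩
      have h3 := Submodule.finrank_sup_add_finrank_inf_eq U U'
      rw [h1, finrank_top] at h3
      have h4 : pl F v ≤ U ⊓ U' := pl_le.2 ⟨le_inf hU hU'.1, h, hU'.2⟩
      have h5 := Submodule.finrank_mono h4
      rw [finrank_pl hv] at h5
      omega
  · rw [B_y, B_y, finrank_pl h]
    have : pl U v ⊔ U' = U ⊔ U' := by
      rw [pl, sup_assoc, sup_eq_right.2 (show Submodule.span k {v} ≤ U' by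
        rw [Submodule.span_singleton_le_iff_mem]; exact hU'.2)]
    rw [this]
    congr 2
    simp only [eq_iff_iff]; omega

lemma B_YY {F : Submodule k V} {v : V} (hv : v ∉ F) {x z : AA k V} (hx : x ∈ A F)
    (hz : z ∈ A F) :
    B (finrank k F) x (Y v z) = B (finrank k F + 1) (Y v x) (Y v z) :=
  B_adj hv hx (Y_mem_A hz v)

lemma B_self {F : Submodule k V} (v : V) {x z : AA k V} (hx : x ∈ A F)
    (hz : z ∈ A F) :
    B (finrank k F) x (Y v z) = B (finrank k F) (Y v x) z := by
  by_cases hv : v ∈ F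
  · rw [Y_zero hx hv, Y_zero hz hv]; simp
  · rw [B_YY hv hx hz, B_symm, ← B_YY hv hz hx, B_symm]

lemma B_deg {f a b : ℕ} {x z : AA k V} (hx : x ∈ H a) (hz : z ∈ H b)
    (h : a + b ≠ finrank k V + f) : B f x z = 0 := by
  have hx' : x ∈ LinearMap.ker ((B f).flip z) := by
    refine H_ind _ (fun U hU => ?_) hx
    have : z ∈ LinearMap.ker (B f (y U)) := by
      refine H_ind _ (fun U' hU' => ?_) hz
      rw [LinearMap.mem_ker, B_y, if_neg]
      rintro ⟨-, h2⟩; omega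
    exact this
  exact hx'

lemma B_pr {f a b : ℕ} {x z : AA k V} (hx : x ∈ H a) (h : a + b = finrank k V + f) :
    B f x z = B f x (pr b z) := by
  conv_lhs => rw [sum_pr z]
  rw [map_sum]
  by_cases hb : b ∈ Finset.range (finrank k V + 1)
  · rw [Finset.sum_eq_single_of_mem b hb]
    intro c _ hc
    exact B_deg hx (pr_mem c z) (by omega)
  · have : pr b z = 0 := H_eq_zero (pr_mem b z) (by simpa using hb)
    rw [this, map_zero]
    refine Finset.sum_eq_zero fun c hc => B_deg hx (pr_mem c z) ?_
    rintro h'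
    have : b = c := by omega
    exact hb (this ▸ hc)

end
end GDE

namespace GDE
noncomputable section
open Module
set_option linter.all false

lemma psd_zero {X : Type*} [AddCommGroup X] [Module ℝ X] (q : LinearMap.BilinForm ℝ X)
    (hs : ∀ x z, q x z = q z x) (W : Submodule ℝ X) (hp : ∀ x ∈ W, 0 ≤ q x x) {x z : X}
    (hx : x ∈ W) (hz : z ∈ W) (h : q x x = 0) : q x z = 0 := by
  have key : ∀ s : ℝ, 0 ≤ 2 * s * q x z + s ^ 2 * q z z := by
    intro s
    have := hp (x + s • z) (W.add_mem hx (W.smul_mem s hz))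
    simp only [map_add, map_smul, LinearMap.add_apply, LinearMap.smul_apply, smul_eq_mul, h,
      hs z x] at this
    nlinarith
  have hz0 := hp z hz
  by_contra hne
  have h1 := key (- q x z / (q z z + 1))
  have hpos : 0 < q z z + 1 := by linarith
  have : 2 * (- q x z / (q z z + 1)) * q x z + (- q x z / (q z z + 1)) ^ 2 * q z z
      = - (q x z) ^ 2 * (q z z + 2) / (q z z + 1) ^ 2 := by
    field_simp; ring
  rw [this] at h1
  have h2 : 0 < (q x z) ^ 2 := by positivity
  have h3 : - (q x z) ^ 2 * (q z z + 2) / (q z z + 1) ^ 2 < 0 := by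
    apply div_neg_of_neg_of_pos
    · nlinarith
    · positivity
  linarith

lemma deform {T X Z : Type*} [TopologicalSpace T] [PreconnectedSpace T]
    [NormedAddCommGroup X] [NormedSpace ℝ X] [FiniteDimensional ℝ X]
    [NormedAddCommGroup Z] [NormedSpace ℝ Z] [FiniteDimensional ℝ Z]
    (N : T → X →L[ℝ] Z) (hN : Continuous N)
    (q : T → LinearMap.BilinForm ℝ X) (hq : Continuous fun p : T × X => q p.1 p.2 p.2)
    (hs : ∀ t x z, q t x z = q t z x)
    (hsurj : ∀ t, Function.Surjective (N t))
    (hnd : ∀ t x, N t x = 0 → (∀ z, N t z = 0 → q t x z = 0) → x = 0)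
    (t₁ : T) (h₁ : ∀ x, N t₁ x = 0 → x ≠ 0 → 0 < q t₁ x x) (t : T) :
    ∀ x, N t x = 0 → x ≠ 0 → 0 < q t x x := by
  set S : Set T := {t | ∀ x, N t x = 0 → x ≠ 0 → 0 < q t x x} with hS
  have hNj : Continuous fun p : T × X => N p.1 p.2 :=
    (hN.comp continuous_fst).clm_apply continuous_snd
  have hopen : IsOpen S := by
    haveI : CompactSpace (Metric.sphere (0 : X) 1) :=
      isCompact_iff_compactSpace.1 (isCompact_sphere (0 : X) 1)
    let C : Set (T × Metric.sphere (0 : X) 1) :=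
      {p | N p.1 p.2 = 0 ∧ q p.1 p.2 p.2 ≤ 0}
    have hmap : Continuous fun p : T × Metric.sphere (0 : X) 1 => ((p.1, (p.2 : X)) : T × X) :=
      continuous_fst.prodMk (continuous_subtype_val.comp continuous_snd)
    have hC : IsClosed C := by
      refine IsClosed.inter ?_ ?_
      · exact isClosed_eq (hNj.comp hmap) continuous_const
      · exact isClosed_le (hq.comp hmap) continuous_const
    have hcl : IsClosed (Prod.fst '' C) := isClosedMap_fst_of_compactSpace _ hC
    have : S = (Prod.fst '' C)ᶜ := by
      ext t
      simp only [hS, Set.mem_setOf_eq, Set.mem_compl_iff, Set.mem_image, Prod.exists,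
        exists_and_right, exists_eq_right]
      constructor
      · rintro h ⟨⟨x, hx⟩, h1, h2⟩
        have hx0 : x ≠ 0 := by
          rintro rfl; simp at hx
        exact absurd (h x h1 hx0) (not_lt.2 h2)
      · intro h x hx hx0
        by_contra hc
        refine h ⟨⟨‖x‖⁻¹ • x, ?_⟩, ?_, ?_⟩
        · simp [norm_smul, hx0]
        · simp [hx]
        · simp only [map_smul, LinearMap.smul_apply, smul_eq_mul]
          push Not at hc
          have : 0 < ‖x‖⁻¹ := by positivity
          nlinarith [mul_nonneg this.le this.le]
    rw [this]; exact hcl.isOpen_compl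
  have hclosed : IsClosed S := by
    rw [← isOpen_compl_iff, isOpen_iff_mem_nhds]
    intro t ht
    obtain ⟨x, hx, hneg⟩ : ∃ x, N t x = 0 ∧ q t x x < 0 := by
      by_contra hc
      push Not at hc
      apply ht
      intro x hx hx0
      refine lt_of_le_of_ne (hc x hx) fun h => hx0 ?_
      refine hnd t x hx fun z hz => ?_
      exact psd_zero (q t) (hs t) (LinearMap.ker (N t).toLinearMap) (fun x hx => hc x hx) hx hz h.symm
    obtain ⟨R0, hR0⟩ := LinearMap.exists_rightInverse_of_surjective (N t).toLinearMap
      (LinearMap.range_eq_top.2 (hsurj t))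
    let R : Z →L[ℝ] X := LinearMap.toContinuousLinearMap R0
    have hR : (N t).comp R = 1 := by
      ext z; exact LinearMap.congr_fun hR0 z
    haveI : CompleteSpace Z := FiniteDimensional.complete ℝ Z
    let M : T → Z →L[ℝ] Z := fun s => (N s).comp R
    have hM : Continuous M := hN.clm_comp continuous_const
    have hMt : M t = 1 := hR
    have hunit : ∀ᶠ s in nhds t, IsUnit (M s) := by
      have : {u : Z →L[ℝ] Z | IsUnit u} ∈ nhds (M t) := by
        rw [hMt]; exact Units.isOpen.mem_nhds isUnit_one
      exact hM.continuousAt this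
    have hinv : ContinuousAt (fun s => Ring.inverse (M s)) t := by
      have : ContinuousAt Ring.inverse (M t) := by
        rw [hMt]; exact NormedRing.inverse_continuousAt 1
      exact ContinuousAt.comp this hM.continuousAt
    let xs : T → X := fun s => x - R (Ring.inverse (M s) (N s x))
    have hxs : ContinuousAt xs t := by
      refine continuousAt_const.sub ?_
      refine R.continuous.continuousAt.comp ?_
      exact hinv.clm_apply (hN.clm_apply continuous_const).continuousAt
    have hxst : xs t = x := by simp [xs, hx]
    have hqc : ContinuousAt (fun s => q s (xs s) (xs s)) t :=
      ContinuousAt.comp (g := fun p : T × X => q p.1 p.2 p.2) (f := fun s => (s, xs s))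
        hq.continuousAt (continuousAt_id.prodMk hxs)
    have hev : ∀ᶠ s in nhds t, q s (xs s) (xs s) < 0 := by
      apply hqc.eventually_lt continuousAt_const
      simpa [hxst] using hneg
    filter_upwards [hunit, hev] with s h1 h2 hsS
    have hk : N s (xs s) = 0 := by
      have : M s (Ring.inverse (M s) (N s x)) = N s x := by
        have := congrArg (fun g : Z →L[ℝ] Z => g (N s x)) (Ring.mul_inverse_cancel (M s) h1)
        simpa using this
      simp only [xs, map_sub]
      rw [sub_eq_zero]; exact this.symm
    have h0 : xs s ≠ 0 := by
      intro h; rw [h] at h2; simp at h2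
    exact absurd (hsS _ hk h0) (not_lt.2 h2.le)
  have : S = Set.univ := IsClopen.eq_univ ⟨hclosed, hopen⟩ ⟨t₁, h₁⟩
  have ht : t ∈ S := this ▸ Set.mem_univ t
  exact ht

end
end GDE

namespace GDE
noncomputable section
open Classical
open Module
set_option linter.all false

variable {k V : Type*} [Field k] [AddCommGroup V] [Module k V] [FiniteDimensional k V]
  [Fintype (Submodule k V)]

/-- Lefschetz-type operator with weights -/
def ell (c : V → ℝ) (E : Finset V) : AA k V →ₗ[ℝ] AA k V := ∑ v ∈ E, c v • Y v

lemma ell_apply (c : V → ℝ) (E : Finset V) (x : AA k V) : ell c E x = ∑ v ∈ E, c v • Y v x := by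
  simp [ell, LinearMap.sum_apply]

lemma ell_Y (c : V → ℝ) (E : Finset V) (v : V) (x : AA k V) :
    ell c E (Y v x) = Y v (ell c E x) := by
  simp only [ell_apply, map_sum, map_smul]
  exact Finset.sum_congr rfl fun w _ => by rw [Y_comm]

lemma ell_pow_Y (c : V → ℝ) (E : Finset V) (v : V) (m : ℕ) (x : AA k V) :
    (ell c E ^ m) (Y v x) = Y v ((ell c E ^ m) x) := by
  induction m with
  | zero => simp
  | succ m ih => rw [pow_succ', Module.End.mul_apply, ih, ell_Y, Module.End.mul_apply]

lemma pow_mem {M : Type*} [AddCommGroup M] [Module ℝ M] {T : M →ₗ[ℝ] M} {J : Submodule ℝ M}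
    (h : ∀ x ∈ J, T x ∈ J) (m : ℕ) : ∀ x ∈ J, (T ^ m) x ∈ J := by
  induction m with
  | zero => intro x hx; simpa using hx
  | succ m ih => intro x hx; rw [pow_succ', Module.End.mul_apply]; exact h _ (ih x hx)

lemma pow_mem_H {T : AA k V →ₗ[ℝ] AA k V} (h : ∀ n, ∀ x ∈ H n, T x ∈ H (n + 1)) (m : ℕ) :
    ∀ n, ∀ x ∈ H n, (T ^ m) x ∈ H (n + m) := by
  induction m with
  | zero => intro n x hx; simpa using hx
  | succ m ih => intro n x hx; rw [pow_succ', Module.End.mul_apply]; exact h _ _ (ih n x hx)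

lemma pow_self {f : ℕ} {T : AA k V →ₗ[ℝ] AA k V} {J : Submodule ℝ (AA k V)}
    (h : ∀ x ∈ J, T x ∈ J) (hs : ∀ x ∈ J, ∀ z ∈ J, B f x (T z) = B f (T x) z) (m : ℕ) :
    ∀ x ∈ J, ∀ z ∈ J, B f x ((T ^ m) z) = B f ((T ^ m) x) z := by
  induction m with
  | zero => intro x _ z _; simp
  | succ m ih =>
    intro x hx z hz
    rw [pow_succ', Module.End.mul_apply, hs x hx _ (pow_mem h m z hz), ih _ (h x hx) z hz,
      ← Module.End.mul_apply, ← pow_succ, pow_succ']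

lemma ell_mem_H (c : V → ℝ) (E : Finset V) (n : ℕ) (x : AA k V) (hx : x ∈ H n) :
    ell c E x ∈ H (n + 1) := by
  rw [ell_apply]; exact Submodule.sum_mem _ fun v _ => Submodule.smul_mem _ _ (Y_mem_H hx v)

lemma ell_mem_A (c : V → ℝ) (E : Finset V) (F : Submodule k V) (x : AA k V) (hx : x ∈ A F) :
    ell c E x ∈ A F := by
  rw [ell_apply]; exact Submodule.sum_mem _ fun v _ => Submodule.smul_mem _ _
    (A_mono (le_pl F v) (Y_mem_A hx v))

lemma ell_self (c : V → ℝ) (E : Finset V) (F : Submodule k V) (x : AA k V) (hx : x ∈ A F)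
    (z : AA k V) (hz : z ∈ A F) :
    B (finrank k F) x (ell c E z) = B (finrank k F) (ell c E x) z := by
  simp only [ell_apply, map_sum, map_smul, LinearMap.sum_apply, LinearMap.smul_apply]
  exact Finset.sum_congr rfl fun w _ => by rw [B_self w hx hz]

/-- surjectivity by duality -/
lemma surj_of_inj {f a b : ℕ} (M : ℕ) (hb : b = a + M) {T : AA k V →ₗ[ℝ] AA k V}
    {J : Submodule ℝ (AA k V)}
    (hab : a + b = finrank k V + f)
    (hg : ∀ n, ∀ x ∈ J, pr n x ∈ J)
    (hnd : ∀ x ∈ J, (∀ z ∈ J, B f x z = 0) → x = 0)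
    (hJ : ∀ x ∈ J, T x ∈ J) (hH : ∀ n, ∀ x ∈ H n, T x ∈ H (n + 1))
    (hinj : ∀ x ∈ J, x ∈ H a → (T ^ M) x = 0 → x = 0) :
    ∀ z ∈ J, z ∈ H b → ∃ x ∈ J, x ∈ H a ∧ (T ^ M) x = z := by
  let Xa : Submodule ℝ (AA k V) := J ⊓ H a
  let Xb : Submodule ℝ (AA k V) := J ⊓ H b
  have hmap : ∀ x ∈ Xa, (T ^ M) x ∈ Xb := fun x hx =>
    ⟨pow_mem hJ M x hx.1, hb ▸ pow_mem_H hH M a x hx.2⟩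
  let φ : Xa →ₗ[ℝ] Xb := (T ^ M).restrict hmap
  have hφ : Function.Injective φ := by
    rw [injective_iff_map_eq_zero]
    rintro ⟨x, hx⟩ h
    have h' : (T ^ M) x = 0 := congrArg Subtype.val h
    exact Subtype.ext (hinj x hx.1 hx.2 h')
  let ψ : Xb →ₗ[ℝ] Dual ℝ Xa := (B f).domRestrict₁₂ Xb Xa
  have hψ : Function.Injective ψ := by
    rw [injective_iff_map_eq_zero]
    rintro ⟨x, hx⟩ h
    refine Subtype.ext (hnd x hx.1 fun z hz => ?_)
    rw [B_pr hx.2 (show b + a = _ by omega)]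
    exact LinearMap.congr_fun h ⟨pr a z, hg a z hz, pr_mem a z⟩
  have h1 := LinearMap.finrank_le_finrank_of_injective hφ
  have h2 := LinearMap.finrank_le_finrank_of_injective hψ
  rw [Subspace.dual_finrank_eq] at h2
  have h3 := (LinearMap.injective_iff_surjective_of_finrank_eq_finrank (le_antisymm h1 h2)).1 hφ
  intro z hz hzb
  obtain ⟨⟨x, hx⟩, h⟩ := h3 ⟨z, hz, hzb⟩
  exact ⟨x, hx.1, hx.2, congrArg Subtype.val h⟩

/-- Hodge-Riemann type property -/
def HR (f : ℕ) (T : AA k V →ₗ[ℝ] AA k V) (J : Submodule ℝ (AA k V)) : Prop :=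
  ∀ n m, ∀ x ∈ J, x ∈ H n → 2 * n + m = finrank k V + f → (T ^ (m + 1)) x = 0 → x ≠ 0 →
    0 < (-1) ^ (n + f) * B f ((T ^ m) x) x

lemma B_cont (f : ℕ) : Continuous fun p : AA k V × AA k V => B f p.1 p.2 := by
    have : (fun p : AA k V × AA k V => B f p.1 p.2) = fun p => ∑ U, ∑ U', p.1 U * p.2 U' *
        B f (y U) (y U') := by
      funext p
      conv_lhs => rw [sum_y p.1, sum_y p.2]
      simp only [map_sum, map_smul, LinearMap.sum_apply, LinearMap.smul_apply, smul_eq_mul,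
        Finset.mul_sum]
      rw [Finset.sum_comm]
      exact Finset.sum_congr rfl fun _ _ => Finset.sum_congr rfl fun _ _ => by ring
    rw [this]
    fun_prop

lemma B_cont2 (f : ℕ) {P : Type*} [TopologicalSpace P] {g h : P → AA k V} (hg : Continuous g)
    (hh : Continuous h) : Continuous fun p => B f (g p) (h p) :=
  Continuous.comp (g := fun p : AA k V × AA k V => B f p.1 p.2) (f := fun p => (g p, h p))
    (B_cont (k := k) (V := V) f) (hg.prodMk hh)

set_option maxHeartbeats 1000000 in
lemma deformHR {f : ℕ} {J : Submodule ℝ (AA k V)}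
    (hg : ∀ n, ∀ x ∈ J, pr n x ∈ J)
    (hnd : ∀ x ∈ J, (∀ z ∈ J, B f x z = 0) → x = 0)
    (T : unitInterval → AA k V →ₗ[ℝ] AA k V)
    (hT : Continuous fun t => LinearMap.toContinuousLinearMap (T t))
    (hJ : ∀ t, ∀ x ∈ J, T t x ∈ J) (hH : ∀ t n, ∀ x ∈ H n, T t x ∈ H (n + 1))
    (hs : ∀ t, ∀ x ∈ J, ∀ z ∈ J, B f x (T t z) = B f (T t x) z)
    (hHL : ∀ t n m, ∀ x ∈ J, x ∈ H n → 2 * n + m = finrank k V + f → (T t ^ m) x = 0 → x = 0)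
    (t₁ : unitInterval) (h₁ : HR f (T t₁) J) (t : unitInterval) : HR f (T t) J := by
  intro n m x hx hxn hnm hx1 hx0
  let X : Submodule ℝ (AA k V) := J ⊓ H n
  let Z : Submodule ℝ (AA k V) := J ⊓ H (n + (m + 1))
  obtain ⟨P0, hP0⟩ := LinearMap.exists_leftInverse_of_injective Z.subtype
    (LinearMap.ker_eq_bot.2 Z.injective_subtype)
  let P : AA k V →L[ℝ] Z := LinearMap.toContinuousLinearMap P0
  have hP : ∀ z (hz : z ∈ Z), P z = ⟨z, hz⟩ := fun z hz => LinearMap.congr_fun hP0 ⟨z, hz⟩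
  let Tc : unitInterval → AA k V →L[ℝ] AA k V := fun t => LinearMap.toContinuousLinearMap (T t)
  have hTc : ∀ t m z, (Tc t ^ m) z = (T t ^ m) z := by
    intro t m
    induction m with
    | zero => intro z; simp
    | succ m ih =>
      intro z
      rw [pow_succ', pow_succ', Module.End.mul_apply, ← ih]; rfl
  let N : unitInterval → X →L[ℝ] Z := fun t => (P.comp (Tc t ^ (m + 1))).comp X.subtypeL
  have hmem : ∀ t, ∀ x ∈ X, (T t ^ (m+1)) x ∈ Z := fun t x hx =>
    ⟨pow_mem (hJ t) _ x hx.1, pow_mem_H (hH t) _ n x hx.2⟩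
  have hNz : ∀ t (x : X), N t x = ⟨(T t ^ (m+1)) x, hmem t x x.2⟩ := by
    intro t x
    show P ((Tc t ^ (m+1)) x) = _
    rw [hTc, hP]
  have hNz0 : ∀ t (x : X), N t x = 0 ↔ (T t ^ (m+1)) x = 0 := by
    intro t x; rw [hNz]; simp
  let q : unitInterval → LinearMap.BilinForm ℝ X := fun t =>
    ((-1 : ℝ) ^ (n + f)) • ((B f).comp ((T t ^ m) ∘ₗ X.subtype) X.subtype)
  have hqv : ∀ t x z, q t x z = (-1) ^ (n + f) * B f ((T t ^ m) x) z := fun t x z => rfl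
  have hN : Continuous N := (continuous_const.clm_comp (hT.pow (m+1))).clm_comp continuous_const
  have hq : Continuous fun p : unitInterval × X => q p.1 p.2 p.2 := by
    have e0 : (fun p : unitInterval × X => q p.1 p.2 p.2) = fun p : unitInterval × X =>
      (-1) ^ (n + f) * B f ((T p.1 ^ m) p.2) p.2 := funext fun p => hqv _ _ _
    rw [e0]
    refine continuous_const.mul ?_
    have e1 : Continuous fun t => Tc t ^ m := hT.pow m
    have e2 : Continuous fun p : unitInterval × X => Tc p.1 ^ m := e1.comp continuous_fst
    have e3 : Continuous fun p : unitInterval × X => (p.2 : AA k V) :=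
      continuous_subtype_val.comp continuous_snd
    have e4 : Continuous fun p : unitInterval × X => (Tc p.1 ^ m) (p.2 : AA k V) := e2.clm_apply e3
    have e5 : Continuous fun p : unitInterval × X => (T p.1 ^ m) (p.2 : AA k V) := by
      have : (fun p : unitInterval × X => (T p.1 ^ m) (p.2 : AA k V)) =
        fun p : unitInterval × X => (Tc p.1 ^ m) (p.2 : AA k V) := by
        funext p; exact (hTc _ _ _).symm
      rw [this]; exact e4
    exact B_cont2 f e5 e3
  -- decomposition
  have hsurj' : ∀ t, ∀ z ∈ Z, ∃ w ∈ J, (∀ n', n = n' + 1 → w ∈ H n') ∧ (n = 0 → w = 0) ∧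
      (T t ^ (m + 2)) w = z := by
    intro t z hz
    rcases Nat.eq_zero_or_pos n with h0 | h0
    · refine ⟨0, J.zero_mem, by omega, fun _ => rfl, ?_⟩
      rw [map_zero, H_eq_zero hz.2 (by omega)]
    · obtain ⟨n', rfl⟩ : ∃ n', n = n' + 1 := ⟨n - 1, by omega⟩
      obtain ⟨w, hw, hw', hw''⟩ := surj_of_inj (f := f) (a := n') (b := n' + 1 + (m + 1)) (m + 2) (by omega)
        (by omega) hg hnd (hJ t) (hH t)
        (fun x hx hxn h => hHL t n' (m+2) x hx hxn (by omega) h) z hz.1 hz.2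
      refine ⟨w, hw, fun n'' h => ?_, by omega, hw''⟩
      obtain rfl : n' = n'' := by omega
      exact hw'
  have hsX : ∀ t, ∀ w ∈ J, (∀ n', n = n' + 1 → w ∈ H n') → (n = 0 → w = 0) → T t w ∈ X := by
    intro t w hw h1 h2
    refine ⟨hJ t w hw, ?_⟩
    rcases Nat.eq_zero_or_pos n with h0 | h0
    · rw [h2 h0, map_zero]; exact Submodule.zero_mem _
    · obtain ⟨n', rfl⟩ : ∃ n', n = n' + 1 := ⟨n - 1, by omega⟩
      exact hH t n' w (h1 n' rfl)
  have hsurj : ∀ t, Function.Surjective (N t) := by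
    rintro t ⟨z, hz⟩
    obtain ⟨w, hw, h1, h2, h3⟩ := hsurj' t z hz
    refine ⟨⟨T t w, hsX t w hw h1 h2⟩, ?_⟩
    rw [hNz]
    refine Subtype.ext ?_
    show (T t ^ (m+1)) (T t w) = z
    rw [← h3, ← Module.End.mul_apply, ← pow_succ]
  have hsg : ((-1 : ℝ) ^ (n + f)) ≠ 0 := by positivity
  have hnd' : ∀ t x, N t x = 0 → (∀ z, N t z = 0 → q t x z = 0) → x = 0 := by
    rintro t ⟨x, hx⟩ h1 h2
    rw [hNz0] at h1
    have h1 : (T t ^ (m+1)) x = 0 := h1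
    refine Subtype.ext (hHL t n m x hx.1 hx.2 hnm ?_)
    refine hnd _ (pow_mem (hJ t) m x hx.1) fun z0 hz0 => ?_
    rw [B_pr (pow_mem_H (hH t) m n x hx.2) (show n + m + n = finrank k V + f by omega)]
    set z := pr n z0 with hz
    have hzX : z ∈ X := ⟨hg n z0 hz0, pr_mem n z0⟩
    obtain ⟨w, hw, hw1, hw2, hw3⟩ := hsurj' t _ (hmem t z hzX)
    have hTw := hsX t w hw hw1 hw2
    have hu : z - T t w ∈ X := X.sub_mem hzX hTw
    have := h2 ⟨z - T t w, hu⟩ (by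
      rw [hNz0]
      show (T t ^ (m+1)) (z - T t w) = 0
      rw [map_sub, ← hw3, ← Module.End.mul_apply, ← pow_succ, sub_self])
    rw [hqv] at this
    have this : B f ((T t ^ m) x) (z - T t w) = 0 := by
      rcases mul_eq_zero.1 this with h | h
      · exact absurd h hsg
      · exact h
    rw [map_sub, hs t _ (pow_mem (hJ t) m x hx.1) w hw, ← Module.End.mul_apply, ← pow_succ', h1,
      map_zero, LinearMap.zero_apply, sub_zero] at this
    exact this
  have hsym : ∀ t x z, q t x z = q t z x := by
    intro t x z
    rw [hqv, hqv, ← pow_self (hJ t) (hs t) m _ x.2.1 _ z.2.1, B_symm]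
  have := deform N hN q hq hsym hsurj hnd' t₁ (fun x h1 h2 => by
    rw [hqv]
    exact h₁ n m x x.2.1 x.2.2 hnm ((hNz0 _ _).1 h1) (fun h => h2 (Subtype.ext h))) t ⟨x, hx, hxn⟩
    ((hNz0 _ _).2 hx1) (fun h => hx0 (congrArg Subtype.val h))
  exact this

end
end GDE

namespace GDE
noncomputable section
open Classical
open Module
set_option linter.all false

variable {k V : Type*} [Field k] [AddCommGroup V] [Module k V] [FiniteDimensional k V]
  [Fintype (Submodule k V)]

/-- a good system of submodules -/
structure Good (E : Finset V) (I : Submodule k V → Submodule ℝ (AA k V)) : Prop where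
  le : ∀ F : Submodule k V, I F ≤ A F
  gr : ∀ (F : Submodule k V) (n : ℕ), ∀ x ∈ I F, pr n x ∈ I F
  mapY : ∀ F : Submodule k V, ∀ v ∈ E, v ∉ F → (I F).map (Y v) = I (pl F v)
  sub : ∀ F : Submodule k V, ∀ v ∈ E, v ∉ F → I (pl F v) ≤ I F
  nd : ∀ F : Submodule k V, ∀ x ∈ I F, (∀ z ∈ I F, B (finrank k F) x z = 0) → x = 0
  ns : ∀ F : Submodule k V, F ≠ ⊤ → ∀ n, ∀ x ∈ I F, x ∈ H n → 2 * n ≤ finrank k V + finrank k F →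
    (∀ v ∈ E, Y v x = 0) → x = 0
  hr : ∀ F : Submodule k V, HR (finrank k F) (ell (fun _ => 1) E) (I F)
  yF : ∀ F : Submodule k V, y F ∈ I F

lemma exists_notMem {E : Finset V} (hE : Submodule.span k (E : Set V) = ⊤) {F : Submodule k V}
    (hF : F ≠ ⊤) : ∃ v ∈ E, v ∉ F := by
  by_contra h
  push Not at h
  exact hF (top_le_iff.1 (hE ▸ Submodule.span_le.2 h))

lemma ne_top_of {F : Submodule k V} {v : V} (h : v ∉ F) : F ≠ ⊤ := by
  rintro rfl; exact h trivial

lemma lt_pl {F : Submodule k V} {v : V} (h : v ∉ F) : F < pl F v :=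
  lt_of_le_of_ne (le_pl F v) fun he => h (he ▸ mem_pl F v)

lemma Good.Y_mem {E : Finset V} {I : Submodule k V → Submodule ℝ (AA k V)} (g : Good E I)
    {F : Submodule k V} {v : V} (hv : v ∈ E) {x : AA k V} (hx : x ∈ I F) : Y v x ∈ I (pl F v) := by
  by_cases h : v ∈ F
  · rw [Y_zero (g.le F hx) h]; exact Submodule.zero_mem _
  · rw [← g.mapY F v hv h]; exact Submodule.mem_map_of_mem hx

lemma Good.Y_mem2 {E : Finset V} {I : Submodule k V → Submodule ℝ (AA k V)} (g : Good E I)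
    {F : Submodule k V} {v : V} (hv : v ∈ E) {x : AA k V} (hx : x ∈ I F) : Y v x ∈ I F := by
  by_cases h : v ∈ F
  · rw [Y_zero (g.le F hx) h]; exact Submodule.zero_mem _
  · exact g.sub F v hv h (g.Y_mem hv hx)

lemma Good.ell_mem {E : Finset V} {I : Submodule k V → Submodule ℝ (AA k V)} (g : Good E I)
    {F : Submodule k V} (c : V → ℝ) {x : AA k V} (hx : x ∈ I F) : ell c E x ∈ I F := by
  rw [ell_apply]
  exact Submodule.sum_mem _ fun v hv => Submodule.smul_mem _ _ (g.Y_mem2 hv hx)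

lemma ns_lt {E : Finset V} (hE : Submodule.span k (E : Set V) = ⊤) {e : V}
    {I : Submodule k V → Submodule ℝ (AA k V)} (g : Good (insert e E) I)
    {F : Submodule k V} {n : ℕ} {x : AA k V} (hx : x ∈ I F) (hn : x ∈ H n)
    (h : 2 * n < finrank k V + finrank k F) (hY : ∀ v ∈ E, Y v x = 0) : x = 0 := by
  have hnF : n < finrank k F → x = 0 := AH_eq_zero (g.le F hx) hn
  by_cases hF : F = ⊤
  · apply hnF; subst hF; rw [finrank_top] at *; omega
  suffices he : Y e x = 0 by
    refine g.ns F hF n x hx hn h.le fun v hv => ?_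
    rcases Finset.mem_insert.1 hv with rfl | hv
    · exact he
    · exact hY v hv
  by_cases heF : e ∈ F
  · exact Y_zero (g.le F hx) heF
  by_cases hpe : pl F e = ⊤
  · have h1 := finrank_pl heF
    rw [hpe, finrank_top] at h1
    by_cases hnf : n < finrank k F
    · rw [hnF hnf, map_zero]
    · have hn' : n = finrank k F := by omega
      subst hn'
      have hxy := AH_eq_smul (g.le F hx) hn
      obtain ⟨v, hv, hvF⟩ := exists_notMem hE hF
      have h2 := hY v hv
      rw [hxy, map_smul, Y_y, if_neg hvF] at h2
      rcases smul_eq_zero.1 h2 with h3 | h3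
      · rw [hxy, h3, zero_smul, map_zero]
      · exact absurd h3 (y_ne _)
  · refine g.ns (pl F e) hpe (n+1) _ (g.Y_mem (Finset.mem_insert_self e E) hx) (Y_mem_H hn e) ?_ ?_
    · rw [finrank_pl heF]; omega
    · intro v hv
      rcases Finset.mem_insert.1 hv with rfl | hv
      · exact Y_zero (Y_mem_A (g.le F hx) v) (mem_pl F v)
      · rw [Y_comm, hY v hv, map_zero]

/-- interpolating weights -/
def wt (e : V) (t : ℝ) : V → ℝ := fun v => if v = e then t else 1

lemma step1 {E : Finset V} (hE : Submodule.span k (E : Set V) = ⊤) {e : V} (he : e ∉ E)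
    {I : Submodule k V → Submodule ℝ (AA k V)} (g : Good (insert e E) I) (F : Submodule k V) :
    ∀ t : unitInterval, HR (finrank k F) (ell (wt e t) (insert e E)) (I F) := by
  induction F using WellFoundedGT.induction with
  | ind F ih =>
  intro t
  refine deformHR (g.gr F) (g.nd F) (fun t => ell (wt e t) (insert e E)) ?_
    (fun t x hx => g.ell_mem _ hx) (fun t n x hx => ell_mem_H _ _ n x hx)
    (fun t x hx z hz => ell_self _ _ F x (g.le F hx) z (g.le F hz)) ?_ 1 ?_ t
  · have : (fun t : unitInterval => LinearMap.toContinuousLinearMap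
        (ell (wt e t) (insert e E) : AA k V →ₗ[ℝ] AA k V)) =
        fun t : unitInterval => ∑ v ∈ insert e E, (wt e t v) • LinearMap.toContinuousLinearMap
          (Y v : AA k V →ₗ[ℝ] AA k V) := by
      funext t
      simp only [ell, map_sum, map_smul]
    rw [this]
    refine continuous_finset_sum _ fun v _ => ?_
    have hw : Continuous fun t : unitInterval => wt e (t : ℝ) v := ?_
    · exact hw.smul continuous_const
    unfold wt
    split_ifs
    · exact continuous_subtype_val
    · exact continuous_const
  · intro t n m x hx hn hnm h0
    rcases m with _ | m
    · simpa using h0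
    set T : AA k V →ₗ[ℝ] AA k V := ell (wt e t) (insert e E) with hT
    have hxA := g.le F hx
    have hTx : (T ^ m) x ∈ A F := pow_mem (fun x hx => ell_mem_A _ _ F x hx) m x hxA
    have hterm : ∀ v ∈ insert e E, v ∉ F → Y v x ≠ 0 →
        0 < (-1) ^ (n + finrank k F) * B (finrank k F) (Y v ((T ^ m) x)) x := by
      intro v hv hvF hne
      have h1 := ih (pl F v) (lt_pl hvF) t (n + 1) m (Y v x) (g.Y_mem hv hx) (Y_mem_H hn v)
        (by rw [finrank_pl hvF]; omega) (by rw [ell_pow_Y, h0, map_zero]) hne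
      rw [finrank_pl hvF, ell_pow_Y, ← B_YY hvF hTx hxA, B_self v hTx hxA] at h1
      have e1 : (-1 : ℝ) ^ (n + 1 + (finrank k F + 1)) = (-1) ^ (n + finrank k F) := by
        rw [show n + 1 + (finrank k F + 1) = n + finrank k F + 2 by ring, pow_add]; norm_num
      rw [e1] at h1
      exact h1
    have hwt : 0 ≤ (t : ℝ) := t.2.1
    have hwn : ∀ v, 0 ≤ wt e t v := by intro v; unfold wt; split_ifs <;> linarith
    have hnn : ∀ v ∈ insert e E,
        0 ≤ (-1) ^ (n + finrank k F) * (wt e t v * B (finrank k F) (Y v ((T ^ m) x)) x) := by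
      intro v hv
      rw [mul_left_comm]
      refine mul_nonneg (hwn v) ?_
      by_cases hvF : v ∈ F
      · rw [Y_zero hTx hvF]; simp
      · by_cases hne : Y v x = 0
        · rw [hT, ← ell_pow_Y, hne]; simp
        · exact (hterm v hv hvF hne).le
    have hsum : ∑ v ∈ insert e E,
        (-1) ^ (n + finrank k F) * (wt e t v * B (finrank k F) (Y v ((T ^ m) x)) x) = 0 := by
      rw [← Finset.mul_sum]
      have : B (finrank k F) ((T ^ (m+1)) x) x = 0 := by rw [h0]; simp
      rw [pow_succ', Module.End.mul_apply, hT, ell_apply, ← hT] at this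
      simp only [map_sum, map_smul, LinearMap.sum_apply, LinearMap.smul_apply, smul_eq_mul] at this
      rw [this, mul_zero]
    rw [Finset.sum_eq_zero_iff_of_nonneg hnn] at hsum
    refine ns_lt hE g hx hn (by omega) fun v hv => ?_
    by_contra hne
    have hvF : v ∉ F := fun h => hne (Y_zero hxA h)
    have h2 := hsum v (Finset.mem_insert_of_mem hv)
    have hve : v ≠ e := by rintro rfl; exact he hv
    have h3 := hterm v (Finset.mem_insert_of_mem hv) hvF hne
    rw [show wt e t v = 1 by simp [wt, hve], one_mul] at h2
    linarith
  · have : (fun v => wt e ((1 : unitInterval) : ℝ) v) = fun _ => (1 : ℝ) := by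
      funext v; simp [wt]
    show HR _ (ell (fun v => wt e ((1 : unitInterval) : ℝ) v) (insert e E)) (I F)
    rw [this]; exact g.hr F

lemma step1' {E : Finset V} (hE : Submodule.span k (E : Set V) = ⊤) {e : V} (he : e ∉ E)
    {I : Submodule k V → Submodule ℝ (AA k V)} (g : Good (insert e E) I) (F : Submodule k V) :
    HR (finrank k F) (ell (fun _ => 1) E) (I F) := by
  have h := step1 hE he g F 0
  have : (ell (wt e ((0 : unitInterval) : ℝ)) (insert e E) : AA k V →ₗ[ℝ] AA k V) =
      ell (fun _ => 1) E := by
    unfold ell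
    rw [Finset.sum_insert he]
    have h1 : wt e ((0 : unitInterval) : ℝ) e = 0 := by simp [wt]
    rw [h1, zero_smul, zero_add]
    refine Finset.sum_congr rfl fun v hv => ?_
    have hve : v ≠ e := by rintro rfl; exact he hv
    simp [wt, hve]
  rwa [this] at h

lemma represent {f : ℕ} {J : Submodule ℝ (AA k V)}
    (hnd : ∀ x ∈ J, (∀ z ∈ J, B f x z = 0) → x = 0) (l : AA k V →ₗ[ℝ] ℝ) :
    ∃ a ∈ J, ∀ z ∈ J, B f a z = l z := by
  let ψ : J →ₗ[ℝ] Dual ℝ J := (B f).domRestrict₁₂ J J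
  have hψ : Function.Injective ψ := by
    rw [injective_iff_map_eq_zero]
    rintro ⟨x, hx⟩ h
    refine Subtype.ext (hnd x hx fun z hz => ?_)
    exact LinearMap.congr_fun h ⟨z, hz⟩
  have h3 := (LinearMap.injective_iff_surjective_of_finrank_eq_finrank
    (Subspace.dual_finrank_eq (K := ℝ) (V := J)).symm).1 hψ
  obtain ⟨⟨a, ha⟩, h⟩ := h3 (l ∘ₗ J.subtype)
  exact ⟨a, ha, fun z hz => LinearMap.congr_fun h ⟨z, hz⟩⟩

end
end GDE

namespace GDE
noncomputable section
open Classical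
open Module
set_option linter.all false

variable {k V : Type*} [Field k] [AddCommGroup V] [Module k V] [FiniteDimensional k V]
  [Fintype (Submodule k V)]

/-- the new system after deletion -/
def I2 [hfd : FiniteDimensional k V] (E : Finset V) (I : Submodule k V → Submodule ℝ (AA k V)) (F : Submodule k V) :
    Submodule ℝ (AA k V) :=
  if F = ⊤ then I ⊤ else
    I F ⊓ (⨅ v : {v : V // v ∈ E ∧ v ∉ F}, (I2 E I (pl F v.1)).comap (Y v.1)) ⊓
    ⨅ n : {n : ℕ // finrank k V + finrank k F ≤ 2 * n},
      (⨆ v : {v : V // v ∈ E ∧ v ∉ F}, I2 E I (pl F v.1)).comap (pr n.1)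
termination_by finrank k V - finrank k F
decreasing_by
  all_goals
    have h1 : finrank k (pl F v.1) = finrank k F + 1 :=
      Submodule.finrank_sup_span_singleton v.2.2
    have h2 := Submodule.finrank_le (pl F v.1)
    omega

/-- the sum of the smaller pieces -/
def DD (E : Finset V) (I : Submodule k V → Submodule ℝ (AA k V)) (F : Submodule k V) :
    Submodule ℝ (AA k V) := ⨆ v : {v : V // v ∈ E ∧ v ∉ F}, I2 E I (pl F v.1)

lemma I2_top (E : Finset V) (I : Submodule k V → Submodule ℝ (AA k V)) : I2 E I ⊤ = I ⊤ := by
  rw [I2, if_pos rfl]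

lemma mem_I2 {E : Finset V} {I : Submodule k V → Submodule ℝ (AA k V)} {F : Submodule k V}
    (hF : F ≠ ⊤) {x : AA k V} : x ∈ I2 E I F ↔ x ∈ I F ∧
      (∀ v ∈ E, v ∉ F → Y v x ∈ I2 E I (pl F v)) ∧
      ∀ n, finrank k V + finrank k F ≤ 2 * n → pr n x ∈ DD E I F := by
  rw [I2, if_neg hF]
  simp only [Submodule.mem_inf, Submodule.mem_iInf, Submodule.mem_comap, Subtype.forall, and_imp,
    and_assoc, DD]

lemma DD_le {E : Finset V} {I : Submodule k V → Submodule ℝ (AA k V)} {F : Submodule k V}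
    {v : V} (hv : v ∈ E) (hvF : v ∉ F) : I2 E I (pl F v) ≤ DD E I F :=
  le_iSup (fun v : {v : V // v ∈ E ∧ v ∉ F} => I2 E I (pl F v.1)) ⟨v, hv, hvF⟩

lemma DD_ind {E : Finset V} {I : Submodule k V → Submodule ℝ (AA k V)} {F : Submodule k V}
    {P : Submodule ℝ (AA k V)} (h : ∀ v ∈ E, v ∉ F → I2 E I (pl F v) ≤ P) : DD E I F ≤ P :=
  iSup_le fun v => h v.1 v.2.1 v.2.2

lemma K_lemma {E : Finset V} (hE : Submodule.span k (E : Set V) = ⊤) {e : V} (he : e ∉ E)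
    {I : Submodule k V → Submodule ℝ (AA k V)} (g : Good (insert e E) I) {F : Submodule k V}
    {n : ℕ} {x : AA k V} (hx : x ∈ I F) (hn : x ∈ H n)
    (hle : ∀ v ∈ E, v ∉ F → I2 E I (pl F v) ≤ A (pl F v))
    (h2 : 2 * n ≤ finrank k V + finrank k F)
    (hD : 2 * n = finrank k V + finrank k F → x ∈ DD E I F)
    (hY : ∀ v ∈ E, Y v x = 0) : x = 0 := by
  rcases h2.lt_or_eq with h | h
  · exact ns_lt hE g hx hn h hY
  · by_contra hne
    have h0 : ∀ z ∈ DD E I F, B (finrank k F) x z = 0 := by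
      intro z hz
      have : DD E I F ≤ LinearMap.ker (B (finrank k F) x) := by
        refine DD_ind fun v hv hvF z hz => ?_
        rw [LinearMap.mem_ker, B_adj hvF (g.le F hx) (hle v hv hvF hz), hY v hv]; simp
      exact this hz
    have h1 := step1' hE he g F n 0 x hx hn (by omega) (by
      rw [zero_add, pow_one, ell_apply]
      exact Finset.sum_eq_zero fun v hv => by rw [hY v hv, smul_zero]) hne
    rw [pow_zero, Module.End.one_apply, h0 x (hD h), mul_zero] at h1
    exact lt_irrefl _ h1

/-- inductive package -/
structure Pk (E : Finset V) (I : Submodule k V → Submodule ℝ (AA k V)) (F : Submodule k V) :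
    Prop where
  le : I2 E I F ≤ I F
  gr : ∀ n, ∀ x ∈ I2 E I F, pr n x ∈ I2 E I F
  yF : y F ∈ I2 E I F
  sub : ∀ v ∈ E, v ∉ F → I2 E I (pl F v) ≤ I2 E I F
  nd : ∀ x ∈ I2 E I F, (∀ z ∈ I2 E I F, B (finrank k F) x z = 0) → x = 0

/-- high degree nondegeneracy -/
lemma nd_high {E : Finset V} {e : V}
    {I : Submodule k V → Submodule ℝ (AA k V)} (g : Good (insert e E) I) {F : Submodule k V}
    (ih : ∀ G, F < G → Pk E I G)
    (hIF : ∀ n a, a ∈ I F → 2 * n < finrank k V + finrank k F →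
      (∀ v ∈ E, v ∉ F → Y v a ∈ I2 E I (pl F v)) → pr n a ∈ I2 E I F)
    {n : ℕ} {x : AA k V} (hx : x ∈ DD E I F) (hxI : x ∈ I F) (hn : x ∈ H n)
    (h2 : finrank k V + finrank k F < 2 * n)
    (hxo : ∀ z ∈ I2 E I F, B (finrank k F) x z = 0) : x = 0 := by
  by_cases hnd : finrank k V < n
  · exact H_eq_zero hn hnd
  refine g.nd F x hxI fun u hu => ?_
  have huA := g.le F hu
  have ihv : ∀ v, v ∉ F → Pk E I (pl F v) := fun v hv => ih _ (lt_pl hv)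
  have hA : ∀ v, v ∉ F → I2 E I (pl F v) ≤ A (pl F v) := fun v hv => (ihv v hv).le.trans (g.le _)
  have hex : ∀ v, ∃ a : AA k V, v ∉ F → a ∈ I2 E I (pl F v) ∧
      ∀ z ∈ I2 E I (pl F v), B (finrank k F + 1) a z = B (finrank k F + 1) (Y v u) z := by
    intro v
    by_cases hv : v ∈ F
    · exact ⟨0, fun h => absurd hv h⟩
    · have := (ihv v hv).nd
      rw [finrank_pl hv] at this
      obtain ⟨a, ha, h⟩ := represent this (B (finrank k F + 1) (Y v u))
      exact ⟨a, fun _ => ⟨ha, h⟩⟩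
  choose α hα using hex
  have heq : ∀ v, v ∉ F → ∀ a ∈ I2 E I (pl F v), ∀ b ∈ I2 E I (pl F v),
      (∀ z ∈ I2 E I (pl F v), B (finrank k F + 1) a z = B (finrank k F + 1) b z) → a = b := by
    intro v hv a ha b hb h
    rw [← sub_eq_zero]
    refine (ihv v hv).nd _ (Submodule.sub_mem _ ha hb) fun z hz => ?_
    rw [finrank_pl hv, map_sub, LinearMap.sub_apply, h z hz, sub_self]
  -- commutation
  have hcomm : ∀ v ∈ E, ∀ w ∈ E, v ∉ F → w ∉ F → w ∉ pl F v → v ∉ pl F w →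
      Y w (α v) = Y v (α w) := by
    intro v hvE w hwE hv hw hwv hvw
    have hP := ih (pl (pl F v) w) ((lt_pl hv).trans (lt_pl hwv))
    rw [← sub_eq_zero]
    have m1 : Y w (α v) ∈ I2 E I (pl (pl F v) w) :=
      ((mem_I2 (ne_top_of hwv)).1 (hα v hv).1).2.1 w hwE hwv
    have m2 : Y v (α w) ∈ I2 E I (pl (pl F v) w) := by
      rw [pl_comm]; exact ((mem_I2 (ne_top_of hvw)).1 (hα w hw).1).2.1 v hvE hvw
    refine hP.nd _ (Submodule.sub_mem _ m1 m2) fun z hz => ?_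
    have hz1 : z ∈ I2 E I (pl F v) := (ihv v hv).sub w hwE hwv hz
    have hz2' : z ∈ I2 E I (pl (pl F w) v) := by rw [pl_comm]; exact hz
    have hz2 : z ∈ I2 E I (pl F w) := (ihv w hw).sub v hvE hvw hz2'
    have hzA : z ∈ A (pl (pl F v) w) := g.le _ (hP.le hz)
    have hzA' : z ∈ A (pl (pl F w) v) := by rw [pl_comm]; exact hzA
    rw [finrank_pl hwv, map_sub, LinearMap.sub_apply, sub_eq_zero]
    have e1 := B_adj hwv (hA v hv (hα v hv).1) hzA
    have e2 := B_adj hvw (hA w hw (hα w hw).1) hzA'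
    have e3 := B_adj hwv (Y_mem_A huA v) hzA
    have e4 := B_adj hvw (Y_mem_A huA w) hzA'
    rw [finrank_pl hv] at e1 e3
    rw [finrank_pl hw] at e2 e4
    rw [finrank_pl hv, ← e1, (hα v hv).2 z hz1, e3, Y_comm, ← e4, ← (hα w hw).2 z hz2, e2]
  have hcons : ∀ v ∈ E, ∀ w ∈ E, v ∉ F → w ∉ F → ∀ U, F ≤ U → v ∈ U → w ∈ U →
      B (finrank k F + 1) (y U) (α v) = B (finrank k F + 1) (y U) (α w) := by
    intro v hvE w hwE hv hw U hFU hvU hwU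
    by_cases hwv : w ∈ pl F v
    · have hpl := mem_pl_exchange hw hwv
      have : α v = α w := by
        refine heq v hv _ (hα v hv).1 _ (hpl ▸ (hα w hw).1) fun z hz => ?_
        rw [(hα v hv).2 z hz, (hα w hw).2 z (hpl.symm ▸ hz), Y_congr huA hpl]
      rw [this]
    · have hvw : v ∉ pl F w := fun h => hwv (by rw [mem_pl_exchange hv h]; exact mem_pl F w)
      have hyA : (y U : AA k V) ∈ A (pl (pl F v) w) :=
        y_mem_A (pl_le.2 ⟨pl_le.2 ⟨hFU, hvU⟩, hwU⟩)
      have hyA' : (y U : AA k V) ∈ A (pl (pl F w) v) := by rw [pl_comm]; exact hyA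
      have e1 := B_adj hwv (hA v hv (hα v hv).1) hyA
      have e2 := B_adj hvw (hA w hw (hα w hw).1) hyA'
      rw [finrank_pl hv] at e1
      rw [finrank_pl hw] at e2
      rw [B_symm, e1, hcomm v hvE w hwE hv hw hwv hvw, ← e2, B_symm]
  let c : Submodule k V → ℝ := fun U => if h : ∃ v, v ∈ E ∧ v ∉ F ∧ v ∈ U then
    B (finrank k F + 1) (y U) (α h.choose) else 0
  let l : AA k V →ₗ[ℝ] ℝ := ∑ U, c U • LinearMap.proj U
  have hl : ∀ U, l (y U) = c U := by
    intro U
    simp [l, y, LinearMap.sum_apply, Pi.single_apply]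
  have hlv : ∀ v ∈ E, v ∉ F → ∀ z ∈ A (pl F v), l z = B (finrank k F + 1) z (α v) := by
    intro v hvE hv z hz
    refine A_ext (f := l) (g := (B (finrank k F + 1)).flip (α v)) (fun U hU => ?_) hz
    rw [hl]
    rw [pl_le] at hU
    have h : ∃ v, v ∈ E ∧ v ∉ F ∧ v ∈ U := ⟨v, hvE, hv, hU.2⟩
    simp only [c, dif_pos h, LinearMap.flip_apply]
    exact hcons _ h.choose_spec.1 v hvE h.choose_spec.2.1 hv U hU.1 h.choose_spec.2.2 hU.2
  obtain ⟨a, haI, ha⟩ := represent (g.nd F) l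
  have hYa : ∀ v ∈ E, v ∉ F → Y v a = α v := by
    intro v hvE hv
    have hvE' := Finset.mem_insert_of_mem (b := e) hvE
    rw [← sub_eq_zero]
    refine g.nd (pl F v) _ (Submodule.sub_mem _ (g.Y_mem hvE' haI) ((ihv v hv).le (hα v hv).1))
      fun z hz => ?_
    rw [finrank_pl hv, map_sub, LinearMap.sub_apply, ← B_adj hv (g.le F haI) (g.le _ hz),
      ha z (g.sub F v hvE' hv hz), hlv v hvE hv z (g.le _ hz), B_symm, sub_self]
  have hn' : n + (finrank k V + finrank k F - n) = finrank k V + finrank k F := by omega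
  have haI2 : pr (finrank k V + finrank k F - n) a ∈ I2 E I F :=
    hIF _ a haI (by omega) fun v hvE hv => by rw [hYa v hvE hv]; exact (hα v hv).1
  have h3 : B (finrank k F) x a = 0 := by
    rw [B_pr hn hn']; exact hxo _ haI2
  have h4 : DD E I F ≤ LinearMap.ker ((B (finrank k F)).flip (u - a)) := by
    refine DD_ind fun v hvE hv z hz => ?_
    show B (finrank k F) z (u - a) = 0
    rw [B_symm, B_adj hv (Submodule.sub_mem _ huA (g.le F haI)) (hA v hv hz), map_sub, map_sub,
      LinearMap.sub_apply, hYa v hvE hv, (hα v hv).2 z hz, sub_self]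
  have h5 : B (finrank k F) x (u - a) = 0 := h4 hx
  rw [map_sub, h3, sub_zero] at h5
  exact h5

lemma pk {E : Finset V} (hE : Submodule.span k (E : Set V) = ⊤) {e : V} (he : e ∉ E)
    {I : Submodule k V → Submodule ℝ (AA k V)} (g : Good (insert e E) I) (F : Submodule k V) :
    Pk E I F := by
  induction F using WellFoundedGT.induction with
  | ind F ih =>
  by_cases hF : F = ⊤
  · subst hF
    refine ⟨(I2_top E I).le, ?_, ?_, fun v _ hv => absurd trivial hv, ?_⟩
    · rw [I2_top]; exact g.gr ⊤
    · rw [I2_top]; exact g.yF ⊤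
    · rw [I2_top]; exact g.nd ⊤
  have ihv : ∀ v, v ∉ F → Pk E I (pl F v) := fun v hv => ih _ (lt_pl hv)
  have hA : ∀ v, v ∉ F → I2 E I (pl F v) ≤ A (pl F v) := fun v hv => (ihv v hv).le.trans (g.le _)
  have hle : I2 E I F ≤ I F := fun x hx => ((mem_I2 hF).1 hx).1
  have hgr : ∀ n, ∀ x ∈ I2 E I F, pr n x ∈ I2 E I F := by
    intro n x hx
    obtain ⟨h1, h2, h3⟩ := (mem_I2 hF).1 hx
    refine (mem_I2 hF).2 ⟨g.gr F n x h1, fun v hvE hv => ?_, fun n' hn' => ?_⟩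
    · rw [← pr_Y]; exact (ihv v hv).gr _ _ (h2 v hvE hv)
    · by_cases h : n = n'
      · subst h; rw [pr_of_mem (pr_mem n x)]; exact h3 n hn'
      · rw [pr_of_mem_ne (pr_mem n x) h]; exact Submodule.zero_mem _
  have hsub : ∀ v ∈ E, v ∉ F → I2 E I (pl F v) ≤ I2 E I F := by
    intro v hvE hv z hz
    refine (mem_I2 hF).2 ⟨g.sub F v (Finset.mem_insert_of_mem hvE) hv ((ihv v hv).le hz),
      fun w hwE hw => ?_, fun n hn => DD_le hvE hv ((ihv v hv).gr n z hz)⟩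
    by_cases hwv : w ∈ pl F v
    · rw [Y_zero (hA v hv hz) hwv]; exact Submodule.zero_mem _
    · have h1 := ((mem_I2 (ne_top_of hwv)).1 hz).2.1 w hwE hwv
      have hvw : v ∉ pl F w := fun h => hwv (by rw [mem_pl_exchange hv h]; exact mem_pl F w)
      rw [pl_comm] at h1
      exact (ihv w hw).sub v hvE hvw h1
  refine ⟨hle, hgr, ?_, hsub, ?_⟩
  · refine (mem_I2 hF).2 ⟨g.yF F, fun v hvE hv => ?_, fun n hn => ?_⟩
    · rw [Y_y, if_neg hv]; exact (ihv v hv).yF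
    · have hlt : finrank k F < finrank k V := Submodule.finrank_lt hF
      rw [pr_of_mem_ne (y_mem_H F) (by omega)]; exact Submodule.zero_mem _
  · intro x0 hx0 hxo0
    refine eq_zero_of_pr fun n => ?_
    by_cases hnd : finrank k V < n
    · exact H_eq_zero (pr_mem n x0) hnd
    have hx := hgr n x0 hx0
    have hn := pr_mem n x0
    have hxo : ∀ z ∈ I2 E I F, B (finrank k F) (pr n x0) z = 0 := by
      intro z hz
      have hn' : n + (finrank k V + finrank k F - n) = finrank k V + finrank k F := by omega
      rw [B_pr hn hn', B_symm, ← B_pr (pr_mem _ z) (by omega), B_symm]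
      exact hxo0 _ (hgr _ z hz)
    set x := pr n x0
    obtain ⟨hx1, hx2, hx3⟩ := (mem_I2 hF).1 hx
    by_cases h2 : 2 * n ≤ finrank k V + finrank k F
    · refine K_lemma hE he g hx1 hn (fun v _ hv => hA v hv) h2 (fun h => ?_) fun v hvE => ?_
      · have := hx3 n h.ge
        rwa [pr_of_mem hn] at this
      · by_cases hv : v ∈ F
        · exact Y_zero (g.le F hx1) hv
        · refine (ihv v hv).nd _ (hx2 v hvE hv) fun z hz => ?_
          rw [finrank_pl hv, ← B_adj hv (g.le F hx1) (hA v hv hz)]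
          exact hxo z (hsub v hvE hv hz)
    · have hxD := hx3 n (by omega)
      rw [pr_of_mem hn] at hxD
      refine nd_high g ih (fun n a ha hn2 hY => ?_) hxD hx1 hn (by omega) hxo
      refine (mem_I2 hF).2 ⟨g.gr F n a ha, fun v hvE hv => ?_, fun n' hn' => ?_⟩
      · rw [← pr_Y]; exact (ihv v hv).gr _ _ (hY v hvE hv)
      · rw [pr_of_mem_ne (pr_mem n a) (by omega)]; exact Submodule.zero_mem _

/-- deletion step -/
lemma Good.delete {E : Finset V} (hE : Submodule.span k (E : Set V) = ⊤) {e : V} (he : e ∉ E)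
    {I : Submodule k V → Submodule ℝ (AA k V)} (g : Good (insert e E) I) : Good E (I2 E I) := by
  have P := pk hE he g
  refine ⟨fun F => (P F).le.trans (g.le F), fun F => (P F).gr, ?_, fun F => (P F).sub,
    fun F => (P F).nd, ?_, ?_, fun F => (P F).yF⟩
  · intro F v hvE hv
    have hF := ne_top_of hv
    refine le_antisymm ?_ fun z hz => ?_
    · rintro _ ⟨x, hx, rfl⟩
      exact ((mem_I2 hF).1 hx).2.1 v hvE hv
    · have hz' := (P _).le hz
      rw [← g.mapY F v (Finset.mem_insert_of_mem hvE) hv] at hz'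
      obtain ⟨x, hx, rfl⟩ := hz'
      obtain ⟨a, ha, h⟩ := represent (P F).nd (B (finrank k F) x)
      refine ⟨a, ha, ?_⟩
      rw [← sub_eq_zero]
      refine (P _).nd _ (Submodule.sub_mem _ (((mem_I2 hF).1 ha).2.1 v hvE hv) hz) fun w hw => ?_
      have hwA := g.le _ ((P _).le hw)
      rw [finrank_pl hv, map_sub, LinearMap.sub_apply, ← B_adj hv (g.le F ((P F).le ha)) hwA,
        ← B_adj hv (g.le F hx) hwA, h w ((P F).sub v hvE hv hw), sub_self]
  · intro F hF n x hx hn h2 hY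
    obtain ⟨hx1, hx2, hx3⟩ := (mem_I2 hF).1 hx
    refine K_lemma hE he g hx1 hn (fun v _ hv => (P _).le.trans (g.le _)) h2 (fun h => ?_) hY
    have := hx3 n h.ge
    rwa [pr_of_mem hn] at this
  · intro F n m x hx
    exact step1' hE he g F n m x ((P F).le hx)

end
end GDE

namespace GDE
noncomputable section
open Classical
open Module
set_option linter.all false

variable {k V : Type*} [Field k] [AddCommGroup V] [Module k V] [FiniteDimensional k V]
  [Fintype (Submodule k V)] [Fintype V] [Fintype k]

/-- indicator -/
def ind (G : Submodule k V) (v : V) : ℝ := if v ∈ G then 1 else 0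

variable (k) in
/-- the field size -/
def qq : ℝ := (Fintype.card k : ℝ)

lemma one_lt_qq : 1 < qq k := by
  unfold qq; exact_mod_cast Fintype.one_lt_card

lemma sum_ind (G : Submodule k V) : ∑ v : V, ind G v = qq k ^ finrank k G := by
  unfold ind qq
  rw [Finset.sum_boole]
  have : (Finset.univ.filter fun v : V => v ∈ G).card = Fintype.card G := by
    rw [Fintype.card_subtype]
  rw [this, Module.card_eq_pow_finrank (K := k) (V := G)]
  push_cast; rfl

lemma ind_mul (G U : Submodule k V) (v : V) : ind G v * ind U v = ind (G ⊓ U) v := by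
  unfold ind; simp only [Submodule.mem_inf]; split_ifs <;> simp_all

lemma Y_coef {n : ℕ} {x : AA k V} (hx : x ∈ H n) {G : Submodule k V} (hG : finrank k G = n + 1)
    {v : V} (hv : v ∈ G) :
    Y v x G = ∑ U, (if U ≤ G then x U * (1 - ind U v) else 0) := by
  show (∑ U, x U • (if v ∈ U then (0 : AA k V) else y (pl U v))) G = _
  rw [Finset.sum_apply]
  refine Finset.sum_congr rfl fun U _ => ?_
  by_cases hU : finrank k U = n
  · by_cases hvU : v ∈ U
    · simp [hvU, ind]
    · simp only [hvU, if_false, Pi.smul_apply, y, Pi.single_apply, ind, smul_eq_mul, sub_zero]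
      by_cases h : U ≤ G
      · have : G = pl U v := by
          symm
          refine Submodule.eq_of_le_of_finrank_eq (pl_le.2 ⟨h, hv⟩) ?_
          rw [finrank_pl hvU]; omega
        rw [if_pos this, if_pos h]
      · rw [if_neg h, if_neg, mul_zero]
        rintro rfl; exact h (le_pl U v)
  · rw [hx U hU]; simp

lemma finrank_inf_hyp {U U0 G : Submodule k V} {n : ℕ} (hU : finrank k U = n)
    (hU0 : finrank k U0 = n) (hG : finrank k G = n + 1) (h : U ≤ G) (h0 : U0 ≤ G) (hne : U ≠ U0) :
    finrank k (U0 ⊓ U : Submodule k V) + 1 = n := by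
  have h1 := Submodule.finrank_sup_add_finrank_inf_eq U0 U
  have h2 : U0 ⊔ U ≤ G := sup_le h0 h
  have h3 := Submodule.finrank_mono h2
  have h4 : U0 < U0 ⊔ U := lt_of_le_of_ne le_sup_left fun he => hne
    (Submodule.eq_of_le_of_finrank_eq (he ▸ le_sup_right) (by omega))
  have h5 := Submodule.finrank_lt_finrank_of_lt h4
  omega

lemma ns_full {n : ℕ} {x : AA k V} (hx : x ∈ H n) (hn : n < finrank k V)
    (hY : ∀ v, Y v x = 0) : x = 0 := by
  funext U0
  by_cases hU0 : finrank k U0 = n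
  swap
  · exact hx U0 hU0
  have hq := one_lt_qq (k := k)
  have hU0t : U0 ≠ ⊤ := by rintro rfl; rw [finrank_top] at hU0; omega
  obtain ⟨v0, hv0⟩ : ∃ v, v ∉ U0 := by
    by_contra h; push Not at h; exact hU0t (eq_top_iff.2 fun v _ => h v)
  set G := pl U0 v0 with hGdef
  have hG : finrank k G = n + 1 := by rw [hGdef, finrank_pl hv0, hU0]
  have h0G : U0 ≤ G := le_pl _ _
  have key : ∀ W : Submodule k V, W ≤ G →
      ∑ U, (if U ≤ G then x U * (qq k ^ finrank k W - qq k ^ finrank k (W ⊓ U : Submodule k V))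
        else 0) = 0 := by
    intro W hW
    have h1 : ∑ v : V, ind W v * ∑ U, (if U ≤ G then x U * (1 - ind U v) else 0) = 0 := by
      refine Finset.sum_eq_zero fun v _ => ?_
      by_cases hv : v ∈ W
      · rw [← Y_coef hx hG (hW hv), hY v]; simp
      · simp [ind, hv]
    simp only [Finset.mul_sum] at h1
    rw [Finset.sum_comm] at h1
    refine Eq.trans ?_ h1
    refine Finset.sum_congr rfl fun U _ => ?_
    split_ifs with h
    · rw [← sum_ind, ← sum_ind, ← Finset.sum_sub_distrib, Finset.mul_sum]
      refine Finset.sum_congr rfl fun v _ => ?_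
      rw [← ind_mul]; ring
    · simp
  have hS : ∑ U, (if U ≤ G then x U else 0) = 0 := by
    have h1 := key G le_rfl
    have h2 : ∑ U, (if U ≤ G then x U * (qq k ^ finrank k G - qq k ^ finrank k
        (G ⊓ U : Submodule k V)) else 0) =
        (qq k ^ (n+1) - qq k ^ n) * ∑ U, (if U ≤ G then x U else 0) := by
      rw [Finset.mul_sum]
      refine Finset.sum_congr rfl fun U _ => ?_
      split_ifs with h
      · by_cases hU : finrank k U = n
        · rw [inf_eq_right.2 h, hU, hG]; ring
        · rw [hx U hU]; ring
      · ring
    rw [h2] at h1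
    rcases mul_eq_zero.1 h1 with h3 | h3
    · have : qq k ^ n < qq k ^ (n+1) := pow_lt_pow_right₀ hq (by omega)
      linarith
    · exact h3
  have h1 := key U0 h0G
  have h2 : ∑ U, (if U ≤ G then x U * (qq k ^ finrank k U0 - qq k ^ finrank k
      (U0 ⊓ U : Submodule k V)) else 0) =
      (qq k ^ n - qq k ^ n / qq k) * (∑ U, (if U ≤ G then x U else 0) -
        ∑ U, if U = U0 then x U0 else 0) := by
    rw [← Finset.sum_sub_distrib, Finset.mul_sum]
    refine Finset.sum_congr rfl fun U _ => ?_
    by_cases hUU : U = U0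
    · subst hUU; rw [if_pos h0G, if_pos h0G, if_pos rfl, inf_idem]; ring
    · rw [if_neg hUU]
      split_ifs with h
      · by_cases hU : finrank k U = n
        · have h3 := finrank_inf_hyp hU hU0 hG h h0G hUU
          rw [hU0]
          conv_rhs => rw [← h3]
          conv_lhs => rw [← h3]
          rw [pow_succ]
          field_simp
          ring
        · rw [hx U hU]; ring
      · ring
  rw [h2, hS] at h1
  rw [Finset.sum_ite_eq' Finset.univ U0] at h1
  simp only [Finset.mem_univ, if_true, zero_sub] at h1
  rcases mul_eq_zero.1 h1 with h3 | h3
  · exfalso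
    have hp : 0 < qq k ^ n := by positivity
    have : qq k ^ n / qq k < qq k ^ n := div_lt_self hp hq
    linarith
  · simpa using h3

lemma nd_full (F : Submodule k V) : ∀ x ∈ (A F : Submodule ℝ (AA k V)),
    (∀ z ∈ (A F : Submodule ℝ (AA k V)), B (finrank k F) x z = 0) → x = 0 := by
  induction F using WellFoundedGT.induction with
  | ind F ih =>
  intro x0 hx0 ho0
  have hgr : ∀ n, ∀ x ∈ (A F : Submodule ℝ (AA k V)), pr n x ∈ (A F : Submodule ℝ (AA k V)) := by
    intro n x hx U hU; rw [pr_apply, hx U hU]; simp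
  refine eq_zero_of_pr fun n => ?_
  have hn := pr_mem n x0
  by_cases hnd : finrank k V < n
  · exact H_eq_zero hn hnd
  have hx := hgr n x0 hx0
  have ho : ∀ z ∈ (A F : Submodule ℝ (AA k V)), B (finrank k F) (pr n x0) z = 0 := by
    intro z hz
    have hn' : n + (finrank k V + finrank k F - n) = finrank k V + finrank k F := by omega
    rw [B_pr hn hn', B_symm, ← B_pr (pr_mem _ z) (by omega), B_symm]
    exact ho0 _ (hgr _ z hz)
  set x := pr n x0
  by_cases hnd' : n < finrank k V
  · refine ns_full hn hnd' fun v => ?_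
    by_cases hv : v ∈ F
    · exact Y_zero hx hv
    · refine ih _ (lt_pl hv) _ (Y_mem_A hx v) fun z hz => ?_
      rw [finrank_pl hv, ← B_adj hv hx hz]
      exact ho z (A_mono (le_pl F v) hz)
  · have hnd'' : n = finrank k (⊤ : Submodule k V) := by rw [finrank_top]; omega
    rw [hnd''] at hn
    have hxt : x ∈ (A ⊤ : Submodule ℝ (AA k V)) := by
      intro U hU
      refine hn U fun he => hU ?_
      rw [Submodule.eq_top_of_finrank_eq (he.trans (finrank_top k V))]
    have h1 := AH_eq_smul hxt hn
    have h2 := ho (y F) (y_mem_A le_rfl)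
    rw [h1, map_smul, LinearMap.smul_apply, B_y, if_pos (by simp [finrank_top])] at h2
    rw [h1]
    simp at h2
    rw [h2, zero_smul]

lemma mapY_full (F : Submodule k V) (v : V) (hv : v ∉ F) :
    (A F : Submodule ℝ (AA k V)).map (Y v) = A (pl F v) := by
  refine le_antisymm ?_ fun z hz => ?_
  · rintro _ ⟨x, hx, rfl⟩; exact Y_mem_A hx v
  · refine A_ind _ (fun U hU => ?_) hz
    obtain ⟨C, hC⟩ := Submodule.exists_isCompl (pl F v)
    have hvU : v ∉ F ⊔ (C ⊓ U) := by
      intro h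
      obtain ⟨a, ha, c, hc, hac⟩ := Submodule.mem_sup.1 h
      have h1 : c ∈ pl F v := by
        have : c = v - a := by rw [← hac]; abel
        rw [this]; exact Submodule.sub_mem _ (mem_pl F v) (le_pl F v ha)
      have h2 : c = 0 := by
        have := hC.disjoint.le_bot ⟨h1, hc.1⟩
        simpa using this
      rw [h2, add_zero] at hac
      exact hv (hac ▸ ha)
    refine ⟨y (F ⊔ (C ⊓ U)), y_mem_A le_sup_left, ?_⟩
    rw [Y_y, if_neg hvU]
    congr 1
    have : pl (F ⊔ (C ⊓ U)) v = pl F v ⊔ C ⊓ U := by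
      simp only [pl]; rw [sup_right_comm]
    rw [this, ← sup_inf_assoc_of_le C hU, hC.sup_eq_top, top_inf_eq]

end
end GDE

namespace GDE
noncomputable section
open Classical
open Module
set_option linter.all false

variable {k V : Type*} [Field k] [AddCommGroup V] [Module k V] [FiniteDimensional k V]
  [Fintype (Submodule k V)] [Fintype V] [Fintype k]

/-- evaluation at a subspace -/
def ev (G : Submodule k V) : AA k V →ₗ[ℝ] ℝ :=
  ∑ U, (if U ≤ G then (1 : ℝ) else 0) • LinearMap.proj U

lemma ev_y (G U : Submodule k V) : ev G (y U) = if U ≤ G then (1 : ℝ) else 0 := by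
  simp only [ev, LinearMap.sum_apply, LinearMap.smul_apply, LinearMap.proj_apply, smul_eq_mul, y,
    Pi.single_apply]
  simp

lemma H_ext {M : Type*} [AddCommGroup M] [Module ℝ M] {n : ℕ}
    {f g : AA k V →ₗ[ℝ] M} (h : ∀ U : Submodule k V, finrank k U = n → f (y U) = g (y U))
    {x : AA k V} (hx : x ∈ H n) : f x = g x :=
  H_ind (LinearMap.eqLocus f g) h hx

lemma AH_ext {M : Type*} [AddCommGroup M] [Module ℝ M] {n : ℕ} {F : Submodule k V}
    {f g : AA k V →ₗ[ℝ] M}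
    (h : ∀ U : Submodule k V, F ≤ U → finrank k U = n → f (y U) = g (y U))
    {x : AA k V} (hxA : x ∈ A F) (hx : x ∈ H n) : f x = g x := by
  have : (f - g) x = 0 := by
    rw [sum_y x, map_sum]
    refine Finset.sum_eq_zero fun U _ => ?_
    by_cases hU : F ≤ U
    · by_cases hn : finrank k U = n
      · rw [map_smul, LinearMap.sub_apply, h U hU hn, sub_self, smul_zero]
      · rw [hx U hn, zero_smul, map_zero]
    · rw [hxA U hU, zero_smul, map_zero]
  rwa [LinearMap.sub_apply, sub_eq_zero] at this

lemma ev_ell {n : ℕ} {x : AA k V} (hx : x ∈ H n) (G : Submodule k V) :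
    ev G (ell (fun _ => 1) Finset.univ x) = (qq k ^ finrank k G - qq k ^ n) * ev G x := by
  refine H_ext (f := ev G ∘ₗ ell (fun _ => 1) Finset.univ)
    (g := (qq k ^ finrank k G - qq k ^ n) • ev G) (fun U hU => ?_) hx
  rw [LinearMap.comp_apply, ell_apply, map_sum, LinearMap.smul_apply, ev_y, smul_eq_mul]
  by_cases h : U ≤ G
  · rw [if_pos h, mul_one, ← hU, ← sum_ind, ← sum_ind, ← Finset.sum_sub_distrib]
    refine Finset.sum_congr rfl fun v _ => ?_
    rw [one_smul, Y_y]
    by_cases hv : v ∈ U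
    · simp [hv, ind, h hv]
    · simp [hv, ind, ev_y, pl_le, h]
  · rw [if_neg h, mul_zero]
    refine Finset.sum_eq_zero fun v _ => ?_
    rw [one_smul, Y_y]
    by_cases hv : v ∈ U
    · simp [hv]
    · simp [hv, ev_y, pl_le, h]

lemma ev_pow {n : ℕ} {x : AA k V} (hx : x ∈ H n) (G : Submodule k V) (m : ℕ) :
    ev G ((ell (fun _ => 1) Finset.univ ^ m) x) =
      (∏ r ∈ Finset.range m, (qq k ^ finrank k G - qq k ^ (n + r))) * ev G x := by
  induction m with
  | zero => simp
  | succ m ih =>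
    rw [pow_succ', Module.End.mul_apply, ev_ell (pow_mem_H (ell_mem_H _ _) m n x hx), ih,
      Finset.prod_range_succ]
    ring

lemma ev_low {n : ℕ} {x : AA k V} (hx : x ∈ H n) (G : Submodule k V) (h : finrank k G < n) :
    ev G x = 0 := by
  refine H_ext (f := ev G) (g := 0) (fun U hU => ?_) hx
  rw [ev_y, if_neg]
  · rfl
  · intro h'; have := Submodule.finrank_mono h'; omega

lemma ev_self {n : ℕ} {x : AA k V} (hx : x ∈ H n) (G : Submodule k V) (h : finrank k G = n) :
    ev G x = x G := by
  refine H_ext (f := ev G) (g := LinearMap.proj G) (fun U hU => ?_) hx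
  rw [ev_y, LinearMap.proj_apply, y, Pi.single_apply]
  by_cases hUG : G = U
  · rw [if_pos hUG, if_pos hUG.ge]
  · rw [if_neg hUG, if_neg]
    intro h'; exact hUG (Submodule.eq_of_le_of_finrank_eq h' (by omega)).symm

variable (k) in
/-- Moebius values by codimension -/
def muc : ℕ → ℝ
  | 0 => 1
  | c + 1 => - qq k ^ c * muc c

lemma muc_sign (c : ℕ) : 0 < (-1) ^ c * muc k c := by
  induction c with
  | zero => simp [muc]
  | succ c ih =>
    have hq : 0 < qq k ^ c := pow_pos (zero_lt_one.trans one_lt_qq) c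
    have : (-1) ^ (c+1) * muc k (c+1) = qq k ^ c * ((-1) ^ c * muc k c) := by
      simp only [muc]; ring
    rw [this]; positivity

/-- Moebius weight of a subspace -/
def mu (G : Submodule k V) : ℝ := muc k (finrank k V - finrank k G)

lemma exists_hyp {U : Submodule k V} (hU : U ≠ ⊤) :
    ∃ W : Submodule k V, U ≤ W ∧ finrank k W + 1 = finrank k V := by
  obtain ⟨W, hW, hUW⟩ := IsCoatomic.eq_top_or_exists_le_coatom U |>.resolve_left hU
  refine ⟨W, hUW, ?_⟩
  obtain ⟨v, hv⟩ : ∃ v, v ∉ W := by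
    by_contra h; push Not at h; exact hW.1 (eq_top_iff.2 fun v _ => h v)
  have := hW.2 _ (lt_pl hv)
  have h2 := finrank_pl hv
  rw [this, finrank_top] at h2
  omega

lemma mob (U : Submodule k V) : ∑ G, (if U ≤ G then mu G else 0) = if U = ⊤ then 1 else 0 := by
  by_cases hU : U = ⊤
  · subst hU
    rw [if_pos rfl, Finset.sum_eq_single ⊤]
    · simp [mu, muc, finrank_top]
    · intro G _ hG; rw [if_neg]; rwa [top_le_iff]
    · simp
  rw [if_neg hU]
  obtain ⟨W, hUW, hW⟩ := exists_hyp hU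
  have hq := one_lt_qq (k := k)
  have hq0 : 0 < qq k := by linarith
  have hWt : W ≠ ⊤ := by rintro rfl; rw [finrank_top] at hW; omega
  -- split
  have hsplit : ∀ G, (if U ≤ G then mu G else 0) =
      (if U ≤ G ∧ G ≤ W then mu G else 0) + (if U ≤ G ∧ ¬ G ≤ W then mu G else 0) := by
    intro G
    by_cases h1 : U ≤ G <;> by_cases h2 : G ≤ W <;> simp [h1, h2]
  rw [Finset.sum_congr rfl fun G _ => hsplit G, Finset.sum_add_distrib]
  have hinf : ∀ G : Submodule k V, ¬ G ≤ W → finrank k (G ⊓ W : Submodule k V) + 1 = finrank k G := by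
    intro G hG
    have h1 := Submodule.finrank_sup_add_finrank_inf_eq G W
    have h2 : W < G ⊔ W := lt_of_le_of_ne le_sup_right fun h => hG (h ▸ le_sup_left)
    have h3 := Submodule.finrank_lt_finrank_of_lt h2
    have h4 := Submodule.finrank_le (G ⊔ W)
    omega
  let h : Submodule k V → ℝ := fun G => mu G / (qq k ^ finrank k G - qq k ^ finrank k G / qq k)
  have hpos : ∀ g : ℕ, 0 < qq k ^ g - qq k ^ g / qq k := by
    intro g
    have hp : 0 < qq k ^ g := by positivity
    have : qq k ^ g / qq k < qq k ^ g := div_lt_self hp hq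
    linarith
  have hA : ∑ G, (if U ≤ G ∧ ¬ G ≤ W then mu G else 0) =
      ∑ w : V, (1 - ind W w) * ∑ G, (if U ≤ G ∧ w ∈ G then h G else 0) := by
    simp only [Finset.mul_sum]
    rw [Finset.sum_comm]
    refine Finset.sum_congr rfl fun G _ => ?_
    have e1 : ∀ w, (1 - ind W w) * (if U ≤ G ∧ w ∈ G then h G else 0) =
        (if U ≤ G then h G else 0) * (ind G w - ind (G ⊓ W) w) := by
      intro w
      rw [← ind_mul]
      unfold ind
      by_cases h1 : U ≤ G <;> by_cases h2 : w ∈ G <;> by_cases h3 : w ∈ W <;> simp [h1, h2, h3]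
    rw [Finset.sum_congr rfl fun w _ => e1 w, ← Finset.mul_sum, Finset.sum_sub_distrib, sum_ind,
      sum_ind]
    by_cases h1 : U ≤ G
    · by_cases h2 : G ≤ W
      · rw [inf_eq_left.2 h2]; simp [h2]
      · simp only [h1, h2, not_false_eq_true, and_self, if_true, h]
        have e2 := hinf G h2
        have e3 : qq k ^ finrank k G / qq k = qq k ^ finrank k (G ⊓ W : Submodule k V) := by
          rw [← e2, pow_succ]; field_simp
        have := hpos (finrank k G)
        rw [e3] at this ⊢
        field_simp
    · simp [h1]
  have hB : ∀ w, w ∉ W → ∑ G, (if U ≤ G ∧ w ∈ G then h G else 0) =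
      ∑ G, (if U ≤ G ∧ G ≤ W then h (pl G w) else 0) := by
    intro w hw
    rw [← Finset.sum_filter, ← Finset.sum_filter]
    symm
    refine Finset.sum_bij' (fun G _ => pl G w) (fun G _ => G ⊓ W) ?_ ?_ ?_ ?_ ?_
    · intro G hG
      simp only [Finset.mem_filter, Finset.mem_univ, true_and] at hG ⊢
      exact ⟨hG.1.trans (le_pl G w), mem_pl G w⟩
    · intro G hG
      simp only [Finset.mem_filter, Finset.mem_univ, true_and] at hG ⊢
      exact ⟨le_inf hG.1 hUW, inf_le_right⟩
    · intro G hG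
      simp only [Finset.mem_filter, Finset.mem_univ, true_and] at hG
      have hwG : w ∉ G := fun h => hw (hG.2 h)
      have hn : ¬ pl G w ≤ W := fun h => hw (h (mem_pl G w))
      symm
      refine Submodule.eq_of_le_of_finrank_eq (le_inf (le_pl G w) hG.2) ?_
      have e1 := hinf _ hn
      rw [finrank_pl hwG] at e1
      omega
    · intro G hG
      simp only [Finset.mem_filter, Finset.mem_univ, true_and] at hG
      have hn : ¬ G ≤ W := fun h => hw (h hG.2)
      refine Submodule.eq_of_le_of_finrank_eq (pl_le.2 ⟨inf_le_left, hG.2⟩) ?_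
      rw [finrank_pl (show w ∉ G ⊓ W from fun h' => hw (Submodule.mem_inf.1 h').2), hinf G hn]
    · intro G hG; rfl
  have hC : ∑ w : V, (1 - ind W w) * ∑ G, (if U ≤ G ∧ w ∈ G then h G else 0) =
      ∑ w : V, (1 - ind W w) * ∑ G, (if U ≤ G ∧ G ≤ W then
        - mu G / (qq k ^ finrank k V - qq k ^ finrank k V / qq k) else 0) := by
    refine Finset.sum_congr rfl fun w _ => ?_
    by_cases hw : w ∈ W
    · simp [ind, hw]
    · rw [hB w hw]
      congr 1
      refine Finset.sum_congr rfl fun G _ => ?_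
      split_ifs with hG
      · have hwG : w ∉ G := fun h => hw (hG.2 h)
        simp only [h, mu]
        rw [finrank_pl hwG]
        have e1 := Submodule.finrank_mono hG.2
        obtain ⟨c, hc⟩ : ∃ c, finrank k V = finrank k G + 1 + c := ⟨_, (Nat.add_sub_of_le (by omega)).symm⟩
        rw [hc, show finrank k G + 1 + c - (finrank k G + 1) = c by omega,
          show finrank k G + 1 + c - finrank k G = c + 1 by omega]
        simp only [muc]
        have p1 := (hpos (finrank k G + 1)).ne'
        have p2 := (hpos (finrank k G + 1 + c)).ne'
        rw [div_eq_div_iff p1 p2, pow_add _ _ c]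
        ring
      · rfl
  rw [hA, hC, ← Finset.sum_mul]
  have hD : ∑ w : V, (1 - ind W w) = qq k ^ finrank k V - qq k ^ finrank k V / qq k := by
    rw [Finset.sum_sub_distrib, sum_ind]
    have e1 : ∑ w : V, (1 : ℝ) = qq k ^ finrank k V := by
      have := sum_ind (⊤ : Submodule k V)
      rw [finrank_top] at this
      rw [← this]
      exact Finset.sum_congr rfl fun v _ => by simp [ind]
    rw [e1, ← hW, pow_succ]
    field_simp
  rw [hD, Finset.mul_sum, ← Finset.sum_add_distrib]
  refine Finset.sum_eq_zero fun G _ => ?_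
  have := (hpos (finrank k V)).ne'
  split_ifs with hG
  · rw [mul_div_cancel₀ _ this]; ring
  · simp

/-- the form given by evaluations -/
def S : LinearMap.BilinForm ℝ (AA k V) :=
  ∑ G, mu G • LinearMap.BilinForm.linMulLin (ev G) (ev G)

lemma S_apply (u z : AA k V) : S u z = ∑ G, mu G * (ev G u * ev G z) := by
  simp [S, LinearMap.sum_apply]

lemma S_y (U U' : Submodule k V) : S (y U) (y U') = if U ⊔ U' = ⊤ then 1 else 0 := by
  rw [S_apply, ← mob]
  refine Finset.sum_congr rfl fun G _ => ?_
  rw [ev_y, ev_y]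
  by_cases h1 : U ≤ G <;> by_cases h2 : U' ≤ G <;> simp [h1, h2]

lemma S_eq_B {F : Submodule k V} {a b : ℕ} {u z : AA k V} (hu : u ∈ A F) (hz : z ∈ A F)
    (hua : u ∈ H a) (hzb : z ∈ H b) (h : a + b ≤ finrank k V + finrank k F) :
    S u z = B (finrank k F) u z := by
  refine AH_ext (f := S.flip z) (g := (B (finrank k F)).flip z) (fun U hU hUa => ?_) hu hua
  refine AH_ext (f := S (y U)) (g := B (finrank k F) (y U)) (fun U' hU' hUb => ?_) hz hzb
  rw [S_y, B_y]
  congr 1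
  rw [eq_iff_iff]
  refine ⟨fun ht => ⟨ht, ?_⟩, fun ht => ht.1⟩
  have h1 := Submodule.finrank_sup_add_finrank_inf_eq U U'
  rw [ht, finrank_top] at h1
  have h2 := Submodule.finrank_mono (le_inf hU hU')
  omega

lemma term_pos {n j : ℕ} {x : AA k V} (hx : x ∈ H n)
    (h0 : ∀ G : Submodule k V, n + j < finrank k G → ev G x = 0) (G : Submodule k V) :
    0 ≤ (-1) ^ (finrank k V - (n + j)) *
      (mu G * (ev G ((ell (fun _ => 1) Finset.univ ^ j) x) * ev G x)) ∧
    (finrank k G = n + j → ev G x ≠ 0 → 0 < (-1) ^ (finrank k V - (n + j)) *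
      (mu G * (ev G ((ell (fun _ => 1) Finset.univ ^ j) x) * ev G x))) := by
  have main : finrank k G = n + j → ev G x ≠ 0 → 0 < (-1) ^ (finrank k V - (n + j)) *
      (mu G * (ev G ((ell (fun _ => 1) Finset.univ ^ j) x) * ev G x)) := by
    intro hG hne
    rw [ev_pow hx]
    have h1 : 0 < ∏ r ∈ Finset.range j, (qq k ^ finrank k G - qq k ^ (n + r)) := by
      refine Finset.prod_pos fun r hr => ?_
      rw [Finset.mem_range] at hr
      have : qq k ^ (n + r) < qq k ^ finrank k G := pow_lt_pow_right₀ one_lt_qq (by omega)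
      linarith
    have h2 := muc_sign (k := k) (finrank k V - (n + j))
    have h3 : mu G = muc k (finrank k V - (n + j)) := by rw [mu, hG]
    rw [h3]
    have h4 : 0 < ev G x ^ 2 := by positivity
    have := mul_pos (mul_pos h2 h1) h4
    calc _ < _ := this
      _ = _ := by ring
  refine ⟨?_, main⟩
  rcases lt_trichotomy (finrank k G) (n + j) with h | h | h
  · have : ev G ((ell (fun _ => 1) Finset.univ ^ j) x) = 0 :=
      ev_low (pow_mem_H (ell_mem_H _ _) j n x hx) G h
    rw [this]; simp
  · by_cases hne : ev G x = 0
    · rw [hne]; simp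
    · exact (main h hne).le
  · rw [h0 G h]; simp

lemma hr_full (F : Submodule k V) :
    HR (finrank k F) (ell (fun _ => 1) Finset.univ) (A F : Submodule ℝ (AA k V)) := by
  intro n m x hx hn hnm hm hx0
  have hfn : finrank k F ≤ n := by
    by_contra h; exact hx0 (AH_eq_zero hx hn (by omega))
  set T : AA k V →ₗ[ℝ] AA k V := ell (fun _ => 1) Finset.univ with hT
  have htop : ∀ G : Submodule k V, n + m < finrank k G → ev G x = 0 := by
    intro G hG
    have h1 := ev_pow hn G (m+1)
    rw [← hT, hm, map_zero] at h1
    rcases mul_eq_zero.1 h1.symm with h2 | h2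
    · exfalso
      obtain ⟨r, hr, h3⟩ := Finset.prod_eq_zero_iff.1 h2
      rw [Finset.mem_range] at hr
      have : qq k ^ (n + r) < qq k ^ finrank k G := pow_lt_pow_right₀ one_lt_qq (by omega)
      linarith
    · exact h2
  have hSj : ∀ j ≤ m, S ((T ^ j) x) x = B (finrank k F) ((T ^ j) x) x := by
    intro j hj
    exact S_eq_B (pow_mem (ell_mem_A _ _ F) j x hx) hx
      (pow_mem_H (ell_mem_H _ _) j n x hn) hn (by omega)
  -- vanishing step
  have hvan : ∀ j, S ((T ^ j) x) x = 0 → (∀ G : Submodule k V, n + j < finrank k G → ev G x = 0) →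
      ∀ G : Submodule k V, n + j ≤ finrank k G → ev G x = 0 := by
    intro j hS h0 G hG
    rcases hG.lt_or_eq with h | h
    · exact h0 G h
    by_contra hne
    rw [S_apply] at hS
    have h1 : ∑ G, (-1) ^ (finrank k V - (n + j)) * (mu G * (ev G ((T ^ j) x) * ev G x)) = 0 := by
      rw [← Finset.mul_sum, hS, mul_zero]
    rw [Finset.sum_eq_zero_iff_of_nonneg fun G _ => (term_pos hn h0 G).1] at h1
    exact ((term_pos hn h0 G).2 h.symm hne).ne' (h1 G (Finset.mem_univ G))
  have hs : (-1 : ℝ) ^ (finrank k V - (n + m)) = (-1) ^ (n + finrank k F) := by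
    rw [show n + finrank k F = finrank k V - (n + m) + 2 * finrank k F by omega, pow_add, pow_mul]
    norm_num
  have hnn : 0 ≤ (-1) ^ (n + finrank k F) * B (finrank k F) ((T ^ m) x) x := by
    rw [← hSj m le_rfl, S_apply, Finset.mul_sum, ← hs]
    exact Finset.sum_nonneg fun G _ => (term_pos hn htop G).1
  refine lt_of_le_of_ne hnn fun heq => hx0 ?_
  have hz : S ((T ^ m) x) x = 0 := by
    rw [hSj m le_rfl]
    rcases mul_eq_zero.1 heq.symm with h | h
    · exfalso; have : ((-1 : ℝ) ^ (n + finrank k F)) ≠ 0 := by positivity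
      exact this h
    · exact h
  have hall : ∀ i ≤ m, ∀ G : Submodule k V, n + (m - i) ≤ finrank k G → ev G x = 0 := by
    intro i
    induction i with
    | zero => intro _; exact hvan m hz htop
    | succ i ih =>
      intro hi
      refine hvan (m - (i+1)) ?_ fun G hG => ih (by omega) G (by omega)
      rw [hSj _ (by omega)]
      exact B_deg (pow_mem_H (ell_mem_H _ _) _ n x hn) hn (by omega)
  funext G
  by_cases hG : finrank k G = n
  · rw [← ev_self hn G hG]; exact hall m le_rfl G (by omega)
  · exact hn G hG

lemma good_univ : Good (Finset.univ : Finset V) (fun F : Submodule k V => A F) := by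
  refine ⟨fun F => le_rfl, ?_, fun F v _ hv => mapY_full F v hv, fun F v _ _ => A_mono (le_pl F v),
    nd_full, ?_, hr_full, fun F => y_mem_A le_rfl⟩
  · intro F n x hx U hU; rw [pr_apply, hx U hU]; simp
  · intro F hF n x hx hn h2 hY
    have := Submodule.finrank_lt hF
    exact ns_full hn (by omega) fun v => hY v (Finset.mem_univ v)

lemma good_exists (E : Finset V) (hE : Submodule.span k (E : Set V) = ⊤) :
    ∃ I : Submodule k V → Submodule ℝ (AA k V), Good E I := by
  have : ∀ n : ℕ, ∀ E : Finset V, Submodule.span k (E : Set V) = ⊤ → (Eᶜ).card = n →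
      ∃ I : Submodule k V → Submodule ℝ (AA k V), Good E I := by
    intro n
    induction n with
    | zero =>
      intro E _ h
      rw [Finset.card_eq_zero, Finset.compl_eq_empty_iff] at h
      subst h
      exact ⟨_, good_univ⟩
    | succ n ih =>
      intro E hE h
      obtain ⟨e, he⟩ : (Eᶜ).Nonempty := Finset.card_pos.1 (by omega)
      have he' := Finset.mem_compl.1 he
      obtain ⟨I, hI⟩ := ih (insert e E) (top_le_iff.1 (hE ▸ Submodule.span_mono (by simp))) (by
        rw [Finset.compl_insert, Finset.card_erase_of_mem he]; omega)
      exact ⟨_, hI.delete hE he'⟩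
  exact this _ E hE rfl

end
end GDE

namespace GDE
noncomputable section
open Classical
open Module
set_option linter.all false

/-- the subspaces of dimension n spanned by subfamilies -/
def Fl (k : Type*) {V ι : Type*} [Field k] [AddCommGroup V] [Module k V] [Fintype ι] (v : ι → V)
    (n : ℕ) : Finset (Submodule k V) :=
  (Finset.univ.image fun S : Finset ι => Submodule.span k (v '' (S : Set ι))).filter
    fun W => finrank k W = n

lemma mem_Fl {k V ι : Type*} [Field k] [AddCommGroup V] [Module k V] [Fintype ι] {v : ι → V}
    {n : ℕ} {U : Submodule k V} : U ∈ Fl k v n ↔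
      (∃ S : Finset ι, Submodule.span k (v '' (S : Set ι)) = U) ∧ finrank k U = n := by
  simp [Fl]

variable {k V : Type*} [Field k] [AddCommGroup V] [Module k V] [FiniteDimensional k V]
  [Fintype (Submodule k V)] {ι : Type*} [Fintype ι]

/-- combinations of flats -/
def Wf (v : ι → V) (n : ℕ) : Submodule ℝ (AA k V) where
  carrier := {x | ∀ U : Submodule k V, U ∉ Fl k v n → x U = 0}
  add_mem' := by intro a b ha hb U hU; simp [ha U hU, hb U hU]
  zero_mem' := by intro U _; rfl
  smul_mem' := by intro c a ha U hU; simp [ha U hU]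

lemma Wf_ind {v : ι → V} {n : ℕ} (P : Submodule ℝ (AA k V))
    (h : ∀ U ∈ Fl k v n, y U ∈ P) {x : AA k V} (hx : x ∈ Wf v n) : x ∈ P := by
  rw [sum_y x]
  refine P.sum_mem fun U _ => ?_
  by_cases hU : U ∈ Fl k v n
  · exact P.smul_mem _ (h U hU)
  · rw [hx U hU, zero_smul]; exact P.zero_mem

lemma y_mem_Wf {v : ι → V} {n : ℕ} {U : Submodule k V} (hU : U ∈ Fl k v n) :
    (y U : AA k V) ∈ Wf v n := by
  intro G hG; simp only [y, Pi.single_apply]; rw [if_neg]; rintro rfl; exact hG hU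

lemma pl_mem_Fl {v : ι → V} {n : ℕ} {U : Submodule k V} (hU : U ∈ Fl k v n) (i : ι)
    (hi : v i ∉ U) : pl U (v i) ∈ Fl k v (n + 1) := by
  rw [mem_Fl] at hU ⊢
  obtain ⟨⟨S, rfl⟩, h⟩ := hU
  refine ⟨⟨insert i S, ?_⟩, by rw [finrank_pl hi, h]⟩
  rw [Finset.coe_insert, Set.image_insert_eq, Submodule.span_insert, pl, sup_comm]

lemma ell_Wf (v : ι → V) (n : ℕ) (x : AA k V) (hx : x ∈ Wf v n) :
    ell (fun _ => 1) (Finset.univ.image v) x ∈ Wf v (n + 1) := by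
  refine Wf_ind ((Wf v (n+1)).comap (ell (fun _ => 1) (Finset.univ.image v))) (fun U hU => ?_) hx
  rw [Submodule.mem_comap, ell_apply]
  refine Submodule.sum_mem _ fun w hw => Submodule.smul_mem _ _ ?_
  obtain ⟨i, -, rfl⟩ := Finset.mem_image.1 hw
  rw [Y_y]
  split_ifs with h
  · exact Submodule.zero_mem _
  · exact y_mem_Wf (pl_mem_Fl hU i h)

lemma ell_pow_Wf (v : ι → V) (m n : ℕ) (x : AA k V) (hx : x ∈ Wf v n) :
    (ell (fun _ => 1) (Finset.univ.image v) ^ m) x ∈ Wf v (n + m) := by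
  induction m with
  | zero => simpa using hx
  | succ m ih => rw [pow_succ', Module.End.mul_apply]; exact ell_Wf v _ _ ih

lemma Wf_H {v : ι → V} {n : ℕ} {x : AA k V} (hx : x ∈ Wf v n) : x ∈ H n := by
  intro U hU; exact hx U fun h => hU (mem_Fl.1 h).2

lemma Wf_I {v : ι → V} {I : Submodule k V → Submodule ℝ (AA k V)}
    (g : Good (Finset.univ.image v) I) {n : ℕ} {x : AA k V} (hx : x ∈ Wf v n) : x ∈ I ⊥ := by
  refine Wf_ind _ (fun U hU => ?_) hx
  obtain ⟨⟨S, rfl⟩, -⟩ := mem_Fl.1 hU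
  have : ∀ S : Finset ι, I (Submodule.span k (v '' (S : Set ι))) ≤ I ⊥ := by
    intro S
    induction S using Finset.induction_on with
    | empty => simp
    | insert i S _ ih =>
      have e : Submodule.span k (v '' ((insert i S : Finset ι) : Set ι)) =
          pl (Submodule.span k (v '' (S : Set ι))) (v i) := by
        rw [Finset.coe_insert, Set.image_insert_eq, Submodule.span_insert, pl, sup_comm]
      rw [e]
      by_cases h : v i ∈ Submodule.span k (v '' (S : Set ι))
      · rwa [pl_of_mem h]
      · exact (g.sub _ _ (Finset.mem_image_of_mem v (Finset.mem_univ i)) h).trans ih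
  exact this S (g.yF _)

lemma count_fin [Fintype V] [Fintype k] (v : ι → V) (hv : Submodule.span k (Set.range v) = ⊤)
    (a : ℕ) (ha : 2 * a ≤ finrank k V) :
    (Fl k v a).card ≤ (Fl k v (finrank k V - a)).card := by
  obtain ⟨I, g⟩ := good_exists (Finset.univ.image v) (by simpa using hv)
  set m := finrank k V - 2 * a with hm
  set T : AA k V →ₗ[ℝ] AA k V := ell (fun _ => 1) (Finset.univ.image v) with hT
  have inj : ∀ x ∈ Wf v a, (T ^ m) x = 0 → x = 0 := by
    intro x hx h
    by_contra hne
    have hr := g.hr ⊥ a m x (Wf_I g hx) (Wf_H hx) (by rw [finrank_bot]; omega)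
      (by rw [pow_succ', Module.End.mul_apply, ← hT, h, map_zero]) hne
    rw [← hT, h] at hr
    simp at hr
  have hdeg : a + m = finrank k V - a := by omega
  let ext : (Fl k v a → ℝ) →ₗ[ℝ] AA k V :=
    { toFun := fun f U => if h : U ∈ Fl k v a then f ⟨U, h⟩ else 0
      map_add' := by intro f g; funext U; by_cases h : U ∈ Fl k v a <;> simp [h]
      map_smul' := by intro f g; funext U; by_cases h : U ∈ Fl k v a <;> simp [h] }
  have hext : ∀ f, ext f ∈ Wf v a := by
    intro f U hU
    show (if h : U ∈ Fl k v a then f ⟨U, h⟩ else 0) = 0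
    rw [dif_neg hU]
  let L : (Fl k v a → ℝ) →ₗ[ℝ] (Fl k v (finrank k V - a) → ℝ) :=
    LinearMap.funLeft ℝ ℝ (fun U : Fl k v (finrank k V - a) => (U : Submodule k V)) ∘ₗ
      (T ^ m) ∘ₗ ext
  have hL : Function.Injective L := by
    rw [← LinearMap.ker_eq_bot, LinearMap.ker_eq_bot']
    intro f hf
    have h1 : (T ^ m) (ext f) = 0 := by
      funext U
      by_cases hU : U ∈ Fl k v (finrank k V - a)
      · exact congrFun hf ⟨U, hU⟩
      · have := ell_pow_Wf v m a (ext f) (hext f)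
        rw [hdeg] at this
        exact this U hU
    have h2 := inj _ (hext f) h1
    funext U
    have h3 : (if h : (U : Submodule k V) ∈ Fl k v a then f ⟨U, h⟩ else 0) = 0 := congrFun h2 U
    rw [dif_pos U.2] at h3
    exact h3
  have := LinearMap.finrank_le_finrank_of_injective hL
  simpa using this

end
end GDE

namespace GDE
noncomputable section
open Classical
open Module
set_option linter.all false

lemma jacobson_int : IsJacobsonRing ℤ := by
  rw [isJacobsonRing_iff_prime_eq]
  intro P hP
  by_cases h : P = ⊥
  · subst h
    rw [eq_bot_iff]
    intro x hx
    rw [Submodule.mem_bot]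
    by_contra hx0
    obtain ⟨p, hp1, hp⟩ := Nat.exists_infinite_primes (x.natAbs + 1)
    have hpi : Prime (p : ℤ) := Nat.prime_iff_prime_int.1 hp
    have hm : (Ideal.span {(p : ℤ)}).IsMaximal :=
      PrincipalIdealRing.isMaximal_of_irreducible hpi.irreducible
    have h1 : x ∈ Ideal.span {(p : ℤ)} := by
      rw [Ideal.jacobson, Ideal.mem_sInf] at hx
      exact hx ⟨bot_le, hm⟩
    rw [Ideal.mem_span_singleton] at h1
    have h2 := Int.natAbs_dvd_natAbs.2 h1
    have h3 := Nat.le_of_dvd (Int.natAbs_pos.2 hx0) h2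
    simp at h3
    omega
  · have := IsPrime.to_maximal_ideal (hpi := hP) h
    exact Ideal.jacobson_eq_self_of_isMaximal

lemma finite_field_of_ft (S : Type*) [Field S] [Algebra.FiniteType ℤ S] : Finite S := by
  have := jacobson_int
  have hf : Module.Finite ℤ S := finite_of_finite_type_of_isJacobsonRing ℤ S
  obtain ⟨p, hp⟩ := CharP.exists S
  have hp0 : p ≠ 0 := by
    rintro rfl
    have := CharP.charP_to_charZero S
    have hinj : Function.Injective (algebraMap ℤ S) := by
      intro a b h; simpa using h
    exact Int.not_isField (isField_of_isIntegral_of_isField hinj (Field.toIsField S))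
  refine Module.finite_of_fg_torsion S ?_
  intro x
  refine ⟨⟨(p : ℤ), mem_nonZeroDivisors_of_ne_zero (by exact_mod_cast hp0)⟩, ?_⟩
  show (p : ℤ) • x = 0
  rw [zsmul_eq_mul]
  simp

lemma finite_field_of_surj {R : Type*} [CommRing R] [Algebra ℤ R] [Algebra.FiniteType ℤ R]
    (S : Type*) [Field S] (f : R →+* S) (hf : Function.Surjective f) : Finite S := by
  have : Algebra.FiniteType ℤ S := Algebra.FiniteType.of_surjective (R := ℤ) (A := R) (B := S)
    { f with commutes' := fun r => by simp } hf
  exact finite_field_of_ft S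

universe u

lemma exists_reduction {K : Type u} [Field K] {ι : Type*} [Fintype ι] {d : ℕ}
    (v : ι → Fin d → K) : ∃ (k : Type u) (_ : Field k) (_ : Finite k) (v' : ι → Fin d → k),
      ∀ t : Fin d → ι, (Matrix.of fun i => v (t i)).det = 0 ↔
        (Matrix.of fun i => v' (t i)).det = 0 := by
  let s : Set K := Set.range (fun p : ι × Fin d => v p.1 p.2) ∪
    Set.range (fun t : Fin d → ι => ((Matrix.of fun i => v (t i)).det)⁻¹)
  have hs : s.Finite := (Set.finite_range _).union (Set.finite_range _)
  let R := Algebra.adjoin ℤ s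
  have hR : Algebra.FiniteType ℤ R := by
    rw [← Subalgebra.fg_iff_finiteType]
    have := Subalgebra.fg_adjoin_finset (R := ℤ) hs.toFinset
    rwa [hs.coe_toFinset] at this
  obtain ⟨m, hm⟩ := Ideal.exists_maximal R
  letI : Field (R ⧸ m) := Ideal.Quotient.field m
  let w : ι → Fin d → R := fun i j => ⟨v i j, Algebra.subset_adjoin (Or.inl ⟨(i, j), rfl⟩)⟩
  let π : R →+* R ⧸ m := Ideal.Quotient.mk m
  refine ⟨R ⧸ m, inferInstance, ?_, fun i j => π (w i j), fun t => ?_⟩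
  · exact finite_field_of_surj (R := R) (R ⧸ m) π Ideal.Quotient.mk_surjective
  · have h1 : (R.val : R →+* K) (Matrix.of fun i => w (t i)).det = (Matrix.of fun i => v (t i)).det := by
      rw [RingHom.map_det]; rfl
    have h2 : π (Matrix.of fun i => w (t i)).det =
        (Matrix.of fun i => fun j => π (w (t i) j)).det := by
      rw [RingHom.map_det]; rfl
    constructor
    · intro h
      have h3 : (Matrix.of fun i => w (t i)).det = 0 := by
        apply Subtype.val_injective
        rw [h] at h1
        exact h1
      rw [← h2, h3, map_zero]
    · intro h
      by_contra hne
      let z : R := ⟨((Matrix.of fun i => v (t i)).det)⁻¹, Algebra.subset_adjoin (Or.inr ⟨t, rfl⟩)⟩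
      have h3 : (Matrix.of fun i => w (t i)).det * z = 1 := by
        apply Subtype.val_injective
        show (R.val : R →+* K) (Matrix.of fun i => w (t i)).det * _ = 1
        rw [h1]
        exact mul_inv_cancel₀ hne
      have h4 := congrArg π h3
      rw [map_mul, h2] at h4
      have h5 : (Matrix.of fun i => fun j => π (w (t i) j)).det = 0 := h
      rw [h5, zero_mul, map_one] at h4
      exact zero_ne_one h4

lemma det_ne_iff {K : Type*} [Field K] {d : ℕ} (u : Fin d → Fin d → K) :
    (Matrix.of u).det ≠ 0 ↔ LinearIndependent K u := by
  rw [← isUnit_iff_ne_zero, ← Matrix.isUnit_iff_isUnit_det, ← Matrix.linearIndependent_rows_iff_isUnit]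
  rfl

lemma exists_basis_ext {K V ι : Type*} [Field K] [AddCommGroup V] [Module K V] (v : ι → V)
    {s t : Set ι} (hst : s ⊆ t) (hs : LinearIndepOn K v s) :
    ∃ b, s ⊆ b ∧ b ⊆ t ∧ LinearIndepOn K v b ∧
      Submodule.span K (v '' b) = Submodule.span K (v '' t) := by
  obtain ⟨b, hbt, hsb, hspan, hb⟩ := exists_linearIndepOn_extension hs hst
  refine ⟨b, hsb, hbt, hb, le_antisymm (Submodule.span_mono (Set.image_mono hbt))
    (Submodule.span_le.2 hspan)⟩

lemma indep_transfer {K k : Type*} [Field K] [Field k] {ι : Type*} [Fintype ι] {d : ℕ}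
    {v : ι → Fin d → K} {v' : ι → Fin d → k}
    (h : ∀ t : Fin d → ι, (Matrix.of fun i => v (t i)).det = 0 ↔
        (Matrix.of fun i => v' (t i)).det = 0)
    (hv : Submodule.span K (Set.range v) = ⊤) {s : Set ι} (hs : LinearIndepOn K v s) :
    ∃ t : Fin d → ι, LinearIndependent k (v' ∘ t) ∧ s ⊆ Set.range t := by
  obtain ⟨b, hsb, -, hb, hspan⟩ := exists_basis_ext v (Set.subset_univ s) hs
  rw [Set.image_univ, hv] at hspan
  have hc : Fintype.card b = d := by
    have h1 := finrank_span_eq_card hb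
    have h2 : Set.range (fun x : b => v x) = v '' b := by
      ext; simp
    rw [h2, hspan, finrank_top] at h1
    simpa using h1.symm
  let e : Fin d ≃ b := (Fintype.equivFinOfCardEq hc).symm
  refine ⟨fun i => (e i : ι), ?_, ?_⟩
  · have h1 : LinearIndependent K (fun i => v (e i)) := hb.comp e e.injective
    rw [← det_ne_iff, ne_eq, h] at h1
    exact (det_ne_iff _).1 h1
  · intro i hi
    exact ⟨e.symm ⟨i, hsb hi⟩, by simp⟩

lemma indepOn_transfer {K k : Type*} [Field K] [Field k] {ι : Type*} [Fintype ι] {d : ℕ}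
    {v : ι → Fin d → K} {v' : ι → Fin d → k}
    (h : ∀ t : Fin d → ι, (Matrix.of fun i => v (t i)).det = 0 ↔
        (Matrix.of fun i => v' (t i)).det = 0)
    (hv : Submodule.span K (Set.range v) = ⊤) {s : Set ι} (hs : LinearIndepOn K v s) :
    LinearIndepOn k v' s := by
  obtain ⟨t, ht, hst⟩ := indep_transfer h hv hs
  choose f hf using fun i : s => hst i.2
  have : (fun i : s => v' i) = (v' ∘ t) ∘ f := by
    funext i; simp [hf]
  show LinearIndependent k (fun i : s => v' i)
  rw [this]
  refine ht.comp f fun i j hij => ?_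
  apply Subtype.ext
  rw [← hf i, ← hf j, hij]

lemma span_transfer {K k : Type*} [Field K] [Field k] {ι : Type*} [Fintype ι] {d : ℕ}
    {v : ι → Fin d → K} {v' : ι → Fin d → k}
    (h : ∀ t : Fin d → ι, (Matrix.of fun i => v (t i)).det = 0 ↔
        (Matrix.of fun i => v' (t i)).det = 0)
    (hv : Submodule.span K (Set.range v) = ⊤) : Submodule.span k (Set.range v') = ⊤ := by
  obtain ⟨t, ht, -⟩ := indep_transfer h hv (s := ∅) (linearIndepOn_empty K v)
  have h1 := ht.span_eq_top_of_card_eq_finrank' (by simp)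
  rw [eq_top_iff, ← h1]
  exact Submodule.span_mono (Set.range_comp_subset_range t v')

lemma rank_le {K k : Type*} [Field K] [Field k] {ι : Type*} [Fintype ι] {d : ℕ}
    {v : ι → Fin d → K} {v' : ι → Fin d → k}
    (h : ∀ t : Fin d → ι, (Matrix.of fun i => v (t i)).det = 0 ↔
        (Matrix.of fun i => v' (t i)).det = 0)
    (hv : Submodule.span K (Set.range v) = ⊤) (S : Set ι) :
    finrank K (Submodule.span K (v '' S)) ≤ finrank k (Submodule.span k (v' '' S)) := by
  obtain ⟨b, -, hbS, hb, hspan⟩ := exists_basis_ext v (Set.empty_subset S) (linearIndepOn_empty K v)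
  have hb' := indepOn_transfer h hv hb
  have e1 : finrank K (Submodule.span K (v '' b)) = Fintype.card b := by
    rw [Set.image_eq_range]; exact finrank_span_eq_card hb
  have e2 : finrank k (Submodule.span k (v' '' b)) = Fintype.card b := by
    rw [Set.image_eq_range]; exact finrank_span_eq_card hb'
  rw [← hspan, e1, ← e2]
  exact Submodule.finrank_mono (Submodule.span_mono (Set.image_mono hbS))

lemma card_image_le_of {α β γ : Type*} (s : Finset α) (f : α → β) (g : α → γ)
    (h : ∀ x ∈ s, ∀ z ∈ s, g x = g z → f x = f z) : (s.image f).card ≤ (s.image g).card := by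
  by_cases hs : s.Nonempty
  · obtain ⟨a, ha⟩ := hs
    have hc : ∀ c : γ, ∃ z ∈ s, (∃ x ∈ s, g x = c) → g z = c := by
      intro c
      by_cases hx : ∃ x ∈ s, g x = c
      · obtain ⟨x, hx, hc⟩ := hx
        exact ⟨x, hx, fun _ => hc⟩
      · exact ⟨a, ha, fun h => absurd h hx⟩
    choose p hp1 hp2 using hc
    have : s.image f ⊆ (s.image g).image (f ∘ p) := by
      intro b hb
      obtain ⟨x, hx, rfl⟩ := Finset.mem_image.1 hb
      refine Finset.mem_image.2 ⟨g x, Finset.mem_image_of_mem g hx, ?_⟩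
      exact h _ (hp1 _) _ hx (hp2 _ ⟨x, hx, rfl⟩)
    exact (Finset.card_le_card this).trans Finset.card_image_le
  · rw [Finset.not_nonempty_iff_eq_empty] at hs
    subst hs; simp

lemma card_Fl_le {K k V W ι : Type*} [Field K] [Field k] [AddCommGroup V] [Module K V]
    [AddCommGroup W] [Module k W] [FiniteDimensional K V] [FiniteDimensional k W] [Fintype ι]
    (v : ι → V) (w : ι → W)
    (h : ∀ S : Set ι, finrank K (Submodule.span K (v '' S)) = finrank k (Submodule.span k (w '' S)))
    (n : ℕ) : (Fl K v n).card ≤ (Fl k w n).card := by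
  have key : ∀ S T : Set ι, Submodule.span k (w '' S) = Submodule.span k (w '' T) →
      Submodule.span K (v '' S) ≤ Submodule.span K (v '' T) := by
    intro S T hST
    have h1 : Submodule.span k (w '' (S ∪ T)) = Submodule.span k (w '' T) := by
      rw [Set.image_union, Submodule.span_union, hST, sup_idem]
    have h2 : Submodule.span K (v '' T) = Submodule.span K (v '' (S ∪ T)) := by
      refine Submodule.eq_of_le_of_finrank_eq
        (Submodule.span_mono (Set.image_mono Set.subset_union_right)) ?_
      rw [h, h, h1]
    rw [h2]
    exact Submodule.span_mono (Set.image_mono Set.subset_union_left)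
  unfold Fl
  rw [Finset.filter_image, Finset.filter_image]
  have e : (Finset.univ.filter fun S : Finset ι =>
      finrank k (Submodule.span k (w '' (S : Set ι))) = n) = (Finset.univ.filter fun S : Finset ι =>
      finrank K (Submodule.span K (v '' (S : Set ι))) = n) := by
    ext S; simp [h]
  rw [e]
  exact card_image_le_of _ _ _ fun S _ T _ hST => le_antisymm (key _ _ hST) (key _ _ hST.symm)

lemma count_all {K V ι : Type*} [Field K] [AddCommGroup V] [Module K V] [FiniteDimensional K V]
    [Fintype ι] (v : ι → V) (hv : Submodule.span K (Set.range v) = ⊤) (a : ℕ)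
    (ha : 2 * a ≤ finrank K V) :
    (Fl K v a).card ≤ (Fl K v (finrank K V - a)).card := by
  let e : V ≃ₗ[K] (Fin (finrank K V) → K) := (finBasis K V).equivFun
  let u : ι → Fin (finrank K V) → K := fun i => e (v i)
  have hmap : ∀ S : Set ι, Submodule.span K (u '' S) =
      (Submodule.span K (v '' S)).map (e : V →ₗ[K] (Fin (finrank K V) → K)) := by
    intro S
    rw [Submodule.map_span, Set.image_image]; rfl
  have hu : Submodule.span K (Set.range u) = ⊤ := by
    rw [← Set.image_univ, hmap, Set.image_univ, hv, Submodule.map_top]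
    exact LinearEquiv.range e
  obtain ⟨k, hk, hfin, w, hw⟩ := exists_reduction u
  have hwspan := span_transfer hw hu
  have hr : ∀ S : Set ι, finrank K (Submodule.span K (v '' S)) =
      finrank k (Submodule.span k (w '' S)) := by
    intro S
    rw [← LinearEquiv.finrank_map_eq e]
    rw [show (Submodule.span K (v '' S)).map (e : V →ₗ[K] (Fin (finrank K V) → K)) =
      Submodule.span K (u '' S) from (hmap S).symm]
    exact le_antisymm (rank_le hw hu S) (rank_le (fun t => (hw t).symm) hwspan S)
  have : Fintype k := Fintype.ofFinite k
  have : Finite (Submodule k (Fin (finrank K V) → k)) :=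
    Finite.of_injective (fun U => (U : Set (Fin (finrank K V) → k))) SetLike.coe_injective
  have : Fintype (Submodule k (Fin (finrank K V) → k)) := Fintype.ofFinite _
  have hd : finrank k (Fin (finrank K V) → k) = finrank K V := by simp
  have hc := count_fin w hwspan a (by rw [hd]; exact ha)
  rw [hd] at hc
  exact (card_Fl_le v w hr a).trans (hc.trans (card_Fl_le w v (fun S => (hr S).symm) _))

end
end GDE


/-- **Generalized de Bruijn–Erdős theorem.** If `E` is a finite spanning subset of a
`d`-dimensional vector space `V` over a field `K`, then for every `k ≤ d/2` there are at
least as many `(d-k)`-dimensional subspaces of `V` spanned by subsets of `E` as there are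
`k`-dimensional ones. -/
theorem generalized_deBruijn_Erdos {K V : Type*} [Field K] [AddCommGroup V] [Module K V]
    [FiniteDimensional K V] (d : ℕ) (hd : Module.finrank K V = d)
    (E : Finset V) (hspan : Submodule.span K (E : Set V) = ⊤) :
    ∀ k : ℕ, 2 * k ≤ d →
      numSpannedSubspaces K E k ≤ numSpannedSubspaces K E (d - k) := by
  intro k hk
  classical
  have hv : Submodule.span K (Set.range fun x : E => (x : V)) = ⊤ := by
    rw [← hspan]; congr 1; ext; simp
  have key : ∀ n, numSpannedSubspaces K E n = (GDE.Fl K (fun x : E => (x : V)) n).card := by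
    intro n
    unfold numSpannedSubspaces
    congr 1
    ext U
    rw [GDE.mem_Fl, Finset.mem_filter, Finset.mem_image]
    refine and_congr_left fun _ => ⟨?_, ?_⟩
    · rintro ⟨S, hS, rfl⟩
      rw [Finset.mem_powerset] at hS
      refine ⟨S.subtype (fun x => x ∈ E), ?_⟩
      congr 1
      ext x
      simp only [Set.mem_image, Finset.mem_coe, Finset.mem_subtype]
      exact ⟨fun ⟨z, hz, h⟩ => h ▸ hz, fun h => ⟨⟨x, hS h⟩, h, rfl⟩⟩
    · rintro ⟨S, rfl⟩
      refine ⟨S.image (fun x : E => (x : V)), ?_, by rw [Finset.coe_image]⟩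
      rw [Finset.mem_powerset]
      intro x hx
      obtain ⟨z, -, rfl⟩ := Finset.mem_image.1 hx
      exact z.2
  rw [key, key, ← hd]
  exact GDE.count_all _ hv k (by omega)
end

section
/- Let M be a loopless matroid of rank d+1 on a finite ground set E. Then there exists a unique group isomorphism deg : A^d(M) → ℤ such that deg(x_{F_1} x_{F_2} ⋯ x_{F_d}) = 1 for every complete flag F_1 ⊊ F_2 ⊊ ⋯ ⊊ F_d of nonempty proper flats of M (where x_{F_1} x_{F_2} ⋯ x_{F_d} denotes the image in A^d(M) of the corresponding monomial). -/
structure FinMatroid (E : Type*) [Fintype E] [DecidableEq E] where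
  Indep : Finset E → Prop
  indep_empty : Indep ∅
  indep_subset : ∀ ⦃I J : Finset E⦄, Indep J → I ⊆ J → Indep I
  indep_exchange : ∀ ⦃I J : Finset E⦄, Indep I → Indep J → I.card < J.card →
    ∃ e ∈ J, e ∉ I ∧ Indep (insert e I)

namespace FinMatroid

variable {E : Type*} [Fintype E] [DecidableEq E]

open Classical in
noncomputable def rank (M : FinMatroid E) (A : Finset E) : ℕ :=
  (A.powerset.filter fun I => M.Indep I).sup Finset.card

noncomputable def rk (M : FinMatroid E) : ℕ := M.rank Finset.univ

noncomputable def closure (M : FinMatroid E) (A : Finset E) : Finset E :=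
  Finset.univ.filter fun x => M.rank (insert x A) = M.rank A

def IsFlat (M : FinMatroid E) (F : Finset E) : Prop := M.closure F = F

def Loopless (M : FinMatroid E) : Prop := M.closure ∅ = ∅

/-- The type of nonempty proper flats of `M`. -/
def ProperFlat (M : FinMatroid E) : Type _ :=
  {F : Finset E // M.IsFlat F ∧ F ≠ ∅ ∧ F ≠ Finset.univ}

instance (M : FinMatroid E) : Finite (ProperFlat M) := Subtype.finite

noncomputable instance (M : FinMatroid E) : Fintype (ProperFlat M) := Fintype.ofFinite _

variable (R : Type*) [CommRing R]

/-- The ideal of relations defining the Chow ring of a matroid: the linear relations (CH1)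
`Σ_{F ∋ a} x_F = Σ_{F ∋ b} x_F` for `a, b ∈ E`, and the quadratic relations (CH2)
`x_F · x_{F'} = 0` for incomparable proper flats `F, F'`. -/
noncomputable def chowIdeal (M : FinMatroid E) : Ideal (MvPolynomial (ProperFlat M) R) :=
  Ideal.span
    ((Set.range fun ab : E × E =>
        (∑ F : ProperFlat M, if ab.1 ∈ F.1 then MvPolynomial.X F else 0) -
        (∑ F : ProperFlat M, if ab.2 ∈ F.1 then MvPolynomial.X F else 0)) ∪
     {p | ∃ F F' : ProperFlat M, ¬F.1 ⊆ F'.1 ∧ ¬F'.1 ⊆ F.1 ∧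
        p = MvPolynomial.X F * MvPolynomial.X F'})

/-- The Chow ring `A*(M)` (with coefficients in `R`). -/
abbrev ChowRing (M : FinMatroid E) := MvPolynomial (ProperFlat M) R ⧸ chowIdeal R M

/-- The quotient map from the polynomial ring onto the Chow ring. -/
noncomputable def chowMk (M : FinMatroid E) :
    MvPolynomial (ProperFlat M) R →ₐ[R] ChowRing R M :=
  Ideal.Quotient.mkₐ R (chowIdeal R M)

/-- The degree-`k` graded piece `A^k(M)` of the Chow ring: the image of the homogeneous
degree-`k` polynomials. -/
noncomputable def piece (M : FinMatroid E) (k : ℕ) : Submodule R (ChowRing R M) :=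
  (MvPolynomial.homogeneousSubmodule (ProperFlat M) R k).map (chowMk R M).toLinearMap

lemma mk_mem_piece {M : FinMatroid E} {p : MvPolynomial (ProperFlat M) R} {k : ℕ}
    (hp : p.IsHomogeneous k) : chowMk R M p ∈ piece R M k :=
  ⟨p, (MvPolynomial.mem_homogeneousSubmodule _ _).2 hp, rfl⟩

lemma mul_mem_piece {M : FinMatroid E} {k l : ℕ} {a b : ChowRing R M}
    (ha : a ∈ piece R M k) (hb : b ∈ piece R M l) : a * b ∈ piece R M (k + l) := by
  obtain ⟨p, hp, rfl⟩ := ha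
  obtain ⟨q, hq, rfl⟩ := hb
  refine ⟨p * q, ?_, by simp⟩
  simp only [SetLike.mem_coe, MvPolynomial.mem_homogeneousSubmodule] at hp hq ⊢
  exact hp.mul hq

lemma pow_mem_piece {M : FinMatroid E} {a : ChowRing R M} (ha : a ∈ piece R M 1) (m : ℕ) :
    a ^ m ∈ piece R M m := by
  induction m with
  | zero =>
      refine ⟨1, ?_, by simp⟩
      simp only [SetLike.mem_coe, MvPolynomial.mem_homogeneousSubmodule]
      simpa using MvPolynomial.isHomogeneous_one (ProperFlat M) R
  | succ n ih =>
      have h := mul_mem_piece R ih ha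
      simpa [pow_succ] using h

/-- The image in the Chow ring of the monomial attached to a flag of `d` proper flats lies in
the degree-`d` graded piece. -/
lemma flagMonomial_mem (M : FinMatroid E) (d : ℕ) (flag : Fin d → ProperFlat M) :
    chowMk R M (∏ i, MvPolynomial.X (flag i)) ∈ piece R M d := by
  refine mk_mem_piece R ?_
  have h := MvPolynomial.IsHomogeneous.prod (R := R) Finset.univ
    (fun i => MvPolynomial.X (flag i)) (fun _ => 1)
    (fun i _ => MvPolynomial.isHomogeneous_X R (flag i))
  simpa using h

/-- Homogeneity (of degree one) of an `R`-linear combination of the variables. -/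
lemma isHomogeneous_comb (M : FinMatroid E) (P : ProperFlat M → Prop) [DecidablePred P]
    (c : ProperFlat M → R) :
    MvPolynomial.IsHomogeneous
      (∑ F : ProperFlat M, if P F then MvPolynomial.C (c F) * MvPolynomial.X F else 0) 1 := by
  refine MvPolynomial.IsHomogeneous.sum _ _ _ (fun F _ => ?_)
  by_cases h : P F
  · simp only [h, if_true]
    simpa using (MvPolynomial.isHomogeneous_C (ProperFlat M) (c F)).mul
      (MvPolynomial.isHomogeneous_X R F)
  · simp [h, MvPolynomial.isHomogeneous_zero]

end FinMatroid


namespace FinMatroid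

section MatroidBasics

variable {E : Type*} [Fintype E] [DecidableEq E] (M : FinMatroid E)

lemma card_le_rank {I A : Finset E} (hI : M.Indep I) (h : I ⊆ A) : I.card ≤ M.rank A := by
  classical
  unfold rank
  exact Finset.le_sup (f := Finset.card) (by simp [hI, h])

lemma exists_indep_card (A : Finset E) : ∃ I ⊆ A, M.Indep I ∧ I.card = M.rank A := by
  classical
  unfold rank
  obtain ⟨I, hI, h⟩ := Finset.exists_mem_eq_sup (A.powerset.filter fun I => M.Indep I)
    ⟨∅, by simp [M.indep_empty]⟩ Finset.card
  simp only [Finset.mem_filter, Finset.mem_powerset] at hI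
  exact ⟨I, hI.1, hI.2, h.symm⟩

lemma rank_mono {A B : Finset E} (h : A ⊆ B) : M.rank A ≤ M.rank B := by
  obtain ⟨I, hI, h1, h2⟩ := M.exists_indep_card A
  rw [← h2]
  exact M.card_le_rank h1 (hI.trans h)

lemma rank_le_card (A : Finset E) : M.rank A ≤ A.card := by
  obtain ⟨I, hI, h1, h2⟩ := M.exists_indep_card A
  rw [← h2]
  exact Finset.card_le_card hI

lemma rank_indep {I : Finset E} (h : M.Indep I) : M.rank I = I.card :=
  le_antisymm (M.rank_le_card I) (M.card_le_rank h subset_rfl)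

lemma exists_extend {A : Finset E} : ∀ (n : ℕ) (I : Finset E), M.Indep I → I ⊆ A →
    n = M.rank A - I.card → ∃ J, I ⊆ J ∧ J ⊆ A ∧ M.Indep J ∧ J.card = M.rank A := by
  intro n
  induction n with
  | zero =>
    intro I hI hA hn
    exact ⟨I, subset_rfl, hA, hI, le_antisymm (M.card_le_rank hI hA) (by omega)⟩
  | succ n ih =>
    intro I hI hA hn
    obtain ⟨K, hK, h1, h2⟩ := M.exists_indep_card A
    obtain ⟨e, he, heI, hi⟩ := M.indep_exchange hI h1 (by omega)
    obtain ⟨J, hJ, h3⟩ := ih (insert e I) hi (Finset.insert_subset (hK he) hA)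
      (by rw [Finset.card_insert_of_notMem heI]; omega)
    exact ⟨J, (Finset.subset_insert _ _).trans hJ, h3⟩

lemma rank_submod (A B : Finset E) :
    M.rank (A ∪ B) + M.rank (A ∩ B) ≤ M.rank A + M.rank B := by
  obtain ⟨I, hI, h1, h2⟩ := M.exists_indep_card (A ∩ B)
  obtain ⟨K, hIK, hK, h3, h4⟩ := M.exists_extend (A := A ∪ B) _ I h1
    (hI.trans (Finset.inter_subset_left.trans Finset.subset_union_left)) rfl
  have hA : (K ∩ A).card ≤ M.rank A :=
    M.card_le_rank (M.indep_subset h3 Finset.inter_subset_left) Finset.inter_subset_right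
  have hB : (K ∩ B).card ≤ M.rank B :=
    M.card_le_rank (M.indep_subset h3 Finset.inter_subset_left) Finset.inter_subset_right
  have h5 := Finset.card_union_add_card_inter (K ∩ A) (K ∩ B)
  have h6 : K ∩ A ∪ K ∩ B = K := by
    rw [← Finset.inter_union_distrib_left]
    exact Finset.inter_eq_left.2 hK
  have h7 : I ⊆ (K ∩ A) ∩ (K ∩ B) := by
    intro x hx
    have := hI hx
    have := hIK hx
    simp_all
  have h8 := Finset.card_le_card h7
  rw [h6] at h5
  omega

lemma rank_submod' {A B C D : Finset E} (h1 : C ⊆ A ∪ B) (h2 : D ⊆ A) (h3 : D ⊆ B) :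
    M.rank C + M.rank D ≤ M.rank A + M.rank B := by
  have := M.rank_submod A B
  have := M.rank_mono h1
  have := M.rank_mono (Finset.subset_inter h2 h3)
  omega

lemma mem_closure {A : Finset E} {x : E} :
    x ∈ M.closure A ↔ M.rank (insert x A) = M.rank A := by
  simp [closure]

lemma subset_closure (A : Finset E) : A ⊆ M.closure A := by
  intro x hx
  rw [mem_closure, Finset.insert_eq_of_mem hx]

lemma rank_union_of_subset_closure (A : Finset E) :
    ∀ B : Finset E, B ⊆ M.closure A → M.rank (A ∪ B) = M.rank A := by
  intro B
  induction B using Finset.induction_on with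
  | empty => simp
  | insert x B hx ih =>
    intro h
    have h1 := ih ((Finset.subset_insert _ _).trans h)
    have h2 := M.mem_closure.1 (h (Finset.mem_insert_self x B))
    have h3 := M.rank_submod' (A := A ∪ B) (B := insert x A) (C := A ∪ insert x B) (D := A)
      (by intro y; simp; tauto) Finset.subset_union_left (Finset.subset_insert _ _)
    have h4 := M.rank_mono (Finset.subset_union_left (s₁ := A) (s₂ := insert x B))
    omega

lemma rank_closure (A : Finset E) : M.rank (M.closure A) = M.rank A := by
  have := M.rank_union_of_subset_closure A _ subset_rfl
  rwa [Finset.union_eq_right.2 (M.subset_closure A)] at this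

lemma isFlat_closure (A : Finset E) : M.IsFlat (M.closure A) := by
  refine Finset.Subset.antisymm (fun x hx => ?_) (M.subset_closure _)
  rw [mem_closure, rank_closure] at hx
  rw [mem_closure]
  have := M.rank_mono (Finset.insert_subset_insert x (M.subset_closure A))
  have := M.rank_mono (Finset.subset_insert x A)
  omega

lemma closure_subset {A H : Finset E} (hH : M.IsFlat H) (h : A ⊆ H) : M.closure A ⊆ H := by
  intro x hx
  rw [mem_closure] at hx
  rw [← hH, mem_closure]
  have := M.rank_submod' (A := H) (B := insert x A) (C := insert x H) (D := A)
    (by intro y; simp; tauto) h (Finset.subset_insert _ _)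
  have := M.rank_mono (Finset.subset_insert x H)
  omega

lemma closure_subset_iff {A H : Finset E} (hH : M.IsFlat H) : M.closure A ⊆ H ↔ A ⊆ H :=
  ⟨(M.subset_closure A).trans, M.closure_subset hH⟩

lemma rank_closure_union (S T : Finset E) : M.rank (M.closure S ∪ T) ≤ M.rank (S ∪ T) := by
  have h := M.rank_submod' (A := S ∪ T) (B := M.closure S) (C := M.closure S ∪ T) (D := S)
    (by intro y; simp; tauto) Finset.subset_union_left (M.subset_closure S)
  rw [rank_closure] at h
  omega

lemma rank_lt {F G : Finset E} (hF : M.IsFlat F) (h : F ⊂ G) : M.rank F < M.rank G := by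
  obtain ⟨x, hx, hxF⟩ := Finset.exists_of_ssubset h
  have h1 := M.rank_mono (Finset.insert_subset hx h.1)
  have h2 := M.rank_mono (Finset.subset_insert x F)
  have h3 : ¬ M.rank (insert x F) = M.rank F := by
    rw [← mem_closure, hF]; exact hxF
  omega

lemma rank_empty : M.rank ∅ = 0 := by
  have := M.rank_le_card ∅
  simpa using this

lemma isFlat_univ : M.IsFlat Finset.univ :=
  Finset.Subset.antisymm (Finset.subset_univ _) (M.subset_closure _)

lemma rank_proper_pos (hM : M.Loopless) (F : ProperFlat M) : 1 ≤ M.rank F.1 := by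
  have := M.rank_lt (F := ∅) hM (Finset.empty_ssubset.2 (Finset.nonempty_iff_ne_empty.2 F.2.2.1))
  omega

lemma rank_proper_lt (F : ProperFlat M) : M.rank F.1 < M.rk :=
  M.rank_lt F.2.1 (Finset.ssubset_univ_iff.2 F.2.2.2)

lemma rank_singleton_le (a : E) : M.rank {a} ≤ 1 := by
  simpa using M.rank_le_card {a}

lemma eq_of_subset_of_rank {F G : Finset E} (hF : M.IsFlat F) (h : F ⊆ G)
    (hr : M.rank G ≤ M.rank F) : F = G := by
  by_contra hne
  have := M.rank_lt hF (Finset.ssubset_iff_subset_ne.2 ⟨h, hne⟩)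
  omega

lemma exists_flag (d : ℕ) (hrk : M.rk = d + 1) :
    ∃ flag : Fin d → ProperFlat M, ∀ i j : Fin d, i < j → (flag i).1 ⊂ (flag j).1 := by
  classical
  obtain ⟨I, -, hI, hc⟩ := M.exists_indep_card Finset.univ
  have hc' : I.card = d + 1 := hc.trans hrk
  let e := (I.equivFinOfCardEq hc').symm
  let S : Fin d → Finset E := fun i =>
    (Finset.univ.filter (fun j : Fin (d+1) => j.1 ≤ i.1)).image (fun j => (e j).1)
  have hcard : ∀ i, (S i).card = i.1 + 1 := by
    intro i
    have h0 := Finset.card_image_of_injective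
      (Finset.univ.filter (fun j : Fin (d+1) => j.1 ≤ i.1))
      (Subtype.val_injective.comp e.injective)
    refine h0.trans ?_
    have : (Finset.univ.filter (fun j : Fin (d+1) => j.1 ≤ i.1)) = Finset.Iic i.castSucc := by
      ext j; simp [Fin.le_def]
    rw [this, Fin.card_Iic]
    simp
  have hrank : ∀ i, M.rank (M.closure (S i)) = i.1 + 1 := by
    intro i
    rw [rank_closure, rank_indep, hcard]
    refine M.indep_subset hI ?_
    intro x hx
    simp only [S, Finset.mem_image] at hx
    obtain ⟨j, -, rfl⟩ := hx
    exact (e j).2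
  refine ⟨fun i => ⟨M.closure (S i), M.isFlat_closure _, ?_, ?_⟩, ?_⟩
  · intro h
    have := hrank i
    rw [h, rank_empty] at this
    omega
  · intro h
    have := hrank i
    rw [h] at this
    change M.rk = _ at this
    omega
  · intro i j hij
    have hsub : M.closure (S i) ⊆ M.closure (S j) := by
      refine M.closure_subset (M.isFlat_closure _) (Finset.Subset.trans ?_ (M.subset_closure _))
      refine Finset.image_subset_image ?_
      intro k hk
      simp only [Finset.mem_filter, Finset.mem_univ, true_and] at hk ⊢
      have : i.1 < j.1 := hij
      omega
    refine Finset.ssubset_iff_subset_ne.2 ⟨hsub, fun h => ?_⟩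
    have h1 := hrank i
    have h2 := hrank j
    have h3 : M.closure (S i) = M.closure (S j) := h
    rw [h3] at h1
    have : i.1 < j.1 := hij
    omega

end MatroidBasics

end FinMatroid

namespace FinMatroid

section AbstractChow

variable {E : Type*} [Fintype E] [DecidableEq E] {M : FinMatroid E}
  {A : Type*} [CommRing A] {x : ProperFlat M → A} {α : A}

lemma chow_vanish (hα : ∀ a : E, α = ∑ F : ProperFlat M, if a ∈ F.1 then x F else 0)
    (hx : ∀ F G : ProperFlat M, ¬ F.1 ⊆ G.1 → ¬ G.1 ⊆ F.1 → x F * x G = 0) :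
    ∀ (m : ℕ) (F : ProperFlat M), M.rk ≤ m + M.rank F.1 → x F * α ^ m = 0 := by
  intro m
  induction m with
  | zero =>
    intro F h
    have := M.rank_proper_lt F
    omega
  | succ m ih =>
    intro F h
    obtain ⟨b, -, hb⟩ := Finset.exists_of_ssubset (Finset.ssubset_univ_iff.2 F.2.2.2)
    rw [pow_succ', hα b, ← hα b, ← mul_assoc]
    nth_rewrite 1 [hα b]
    rw [Finset.mul_sum, Finset.sum_mul]
    refine Finset.sum_eq_zero fun G _ => ?_
    split_ifs with hG
    · have h1 : ¬ G.1 ⊆ F.1 := fun h => hb (h hG)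
      by_cases h2 : F.1 ⊆ G.1
      · have := M.rank_lt F.2.1 ⟨h2, h1⟩
        rw [mul_assoc, ih G (by omega), mul_zero]
      · rw [hx F G h2 h1, zero_mul]
    · simp

lemma chow_step (hα : ∀ a : E, α = ∑ F : ProperFlat M, if a ∈ F.1 then x F else 0)
    (hx : ∀ F G : ProperFlat M, ¬ F.1 ⊆ G.1 → ¬ G.1 ⊆ F.1 → x F * x G = 0)
    (F : Finset E) (hF : M.IsFlat F) (c : A)
    (hc : ∀ G : ProperFlat M, ¬ F ⊆ G.1 → ¬ G.1 ⊆ F → c * x G = 0)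
    (G : ProperFlat M) (hFG : F ⊂ G.1) (hr : M.rank G.1 = M.rank F + 1) (m : ℕ)
    (hm : M.rk ≤ m + M.rank G.1 + 1) : c * α ^ (m + 1) = c * x G * α ^ m := by
  obtain ⟨b, hbG, hbF⟩ := Finset.exists_of_ssubset hFG
  rw [pow_succ', ← mul_assoc]
  nth_rewrite 1 [hα b]
  rw [Finset.mul_sum, Finset.sum_mul]
  have hK : ∀ H : ProperFlat M, F ⊆ H.1 → b ∈ H.1 → M.rank H.1 = M.rank F + 1 →
      M.closure (insert b F) = H.1 := by
    intro H h1 h2 h3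
    refine M.eq_of_subset_of_rank (M.isFlat_closure _)
      (M.closure_subset H.2.1 (Finset.insert_subset h2 h1)) ?_
    have := M.rank_lt hF (Finset.ssubset_insert hbF)
    rw [rank_closure]
    omega
  rw [Finset.sum_eq_single G]
  · rw [if_pos hbG]
  · intro H _ hne
    split_ifs with hH
    · have h1 : ¬ H.1 ⊆ F := fun h => hbF (h hH)
      by_cases h2 : F ⊆ H.1
      · have h3 := M.rank_lt hF ⟨h2, h1⟩
        have h4 : M.rank H.1 ≠ M.rank F + 1 := by
          intro h4
          exact hne (Subtype.ext ((hK H h2 hH h4).symm.trans (hK G hFG.1 hbG hr)))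
        rw [mul_assoc, chow_vanish hα hx m H (by omega), mul_zero]
      · rw [hc H h2 h1, zero_mul]
    · simp
  · simp

lemma chow_chain (hM : M.Loopless)
    (hα : ∀ a : E, α = ∑ F : ProperFlat M, if a ∈ F.1 then x F else 0)
    (hx : ∀ F G : ProperFlat M, ¬ F.1 ⊆ G.1 → ¬ G.1 ⊆ F.1 → x F * x G = 0) {d : ℕ}
    (hrk : M.rk = d + 1) :
    ∀ (k : ℕ) (C : Finset (ProperFlat M)), (∀ F ∈ C, ∀ G ∈ C, F.1 ⊆ G.1 ∨ G.1 ⊆ F.1) →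
      C.card = k → C.image (fun F => M.rank F.1) = Finset.Icc 1 k → ∀ m, m + k = d →
      (∏ F ∈ C, x F) * α ^ m = α ^ d := by
  classical
  intro k
  induction k with
  | zero =>
    intro C _ hk _ m hm
    rw [Finset.card_eq_zero] at hk
    subst hk
    simp at hm
    simp [hm]
  | succ k ih =>
    intro C hC hk hI m hm
    have hinj : Set.InjOn (fun F : ProperFlat M => M.rank F.1) (C : Set (ProperFlat M)) := by
      rw [← Finset.card_image_iff, hI, hk]; simp
    obtain ⟨G, hG, hGr⟩ := Finset.mem_image.1 (hI.symm ▸ Finset.mem_Icc.2 ⟨by omega, le_rfl⟩ :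
      (k + 1) ∈ C.image (fun F => M.rank F.1))
    try simp only at hGr
    have hI' : (C.erase G).image (fun F => M.rank F.1) = Finset.Icc 1 k := by
      ext j
      constructor
      · intro hj
        obtain ⟨F, hF, rfl⟩ := Finset.mem_image.1 hj
        have h1 := Finset.mem_Icc.1 (hI ▸ Finset.mem_image_of_mem (fun F : ProperFlat M => M.rank F.1)
          (Finset.mem_of_mem_erase hF))
        have h2 : M.rank F.1 ≠ M.rank G.1 := fun h =>
          Finset.ne_of_mem_erase hF (hinj (Finset.mem_of_mem_erase hF) hG h)
        simp only [Finset.mem_Icc]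
        omega
      · intro hj
        rw [Finset.mem_Icc] at hj
        obtain ⟨F, hF, hFr⟩ := Finset.mem_image.1 (hI.symm ▸ Finset.mem_Icc.2 ⟨hj.1, by omega⟩ :
          j ∈ C.image (fun F => M.rank F.1))
        refine Finset.mem_image.2 ⟨F, Finset.mem_erase.2 ⟨?_, hF⟩, hFr⟩
        rintro rfl
        try simp only at hFr
        omega
    have hrec := ih (C.erase G)
      (fun F hF H hH => hC F (Finset.mem_of_mem_erase hF) H (Finset.mem_of_mem_erase hH))
      (by rw [Finset.card_erase_of_mem hG, hk]; rfl) hI' (m + 1) (by omega)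
    rw [← hrec, ← Finset.prod_erase_mul _ _ hG]
    symm
    rcases Nat.eq_zero_or_pos k with rfl | hkpos
    · have h0 : C.erase G = ∅ := by
        rw [← Finset.card_eq_zero, Finset.card_erase_of_mem hG, hk]
      rw [h0, Finset.prod_empty]
      refine chow_step hα hx ∅ hM 1 (fun H h => absurd (Finset.empty_subset _) h) G
        (Finset.empty_ssubset.2 (Finset.nonempty_iff_ne_empty.2 G.2.2.1)) ?_ m (by omega)
      rw [rank_empty, hGr]
    · obtain ⟨F, hF, hFr⟩ := Finset.mem_image.1 (hI'.symm ▸ Finset.mem_Icc.2 ⟨hkpos, le_rfl⟩ :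
        k ∈ (C.erase G).image (fun F => M.rank F.1))
      try simp only at hFr
      have hFG : F.1 ⊂ G.1 := by
        rcases hC F (Finset.mem_of_mem_erase hF) G hG with h | h
        · refine Finset.ssubset_iff_subset_ne.2 ⟨h, fun h' => ?_⟩
          exact Finset.ne_of_mem_erase hF (Subtype.ext h')
        · have := M.rank_mono h
          omega
      refine chow_step hα hx F.1 F.2.1 _ (fun H h1 h2 => ?_) G hFG (by omega) m (by omega)
      rw [← Finset.prod_erase_mul _ _ hF, mul_assoc, hx F H h1 h2, mul_zero]

/-- A chain of `d` proper flats in rank `d + 1` has product `α ^ d`. -/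
lemma chow_chain_top (hM : M.Loopless)
    (hα : ∀ a : E, α = ∑ F : ProperFlat M, if a ∈ F.1 then x F else 0)
    (hx : ∀ F G : ProperFlat M, ¬ F.1 ⊆ G.1 → ¬ G.1 ⊆ F.1 → x F * x G = 0) {d : ℕ}
    (hrk : M.rk = d + 1) (C : Finset (ProperFlat M))
    (hC : ∀ F ∈ C, ∀ G ∈ C, F.1 ⊆ G.1 ∨ G.1 ⊆ F.1) (hd : C.card = d) :
    ∏ F ∈ C, x F = α ^ d := by
  classical
  have hinj : Set.InjOn (fun F : ProperFlat M => M.rank F.1) (C : Set (ProperFlat M)) := by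
    intro F hF G hG h
    try simp only at h
    rcases hC F hF G hG with h1 | h1
    · exact Subtype.ext (M.eq_of_subset_of_rank F.2.1 h1 h.ge)
    · exact (Subtype.ext (M.eq_of_subset_of_rank G.2.1 h1 h.le)).symm
  have hI : C.image (fun F => M.rank F.1) = Finset.Icc 1 d := by
    refine Finset.eq_of_subset_of_card_le ?_ ?_
    · intro j hj
      obtain ⟨F, hF, rfl⟩ := Finset.mem_image.1 hj
      have h1 := M.rank_proper_pos hM F
      have h2 := M.rank_proper_lt F
      rw [Finset.mem_Icc]
      omega
    · rw [Finset.card_image_of_injOn hinj, hd]; simp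
  have := chow_chain hM hα hx hrk d C hC hd hI 0 (by omega)
  simpa using this

/-- Every monomial of degree `d` is an integer multiple of `α ^ d`. -/
lemma chow_span [DecidableEq (ProperFlat M)] (hM : M.Loopless)
    (hα : ∀ a : E, α = ∑ F : ProperFlat M, if a ∈ F.1 then x F else 0)
    (hx : ∀ F G : ProperFlat M, ¬ F.1 ⊆ G.1 → ¬ G.1 ⊆ F.1 → x F * x G = 0) {d : ℕ}
    (hrk : M.rk = d + 1) :
    ∀ (n : ℕ) (s : Multiset (ProperFlat M)), s.card = d → n + s.toFinset.card = d →
      (s.map x).prod ∈ AddSubgroup.zmultiples (α ^ d) := by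
  intro n
  induction n with
  | zero =>
    intro s hs hn
    have hnd : s.Nodup := by
      rw [← Multiset.toFinset_card_eq_card_iff_nodup]; omega
    by_cases hC : ∀ F ∈ s.toFinset, ∀ G ∈ s.toFinset, F.1 ⊆ G.1 ∨ G.1 ⊆ F.1
    · have h := chow_chain_top hM hα hx hrk s.toFinset hC (by omega)
      have h2 : ∏ F ∈ s.toFinset, x F = (s.map x).prod := by
        rw [Finset.prod, Multiset.toFinset_val, hnd.dedup]
      rw [← h2, h]
      exact AddSubgroup.mem_zmultiples _
    · push Not at hC
      obtain ⟨F, hF, G, hG, h1, h2⟩ := hC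
      rw [Multiset.mem_toFinset] at hF hG
      have hne : G ≠ F := by rintro rfl; exact h1 subset_rfl
      obtain ⟨t, rfl⟩ := Multiset.exists_cons_of_mem hF
      obtain ⟨u, rfl⟩ := Multiset.exists_cons_of_mem
        ((Multiset.mem_cons.1 hG).resolve_left hne)
      rw [Multiset.map_cons, Multiset.map_cons, Multiset.prod_cons, Multiset.prod_cons,
        ← mul_assoc, hx F G h1 h2, zero_mul]
      exact zero_mem _
  | succ n ih =>
    intro s hs hn
    by_cases hC : ∀ F ∈ s, ∀ G ∈ s, F.1 ⊆ G.1 ∨ G.1 ⊆ F.1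
    · have hnd : ¬ s.Nodup := by
        rw [← Multiset.toFinset_card_eq_card_iff_nodup]; omega
      rw [Multiset.nodup_iff_ne_cons_cons] at hnd
      push Not at hnd
      obtain ⟨F, t, rfl⟩ := hnd
      -- choose a ∈ F outside all smaller members
      obtain ⟨a, haF, ha⟩ : ∃ a ∈ F.1, ∀ G ∈ F ::ₘ F ::ₘ t, G.1 ⊂ F.1 → a ∉ G.1 := by
        let L := (F ::ₘ F ::ₘ t).toFinset.filter (fun G => G.1 ⊂ F.1)
        rcases L.eq_empty_or_nonempty with hL | hL
        · obtain ⟨a, ha⟩ := Finset.nonempty_iff_ne_empty.2 F.2.2.1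
          refine ⟨a, ha, fun G hG hGF => ?_⟩
          have : G ∈ L := Finset.mem_filter.2 ⟨Multiset.mem_toFinset.2 hG, hGF⟩
          rw [hL] at this
          simp at this
        · obtain ⟨H, hH, hmax⟩ := Finset.exists_max_image L (fun G => G.1.card) hL
          obtain ⟨hHs, hHF⟩ := Finset.mem_filter.1 hH
          rw [Multiset.mem_toFinset] at hHs
          obtain ⟨a, ha, haH⟩ := Finset.exists_of_ssubset hHF
          refine ⟨a, ha, fun G hG hGF haG => ?_⟩
          have h1 := hmax G (Finset.mem_filter.2 ⟨Multiset.mem_toFinset.2 hG, hGF⟩)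
          rcases hC G hG H hHs with h2 | h2
          · exact haH (h2 haG)
          · exact haH ((Finset.eq_of_subset_of_card_le h2 h1) ▸ haG)
      obtain ⟨b, hbF, hb⟩ : ∃ b, b ∉ F.1 ∧ ∀ G ∈ F ::ₘ F ::ₘ t, F.1 ⊂ G.1 → b ∈ G.1 := by
        let L := (F ::ₘ F ::ₘ t).toFinset.filter (fun G => F.1 ⊂ G.1)
        rcases L.eq_empty_or_nonempty with hL | hL
        · obtain ⟨b, -, hb⟩ := Finset.exists_of_ssubset (Finset.ssubset_univ_iff.2 F.2.2.2)
          refine ⟨b, hb, fun G hG hGF => ?_⟩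
          have : G ∈ L := Finset.mem_filter.2 ⟨Multiset.mem_toFinset.2 hG, hGF⟩
          rw [hL] at this
          simp at this
        · obtain ⟨H, hH, hmin⟩ := Finset.exists_min_image L (fun G => G.1.card) hL
          obtain ⟨hHs, hHF⟩ := Finset.mem_filter.1 hH
          rw [Multiset.mem_toFinset] at hHs
          obtain ⟨b, hbH, hb⟩ := Finset.exists_of_ssubset hHF
          refine ⟨b, hb, fun G hG hGF => ?_⟩
          have h1 := hmin G (Finset.mem_filter.2 ⟨Multiset.mem_toFinset.2 hG, hGF⟩)
          rcases hC G hG H hHs with h2 | h2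
          · exact (Finset.eq_of_subset_of_card_le h2 h1) ▸ hbH
          · exact h2 hbH
      have hrel : x F = ∑ G : ProperFlat M, if G = F then 0 else
          ((if b ∈ G.1 then x G else 0) - (if a ∈ G.1 then x G else 0)) := by
        have h1 : ∑ G : ProperFlat M,
            ((if b ∈ G.1 then x G else 0) - (if a ∈ G.1 then x G else 0)) = 0 := by
          rw [Finset.sum_sub_distrib, ← hα, ← hα, sub_self]
        rw [← Finset.add_sum_erase _ _ (Finset.mem_univ F), if_neg hbF, if_pos haF] at h1
        rw [← Finset.add_sum_erase _ _ (Finset.mem_univ F), if_pos rfl]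
        have h2 : ∀ G ∈ Finset.univ.erase F, (if G = F then 0 else
          ((if b ∈ G.1 then x G else 0) - (if a ∈ G.1 then x G else 0))) =
          ((if b ∈ G.1 then x G else 0) - (if a ∈ G.1 then x G else 0)) := fun G hG => by
          rw [if_neg (Finset.ne_of_mem_erase hG)]
        rw [Finset.sum_congr rfl h2]
        linear_combination -h1
      rw [Multiset.map_cons, Multiset.prod_cons, hrel, Finset.sum_mul]
      refine sum_mem fun G _ => ?_
      split_ifs with h1 h2 h3 h3
      · simp
      · simp
      · -- b ∈ G, a ∉ G
        rw [sub_zero, Multiset.map_cons, Multiset.prod_cons, ← mul_assoc,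
          hx G F (fun h => hbF (h h2)) (fun h => h3 (h haF)), zero_mul]
        exact zero_mem _
      · rw [zero_sub, neg_mul]
        refine neg_mem ?_
        have hG : G ∉ F ::ₘ F ::ₘ t := by
          intro hG
          rcases hC G hG F (by simp) with h4 | h4
          · exact ha G hG (Finset.ssubset_iff_subset_ne.2 ⟨h4, fun h => h1 (Subtype.ext h)⟩) h3
          · exact h2 (hb G hG (Finset.ssubset_iff_subset_ne.2
              ⟨h4, fun h => h1 (Subtype.ext h.symm)⟩))
        have := ih (G ::ₘ F ::ₘ t) (by simpa using hs) (by
          have h5 : (G ::ₘ F ::ₘ t).toFinset = insert G (F ::ₘ F ::ₘ t).toFinset := by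
            ext H; simp
          rw [h5, Finset.card_insert_of_notMem (by rwa [Multiset.mem_toFinset])]
          omega)
        rwa [Multiset.map_cons, Multiset.prod_cons] at this
      · simp
    · push Not at hC
      obtain ⟨F, hF, G, hG, h1, h2⟩ := hC
      have hne : G ≠ F := by rintro rfl; exact h1 subset_rfl
      obtain ⟨t, rfl⟩ := Multiset.exists_cons_of_mem hF
      obtain ⟨u, rfl⟩ := Multiset.exists_cons_of_mem
        ((Multiset.mem_cons.1 hG).resolve_left hne)
      rw [Multiset.map_cons, Multiset.map_cons, Multiset.prod_cons, Multiset.prod_cons,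
        ← mul_assoc, hx F G h1 h2, zero_mul]
      exact zero_mem _

end AbstractChow

end FinMatroid

namespace FinMatroid

section DragonHallRado

set_option linter.unusedSectionVars false

variable {E : Type*} [Fintype E] [DecidableEq E] (M : FinMatroid E)

/-- The dragon Hall–Rado condition on a multiset of subsets. -/
def DHR (A : Multiset (Finset E)) : Prop :=
  ∀ B ≤ A, B ≠ 0 → B.card + 1 ≤ M.rank B.sup

variable {M}

lemma DHR.mono {A B : Multiset (Finset E)} (h : M.DHR B) (hAB : A ≤ B) : M.DHR A :=
  fun C hC => h C (hC.trans hAB)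

lemma le_cons_cases {F : Finset E} {A B : Multiset (Finset E)} (h : B ≤ F ::ₘ A) :
    B ≤ A ∨ ∃ C ≤ A, B = F ::ₘ C := by
  by_cases hF : F ∈ B
  · obtain ⟨C, rfl⟩ := Multiset.exists_cons_of_mem hF
    exact Or.inr ⟨C, (Multiset.cons_le_cons_iff F).1 h, rfl⟩
  · exact Or.inl ((Multiset.le_cons_of_notMem hF).1 h)

lemma dhr_cons {F : Finset E} {A : Multiset (Finset E)} :
    M.DHR (F ::ₘ A) ↔ M.DHR A ∧ ∀ B ≤ A, B.card + 2 ≤ M.rank (F ∪ B.sup) := by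
  constructor
  · intro h
    refine ⟨h.mono (Multiset.le_cons_self _ _), fun B hB => ?_⟩
    have := h (F ::ₘ B) ((Multiset.cons_le_cons_iff F).2 hB) (Multiset.cons_ne_zero)
    rw [Multiset.card_cons, Multiset.sup_cons, Finset.sup_eq_union] at this
    omega
  · rintro ⟨h1, h2⟩ B hB hB0
    rcases le_cons_cases hB with h | ⟨C, hC, rfl⟩
    · exact h1 B h hB0
    · have := h2 C hC
      rw [Multiset.card_cons, Multiset.sup_cons, Finset.sup_eq_union]
      omega

lemma dhr_cons_cons {F G : Finset E} {A : Multiset (Finset E)} :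
    M.DHR (F ::ₘ G ::ₘ A) ↔ M.DHR A ∧ (∀ B ≤ A, B.card + 2 ≤ M.rank (F ∪ B.sup)) ∧
      (∀ B ≤ A, B.card + 2 ≤ M.rank (G ∪ B.sup)) ∧
      (∀ B ≤ A, B.card + 3 ≤ M.rank (F ∪ G ∪ B.sup)) := by
  rw [dhr_cons, dhr_cons]
  constructor
  · rintro ⟨⟨h1, h2⟩, h3⟩
    refine ⟨h1, fun B hB => h3 B (hB.trans (Multiset.le_cons_self _ _)), h2, fun B hB => ?_⟩
    have := h3 (G ::ₘ B) ((Multiset.cons_le_cons_iff G).2 hB)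
    rw [Multiset.card_cons, Multiset.sup_cons, Finset.sup_eq_union, ← Finset.union_assoc] at this
    omega
  · rintro ⟨h1, h2, h3, h4⟩
    refine ⟨⟨h1, h3⟩, fun B hB => ?_⟩
    rcases le_cons_cases hB with h | ⟨C, hC, rfl⟩
    · exact h2 B h
    · have := h4 C hC
      rw [Multiset.card_cons, Multiset.sup_cons, Finset.sup_eq_union, ← Finset.union_assoc]
      omega

lemma rank_closure_union_eq (S T : Finset E) : M.rank (M.closure S ∪ T) = M.rank (S ∪ T) :=
  le_antisymm (M.rank_closure_union S T)
    (M.rank_mono (Finset.union_subset_union (M.subset_closure S) subset_rfl))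

lemma ind_aux {P a b c j : Prop} [Decidable (P ∧ a ∧ b ∧ c)] [Decidable (P ∧ a ∧ j ∧ c)]
    [Decidable (P ∧ b ∧ j ∧ c)] [Decidable (P ∧ j ∧ j ∧ c)] (hcj : c → j)
    (hor : P → c → a ∨ b) :
    (if P ∧ a ∧ b ∧ c then (1 : ℤ) else 0) - (if P ∧ a ∧ j ∧ c then 1 else 0)
      - (if P ∧ b ∧ j ∧ c then 1 else 0) + (if P ∧ j ∧ j ∧ c then 1 else 0) = 0 := by
  by_cases hP : P
  · by_cases hc : c
    · have hj := hcj hc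
      by_cases ha : a <;> by_cases hb : b <;> simp_all
    · simp [hc]
  · simp [hP]

open Classical in
lemma dhr_relation (F G : Finset E) (A : Multiset (Finset E)) :
    (if M.DHR (F ::ₘ G ::ₘ A) then (1 : ℤ) else 0)
      - (if M.DHR (F ::ₘ M.closure (F ∪ G) ::ₘ A) then 1 else 0)
      - (if M.DHR (G ::ₘ M.closure (F ∪ G) ::ₘ A) then 1 else 0)
      + (if M.DHR (M.closure (F ∪ G) ::ₘ M.closure (F ∪ G) ::ₘ A) then 1 else 0) = 0 := by
  set J := M.closure (F ∪ G) with hJ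
  have hFJ : F ⊆ J := Finset.subset_union_left.trans (M.subset_closure _)
  have hGJ : G ⊆ J := Finset.subset_union_right.trans (M.subset_closure _)
  have e1 : F ∪ J = J := Finset.union_eq_right.2 hFJ
  have e2 : G ∪ J = J := Finset.union_eq_right.2 hGJ
  have e3 : J ∪ J = J := Finset.union_self J
  have key : ∀ B : Multiset (Finset E), M.rank (J ∪ B.sup) = M.rank (F ∪ G ∪ B.sup) :=
    fun B => rank_closure_union_eq _ _
  have mF : ∀ B : Multiset (Finset E), M.rank (F ∪ B.sup) ≤ M.rank (J ∪ B.sup) :=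
    fun B => M.rank_mono (Finset.union_subset_union hFJ subset_rfl)
  have mG : ∀ B : Multiset (Finset E), M.rank (G ∪ B.sup) ≤ M.rank (J ∪ B.sup) :=
    fun B => M.rank_mono (Finset.union_subset_union hGJ subset_rfl)
  simp only [dhr_cons_cons, e1, e2, e3, key] at mF mG ⊢
  have hcj : (∀ B ≤ A, B.card + 3 ≤ M.rank (F ∪ G ∪ B.sup)) → ∀ B ≤ A, B.card + 2 ≤ M.rank (F ∪ G ∪ B.sup) := fun h B hB => by
    have := h B hB
    omega
  have hor : M.DHR A → (∀ B ≤ A, B.card + 3 ≤ M.rank (F ∪ G ∪ B.sup)) →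
      (∀ B ≤ A, B.card + 2 ≤ M.rank (F ∪ B.sup)) ∨ (∀ B ≤ A, B.card + 2 ≤ M.rank (G ∪ B.sup)) := by
    intro hP h
    by_contra hcon
    rw [not_or] at hcon
    obtain ⟨h1, h2⟩ := hcon
    push Not at h1 h2
    obtain ⟨B, hB, h1⟩ := h1
    obtain ⟨C, hC, h2⟩ := h2
    have h3 := h (B ∪ C) (Multiset.union_le hB hC)
    have h4 := M.rank_submod' (A := F ∪ B.sup) (B := G ∪ C.sup) (C := F ∪ G ∪ (B ∪ C).sup)
      (D := (B ∩ C).sup)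
      (by rw [Multiset.sup_union, Finset.sup_eq_union]; intro y; simp only [Finset.mem_union]; tauto)
      (Finset.Subset.trans (Multiset.sup_mono (Multiset.subset_of_le Multiset.inter_le_left))
        Finset.subset_union_right)
      (Finset.Subset.trans (Multiset.sup_mono (Multiset.subset_of_le Multiset.inter_le_right))
        Finset.subset_union_right)
    have h5 : (B ∪ C).card + (B ∩ C).card = B.card + C.card := by
      rw [← Multiset.card_add, Multiset.union_add_inter, Multiset.card_add]
    by_cases h6 : B ∩ C = 0
    · rw [h6] at h5
      simp only [Multiset.card_zero] at h5
      omega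
    · have := hP (B ∩ C) (Multiset.inter_le_left.trans hB) h6
      omega
  exact ind_aux hcj hor

variable (M)

open Classical in
/-- The functional on the polynomial ring in the `h`-variables. -/
noncomputable def dhrFun : MvPolynomial (Finset E) ℤ →ₗ[ℤ] ℤ :=
  (MvPolynomial.basisMonomials (Finset E) ℤ).constr ℤ
    (fun s => if M.DHR (Finsupp.toMultiset s) then (1 : ℤ) else 0)

open Classical in
lemma dhrFun_monomial (s : Finset E →₀ ℕ) :
    M.dhrFun (MvPolynomial.monomial s 1) = if M.DHR (Finsupp.toMultiset s) then (1 : ℤ) else 0 := by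
  have := (MvPolynomial.basisMonomials (Finset E) ℤ).constr_basis ℤ
    (fun s => if M.DHR (Finsupp.toMultiset s) then (1 : ℤ) else 0) s
  rw [MvPolynomial.coe_basisMonomials] at this
  exact this

/-- The ideal of polynomials annihilated by the functional. -/
def dhrIdeal : Ideal (MvPolynomial (Finset E) ℤ) where
  carrier := {p | ∀ q, M.dhrFun (p * q) = 0}
  add_mem' := by
    intro p q hp hq r
    rw [add_mul, map_add, hp, hq, add_zero]
  zero_mem' := by intro q; simp
  smul_mem' := by
    intro c p hp q
    rw [smul_eq_mul, mul_comm c p, mul_assoc]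
    exact hp _

lemma mem_dhrIdeal_of_monomial {p : MvPolynomial (Finset E) ℤ}
    (h : ∀ s, M.dhrFun (p * MvPolynomial.monomial s 1) = 0) : p ∈ M.dhrIdeal := by
  intro q
  induction q using MvPolynomial.induction_on' with
  | monomial s c =>
    have : MvPolynomial.monomial s c = c • MvPolynomial.monomial s (1 : ℤ) := by
      rw [MvPolynomial.smul_monomial]; simp
    rw [this, mul_smul_comm, map_smul, h, smul_zero]
  | add q r hq hr => rw [mul_add, map_add, hq, hr, add_zero]

lemma X_mul_monomial (F : Finset E) (s : Finset E →₀ ℕ) :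
    (MvPolynomial.X F * MvPolynomial.monomial s 1 : MvPolynomial (Finset E) ℤ)
      = MvPolynomial.monomial (Finsupp.single F 1 + s) 1 := by
  rw [MvPolynomial.X, MvPolynomial.monomial_mul, one_mul]

lemma X_mem_dhrIdeal (F : Finset E) (hF : M.rank F ≤ 1) :
    (MvPolynomial.X F : MvPolynomial (Finset E) ℤ) ∈ M.dhrIdeal := by
  classical
  refine M.mem_dhrIdeal_of_monomial fun s => ?_
  rw [X_mul_monomial, dhrFun_monomial, if_neg]
  rw [map_add, Finsupp.toMultiset_single, one_smul, Multiset.singleton_add, dhr_cons]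
  rintro ⟨-, h⟩
  have := h 0 (Multiset.zero_le _)
  simp at this
  omega

lemma rel_mem_dhrIdeal (F G : Finset E) :
    ((MvPolynomial.X F - MvPolynomial.X (M.closure (F ∪ G))) *
      (MvPolynomial.X G - MvPolynomial.X (M.closure (F ∪ G))) : MvPolynomial (Finset E) ℤ)
      ∈ M.dhrIdeal := by
  classical
  refine M.mem_dhrIdeal_of_monomial fun s => ?_
  set J := M.closure (F ∪ G) with hJ
  have e : ((MvPolynomial.X F - MvPolynomial.X J) * (MvPolynomial.X G - MvPolynomial.X J) *
      MvPolynomial.monomial s 1 : MvPolynomial (Finset E) ℤ) =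
      MvPolynomial.X F * (MvPolynomial.X G * MvPolynomial.monomial s 1)
      - MvPolynomial.X F * (MvPolynomial.X J * MvPolynomial.monomial s 1)
      - MvPolynomial.X G * (MvPolynomial.X J * MvPolynomial.monomial s 1)
      + MvPolynomial.X J * (MvPolynomial.X J * MvPolynomial.monomial s 1) := by ring
  rw [e]
  simp only [X_mul_monomial, map_add, map_sub, dhrFun_monomial, Finsupp.toMultiset_single,
    one_smul, Multiset.singleton_add]
  exact dhr_relation F G _

open Classical in
/-- The `x`-variables expressed in the `h`-variables. -/
noncomputable def yVar (F : Finset E) : MvPolynomial (Finset E) ℤ :=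
  - MvPolynomial.X F - ∑ G : {G : Finset E // M.IsFlat G ∧ F ⊂ G}, yVar G.1
termination_by (Fintype.card E - F.card)
decreasing_by
  have h1 := Finset.card_lt_card G.2.2
  have h2 := Finset.card_le_univ G.1
  omega

open Classical in
lemma sum_yVar {F : Finset E} (hF : M.IsFlat F) :
    ∑ G ∈ Finset.univ.filter (fun G => M.IsFlat G ∧ F ⊆ G), M.yVar G = - MvPolynomial.X F := by
  have h1 : Finset.univ.filter (fun G => M.IsFlat G ∧ F ⊆ G) =
      insert F (Finset.univ.filter (fun G => M.IsFlat G ∧ F ⊂ G)) := by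
    ext G
    simp only [Finset.mem_filter, Finset.mem_univ, true_and, Finset.mem_insert,
      Finset.ssubset_iff_subset_ne]
    by_cases h : G = F
    · subst h; simp [hF]
    · simp only [h, false_or, ne_eq, Ne.symm h, not_false_eq_true, and_true]
  rw [h1, Finset.sum_insert (by simp), yVar]
  have h2 : ∑ G : {G : Finset E // M.IsFlat G ∧ F ⊂ G}, M.yVar G.1 =
      ∑ G ∈ Finset.univ.filter (fun G => M.IsFlat G ∧ F ⊂ G), M.yVar G := by
    symm
    exact Finset.sum_subtype _ (by simp) _
  rw [h2]
  ring

lemma yVar_mul_mem : ∀ (n : ℕ) (F G : Finset E), M.IsFlat F → M.IsFlat G → ¬ F ⊆ G → ¬ G ⊆ F →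
    n + F.card + G.card = 2 * Fintype.card E → M.yVar F * M.yVar G ∈ M.dhrIdeal := by
  classical
  intro n
  induction n using Nat.strong_induction_on with
  | _ n ih =>
  intro F G hF hG h1 h2 hn
  set J := M.closure (F ∪ G) with hJ
  have hJF : M.IsFlat J := M.isFlat_closure _
  have hdiff : ∀ F G : Finset E, M.IsFlat F → F ⊆ G → M.IsFlat G → 
      (MvPolynomial.X F - MvPolynomial.X G : MvPolynomial (Finset E) ℤ) = 
      - ∑ H ∈ Finset.univ.filter (fun H => M.IsFlat H ∧ F ⊆ H ∧ ¬ G ⊆ H), M.yVar H := by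
    intro F G hF hFG hG
    have h3 := M.sum_yVar hF
    have h4 := M.sum_yVar hG
    rw [← Finset.sum_filter_add_sum_filter_not _ (fun H => G ⊆ H), Finset.filter_filter,
      Finset.filter_filter] at h3
    have h5 : Finset.univ.filter (fun H => (M.IsFlat H ∧ F ⊆ H) ∧ G ⊆ H) =
        Finset.univ.filter (fun H => M.IsFlat H ∧ G ⊆ H) := by
      ext H
      simp only [Finset.mem_filter, Finset.mem_univ, true_and]
      exact ⟨fun h => ⟨h.1.1, h.2⟩, fun h => ⟨⟨h.1, hFG.trans h.2⟩, h.2⟩⟩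
    rw [h5, h4] at h3
    simp only [and_assoc] at h3
    linear_combination h3
  have hFJ : F ⊆ J := Finset.subset_union_left.trans (M.subset_closure _)
  have hGJ : G ⊆ J := Finset.subset_union_right.trans (M.subset_closure _)
  have hJsub : ∀ H, M.IsFlat H → (J ⊆ H ↔ F ⊆ H ∧ G ⊆ H) := fun H hH => by
    rw [hJ, M.closure_subset_iff hH, Finset.union_subset_iff]
  have hrel := M.rel_mem_dhrIdeal F G
  rw [← hJ, hdiff F J hF hFJ hJF, hdiff G J hG hGJ hJF, neg_mul_neg, Finset.sum_mul_sum,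
    ← Finset.sum_product'] at hrel
  rw [← Finset.add_sum_erase _ _ (a := (F, G)) (by
    simp only [Finset.mem_product, Finset.mem_filter, Finset.mem_univ, true_and]
    refine ⟨⟨hF, subset_rfl, fun h => h2 (hGJ.trans h)⟩, ⟨hG, subset_rfl, fun h => h1 (hFJ.trans h)⟩⟩)]
    at hrel
  refine (Ideal.add_mem_iff_left _ ?_).1 hrel
  refine Ideal.sum_mem _ fun p hp => ?_
  obtain ⟨H, K⟩ := p
  simp only [Finset.mem_erase, Finset.mem_product, Finset.mem_filter, Finset.mem_univ,
    true_and, ne_eq] at hp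
  obtain ⟨hne, ⟨hH, hFH, hJH⟩, ⟨hK, hGK, hJK⟩⟩ := hp
  rw [hJsub H hH] at hJH
  rw [hJsub K hK] at hJK
  have c1 := Finset.card_le_card hFH
  have c2 := Finset.card_le_card hGK
  have c3 := Finset.card_le_univ H
  have c4 := Finset.card_le_univ K
  have c5 : F.card < H.card ∨ G.card < K.card := by
    by_contra hcon
    push Not at hcon
    exact hne (Prod.ext (Finset.eq_of_subset_of_card_le hFH hcon.1).symm
      (Finset.eq_of_subset_of_card_le hGK hcon.2).symm)
  refine ih (2 * Fintype.card E - H.card - K.card) (by omega) H K hH hK ?_ ?_ (by omega)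
  · intro h
    exact hJK ⟨hFH.trans h, hGK⟩
  · intro h
    exact hJH ⟨hFH, hGK.trans h⟩

lemma yVar_sum_mem (a : E) :
    (∑ F : ProperFlat M, if a ∈ F.1 then M.yVar F.1 else 0) =
      MvPolynomial.X Finset.univ - MvPolynomial.X (M.closure {a}) := by
  classical
  have h1 := M.sum_yVar (M.isFlat_closure {a})
  have h2 := M.sum_yVar M.isFlat_univ
  have h3 : Finset.univ.filter (fun G => M.IsFlat G ∧ Finset.univ ⊆ G) = {Finset.univ} := by
    ext G
    simp only [Finset.mem_filter, Finset.mem_univ, true_and, Finset.mem_singleton,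
      Finset.univ_subset_iff]
    exact ⟨fun h => h.2, fun h => ⟨h ▸ M.isFlat_univ, h⟩⟩
  rw [h3, Finset.sum_singleton] at h2
  have h4 : (∑ F : ProperFlat M, if a ∈ F.1 then M.yVar F.1 else 0) =
      ∑ G ∈ Finset.univ.filter (fun G => M.IsFlat G ∧ G ≠ ∅ ∧ G ≠ Finset.univ),
        if a ∈ G then M.yVar G else 0 := by
    symm
    exact Finset.sum_subtype _ (by simp) (fun G => if a ∈ G then M.yVar G else 0)
  rw [h4, ← Finset.sum_filter, Finset.filter_filter]
  have h5 : Finset.univ.filter (fun G => M.IsFlat G ∧ M.closure {a} ⊆ G) =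
      insert Finset.univ (Finset.univ.filter
        (fun G => (M.IsFlat G ∧ G ≠ ∅ ∧ G ≠ Finset.univ) ∧ a ∈ G)) := by
    ext G
    simp only [Finset.mem_filter, Finset.mem_univ, true_and, Finset.mem_insert]
    constructor
    · rintro ⟨hG, h⟩
      rw [M.closure_subset_iff hG, Finset.singleton_subset_iff] at h
      by_cases hu : G = Finset.univ
      · exact Or.inl hu
      · exact Or.inr ⟨⟨hG, Finset.nonempty_iff_ne_empty.1 ⟨a, h⟩, hu⟩, h⟩
    · rintro (rfl | ⟨⟨hG, -, -⟩, h⟩)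
      · exact ⟨M.isFlat_univ, Finset.subset_univ _⟩
      · exact ⟨hG, (M.closure_subset_iff hG).2 (Finset.singleton_subset_iff.2 h)⟩
  rw [h5, Finset.sum_insert (by simp), h2] at h1
  linear_combination h1

/-- The substitution of the `x`-variables. -/
noncomputable def yHom : MvPolynomial (ProperFlat M) ℤ →ₐ[ℤ] MvPolynomial (Finset E) ℤ :=
  MvPolynomial.aeval (fun F => M.yVar F.1)

lemma yHom_alpha (a : E) :
    M.yHom (∑ F : ProperFlat M, if a ∈ F.1 then MvPolynomial.X F else 0) =
      MvPolynomial.X Finset.univ - MvPolynomial.X (M.closure {a}) := by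
  rw [← yVar_sum_mem, map_sum]
  refine Finset.sum_congr rfl fun F _ => ?_
  split_ifs <;> simp [yHom]

lemma X_closure_mem (a : E) :
    (MvPolynomial.X (M.closure {a}) : MvPolynomial (Finset E) ℤ) ∈ M.dhrIdeal :=
  M.X_mem_dhrIdeal _ (by rw [rank_closure]; exact M.rank_singleton_le a)

lemma chowIdeal_le : chowIdeal ℤ M ≤ M.dhrIdeal.comap M.yHom := by
  rw [chowIdeal, Ideal.span_le]
  rintro p (⟨⟨a, b⟩, rfl⟩ | ⟨F, G, h1, h2, rfl⟩)
  · simp only [SetLike.mem_coe, Ideal.mem_comap]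
    rw [map_sub, yHom_alpha, yHom_alpha]
    have := sub_mem (M.X_closure_mem b) (M.X_closure_mem a)
    convert this using 1
    ring
  · simp only [SetLike.mem_coe, Ideal.mem_comap, map_mul]
    have c1 := Finset.card_le_univ F.1
    have c2 := Finset.card_le_univ G.1
    have := M.yVar_mul_mem (2 * Fintype.card E - F.1.card - G.1.card) F.1 G.1 F.2.1 G.2.1 h1 h2
      (by omega)
    simpa [yHom] using this

lemma dhrFun_alpha_pow (a : E) (d : ℕ) (hrk : M.rk = d + 1) :
    M.dhrFun (M.yHom ((∑ F : ProperFlat M, if a ∈ F.1 then MvPolynomial.X F else 0) ^ d)) = 1 := by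
  classical
  rw [map_pow, yHom_alpha]
  have h1 : ((MvPolynomial.X Finset.univ - MvPolynomial.X (M.closure {a})) ^ d
      - MvPolynomial.X Finset.univ ^ d : MvPolynomial (Finset E) ℤ) ∈ M.dhrIdeal := by
    refine Ideal.mem_of_dvd _ (sub_dvd_pow_sub_pow _ _ d) ?_
    have := neg_mem (M.X_closure_mem a)
    convert this using 1
    ring
  have h2 := h1 1
  rw [mul_one, map_sub, sub_eq_zero] at h2
  rw [h2, MvPolynomial.X_pow_eq_monomial, dhrFun_monomial, if_pos]
  rw [Finsupp.toMultiset_single]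
  intro B hB hB0
  have h3 := Multiset.card_le_card hB
  rw [Multiset.card_nsmul, Multiset.card_singleton] at h3
  obtain ⟨F, hF⟩ := Multiset.exists_mem_of_ne_zero hB0
  have h4 : F = Finset.univ := by
    have := Multiset.mem_of_le hB hF
    rw [Multiset.nsmul_singleton] at this
    exact Multiset.eq_of_mem_replicate this
  subst h4
  have h5 : M.rk ≤ M.rank B.sup := M.rank_mono (Multiset.le_sup hF)
  omega

lemma exists_degree : ∃ f : ChowRing ℤ M →+ ℤ, ∀ p, f (chowMk ℤ M p) = M.dhrFun (M.yHom p) := by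
  refine ⟨QuotientAddGroup.lift (chowIdeal ℤ M).toAddSubgroup
    (M.dhrFun.toAddMonoidHom.comp M.yHom.toRingHom.toAddMonoidHom) ?_, fun p => rfl⟩
  intro p hp
  have := M.chowIdeal_le hp 1
  rw [mul_one] at this
  exact this

end DragonHallRado

end FinMatroid

set_option synthInstance.maxHeartbeats 1000000 in
set_option maxHeartbeats 1000000 in
open FinMatroid in
/-- For a loopless matroid `M` of rank `d+1`, there is a unique group isomorphism
`deg : A^d(M) → ℤ` with `deg(x_{F_1} ⋯ x_{F_d}) = 1` for every complete flag
`F_1 ⊊ ⋯ ⊊ F_d` of nonempty proper flats of `M`. -/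
theorem degree_map_exists_unique {E : Type*} [Fintype E] [DecidableEq E]
    (M : FinMatroid E) (hM : M.Loopless) (d : ℕ) (hrk : M.rk = d + 1) :
    ∃! deg : (piece ℤ M d) →+ ℤ,
      Function.Bijective deg ∧
      ∀ flag : Fin d → ProperFlat M, (∀ i j : Fin d, i < j → (flag i).1 ⊂ (flag j).1) →
        deg ⟨chowMk ℤ M (∏ i, MvPolynomial.X (flag i)), flagMonomial_mem ℤ M d flag⟩ = 1 := by
  classical
  -- the ground set is nonempty
  have hE : Nonempty E := by
    by_contra h
    rw [not_nonempty_iff] at h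
    have h1 := M.rank_le_card Finset.univ
    change M.rk ≤ _ at h1
    rw [Finset.univ_eq_empty, Finset.card_empty] at h1
    omega
  obtain ⟨e⟩ := hE
  let A : E → MvPolynomial (ProperFlat M) ℤ := fun a =>
    ∑ F : ProperFlat M, if a ∈ F.1 then MvPolynomial.X F else 0
  let x : ProperFlat M → ChowRing ℤ M := fun F => chowMk ℤ M (MvPolynomial.X F)
  have hker : ∀ p ∈ chowIdeal ℤ M, chowMk ℤ M p = 0 := fun p hp =>
    Ideal.Quotient.eq_zero_iff_mem.2 hp
  have hα : ∀ a : E, chowMk ℤ M (A e) = ∑ F : ProperFlat M, if a ∈ F.1 then x F else 0 := by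
    intro a
    have h1 : chowMk ℤ M (A a) = ∑ F : ProperFlat M, if a ∈ F.1 then x F else 0 := by
      simp only [A, map_sum]
      refine Finset.sum_congr rfl fun F _ => ?_
      split_ifs <;> simp [x]
    rw [← h1, ← sub_eq_zero, ← map_sub]
    exact hker _ (Ideal.subset_span (Or.inl ⟨(e, a), rfl⟩))
  have hx : ∀ F G : ProperFlat M, ¬ F.1 ⊆ G.1 → ¬ G.1 ⊆ F.1 → x F * x G = 0 := by
    intro F G h1 h2
    simp only [x]
    rw [← map_mul]
    exact hker _ (Ideal.subset_span (Or.inr ⟨F, G, h1, h2, rfl⟩))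
  have hAhom : (A e).IsHomogeneous 1 := by
    refine MvPolynomial.IsHomogeneous.sum _ _ _ fun F _ => ?_
    split_ifs
    · exact MvPolynomial.isHomogeneous_X _ _
    · exact MvPolynomial.isHomogeneous_zero _ _ _
  let α : piece ℤ M d := ⟨chowMk ℤ M (A e) ^ d, pow_mem_piece ℤ (mk_mem_piece ℤ hAhom) d⟩
  have hflag : ∀ flag : Fin d → ProperFlat M, (∀ i j : Fin d, i < j → (flag i).1 ⊂ (flag j).1) →
      (⟨chowMk ℤ M (∏ i, MvPolynomial.X (flag i)), flagMonomial_mem ℤ M d flag⟩ : piece ℤ M d)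
        = α := by
    intro flag hf
    refine Subtype.ext ?_
    change chowMk ℤ M (∏ i, MvPolynomial.X (flag i)) = chowMk ℤ M (A e) ^ d
    have hinj : Function.Injective flag := by
      intro i j hij
      rcases lt_trichotomy i j with h | h | h
      · exact absurd (congrArg Subtype.val hij) (hf i j h).ne
      · exact h
      · exact absurd (congrArg Subtype.val hij).symm (hf j i h).ne
    rw [← chow_chain_top hM hα hx hrk (Finset.univ.image flag) ?_ ?_, map_prod,
      Finset.prod_image hinj.injOn]
    · intro F hF G hG
      obtain ⟨i, -, rfl⟩ := Finset.mem_image.1 hF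
      obtain ⟨j, -, rfl⟩ := Finset.mem_image.1 hG
      rcases lt_trichotomy i j with h | h | h
      · exact Or.inl (hf i j h).1
      · subst h; exact Or.inl subset_rfl
      · exact Or.inr (hf j i h).1
    · rw [Finset.card_image_of_injective _ hinj]; simp
  have hspan : ∀ z : piece ℤ M d, ∃ n : ℤ, n • α = z := by
    rintro ⟨z, p, hp, rfl⟩
    have hz : chowMk ℤ M p ∈ AddSubgroup.zmultiples (chowMk ℤ M (A e) ^ d) := by
      have hsum : chowMk ℤ M p = ∑ s ∈ p.support,
          chowMk ℤ M (MvPolynomial.monomial s (MvPolynomial.coeff s p)) := by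
        conv_lhs => rw [p.as_sum]
        exact map_sum _ _ _
      rw [hsum]
      refine AddSubgroup.sum_mem _ fun s hs => ?_
      have hdeg : s.degree = d := by
        have h0 := (MvPolynomial.mem_homogeneousSubmodule _ _).1 hp
          (MvPolynomial.mem_support_iff.1 hs)
        rw [Finsupp.degree_eq_weight_one]
        exact h0
      have h1 : (MvPolynomial.monomial s (MvPolynomial.coeff s p))
          = (MvPolynomial.coeff s p) • (MvPolynomial.monomial s (1 : ℤ)) := by
        rw [MvPolynomial.smul_monomial]; simp
      rw [h1, map_zsmul]
      refine AddSubgroup.zsmul_mem _ ?_ _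
      have h2 : chowMk ℤ M (MvPolynomial.monomial s (1 : ℤ)) =
          ((Finsupp.toMultiset s).map x).prod := by
        rw [MvPolynomial.monomial_eq, map_one, one_mul, Finsupp.toMultiset_map,
          Finsupp.prod_toMultiset, Finsupp.prod_mapDomain_index (by simp)
            (fun _ _ _ => pow_add _ _ _), Finsupp.prod, map_prod]
        exact Finset.prod_congr rfl fun F _ => map_pow _ _ _
      rw [h2]
      have h3 : (Finsupp.toMultiset s).card = d := by
        rw [Finsupp.card_toMultiset]; exact hdeg
      have h4 := Multiset.toFinset_card_le (Finsupp.toMultiset s)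
      exact chow_span hM hα hx hrk (d - (Finsupp.toMultiset s).toFinset.card) _ h3 (by omega)
    obtain ⟨n, hn⟩ := AddSubgroup.mem_zmultiples_iff.1 hz
    exact ⟨n, Subtype.ext hn⟩
  obtain ⟨f, hf⟩ := M.exists_degree
  let deg : piece ℤ M d →+ ℤ := f.comp (piece ℤ M d).subtype.toAddMonoidHom
  have hdegα : deg α = 1 := by
    have h1 : deg α = f (chowMk ℤ M (A e ^ d)) := by
      rw [map_pow]; rfl
    rw [h1, hf]
    exact M.dhrFun_alpha_pow e d hrk
  refine ⟨deg, ⟨⟨?_, ?_⟩, ?_⟩, ?_⟩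
  · rw [injective_iff_map_eq_zero]
    intro z hz
    obtain ⟨n, rfl⟩ := hspan z
    rw [map_zsmul, hdegα, smul_eq_mul, mul_one] at hz
    rw [hz, zero_smul]
  · intro n
    exact ⟨n • α, by rw [map_zsmul, hdegα, smul_eq_mul, mul_one]⟩
  · intro flag h
    rw [hflag flag h, hdegα]
  · rintro deg' ⟨-, h'⟩
    obtain ⟨flag, hfl⟩ := M.exists_flag d hrk
    have h1 := h' flag hfl
    rw [hflag flag hfl] at h1
    ext z
    obtain ⟨n, rfl⟩ := hspan z
    rw [map_zsmul, map_zsmul, h1, hdegα]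
end
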